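/- (Boundary comparison principle for Robin solutions) Let (Ω,σ) be a bounded one-sided NTA pair of mixed dimension in ℝ^n with n ≥ 3 and let a > 0. There exist constants C > 0 and K̃ > 1, depending only on the geometric constants (not on a), such that the following holds: for every Q ∈ ∂Ω and 0 < r < diam(Ω)/K̃, if u and v are nonnegative weak solutions of the homogeneous Robin problem in B(Q, K̃r) (with parameter a), then for every corkscrew point A for B(Q,r) and every X ∈ Ω ∩ B(Q,r): C^{−1}·u(X)·v(A) ≤ u(A)·v(X) ≤ C·u(X)·v(A). -/

import Mathlib

open MeasureTheory Metric Set
open scoped RealInnerProductSpace ENNReal NNReal Topology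

noncomputable section

/-- The (second-order) Laplacian-based notion of harmonicity: `u` is `C²` near each point of `S`
and its Laplacian (the sum of pure second derivatives) vanishes on `S`. -/
def IsHarmonicOn {n : ℕ} (u : EuclideanSpace ℝ (Fin n) → ℝ)
    (S : Set (EuclideanSpace ℝ (Fin n))) : Prop :=
  ∀ x ∈ S, ContDiffAt ℝ 2 u x ∧
    ∑ i : Fin n, iteratedFDeriv ℝ 2 u x ![EuclideanSpace.single i (1 : ℝ),
      EuclideanSpace.single i (1 : ℝ)] = 0

/-- One-sided NTA conditions (C1) interior corkscrew and (C2) Harnack chains, with constant `M`. -/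
structure IsOneSidedNTA {n : ℕ} (M : ℝ) (Ω : Set (EuclideanSpace ℝ (Fin n))) : Prop where
  isOpen : IsOpen Ω
  M_gt_one : 1 < M
  corkscrew : ∀ Q ∈ frontier Ω, ∀ r : ℝ, 0 < r → r < Metric.diam Ω / 10 →
    ∃ A ∈ Ω ∩ ball Q r, r / M ≤ infDist A (frontier Ω)
  harnack : ∀ r ε : ℝ, ∀ k : ℕ, 0 < r → r < Metric.diam Ω / 10 → 0 < ε → 1 ≤ k →
    ∀ x ∈ Ω, ∀ y ∈ Ω, dist x y = r → ε ≤ infDist x (frontier Ω) →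
      ε ≤ infDist y (frontier Ω) → r ≤ 2 ^ k * ε →
      ∃ (c : ℕ → EuclideanSpace ℝ (Fin n)) (ρ : ℕ → ℝ),
        c 1 = x ∧ c ⌈M * (k : ℝ)⌉₊ = y ∧
        ∀ i : ℕ, 1 ≤ i → i ≤ ⌈M * (k : ℝ)⌉₊ →
          0 < ρ i ∧ ρ i ≤ infDist (c i) (frontier Ω) / 10 ∧ ball (c i) (ρ i) ⊆ Ω ∧
          (i < ⌈M * (k : ℝ)⌉₊ → c (i + 1) ∈ ball (c i) (ρ i))

/-- A bounded one-sided NTA pair of mixed dimension, with geometric constants `M, Cσ, d, cd`. -/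
structure IsMixedPair {n : ℕ} (M Cσ d cd : ℝ) (Ω : Set (EuclideanSpace ℝ (Fin n)))
    (σ : Measure (EuclideanSpace ℝ (Fin n))) : Prop where
  nta : IsOneSidedNTA M Ω
  bounded : Bornology.IsBounded Ω
  nonempty : Ω.Nonempty
  supp_pos : ∀ Q ∈ frontier Ω, ∀ r : ℝ, 0 < r → 0 < σ (ball Q r)
  null_outside : σ (frontier Ω)ᶜ = 0
  finite : σ (frontier Ω) ≠ ⊤
  Cσ_pos : 0 < Cσ
  doubling : ∀ Q ∈ frontier Ω, ∀ r : ℝ, 0 < r → r < Metric.diam Ω →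
    (σ (ball Q (2 * r))).toReal ≤ Cσ * (σ (ball Q r)).toReal
  d_gt : (n : ℝ) - 2 < d
  cd_pos : 0 < cd
  lower_dim : ∀ Q ∈ frontier Ω, ∀ r s : ℝ, 0 < s → s < r → r < Metric.diam Ω →
    cd * (r / s) ^ d * (σ (ball Q s)).toReal ≤ (σ (ball Q r)).toReal

/-- A Robin Green function for the Laplacian on `(Ω, σ)` with parameter `a`. -/
structure IsRobinGreen {n : ℕ} (Ω : Set (EuclideanSpace ℝ (Fin n)))
    (σ : Measure (EuclideanSpace ℝ (Fin n))) (a : ℝ)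
    (G : EuclideanSpace ℝ (Fin n) → EuclideanSpace ℝ (Fin n) → ℝ) : Prop where
  symm : ∀ X ∈ Ω, ∀ Y ∈ Ω, X ≠ Y → G X Y = G Y X
  nonneg : ∀ Y ∈ Ω, ∀ X ∈ closure Ω \ {Y}, 0 ≤ G X Y
  contOn : ∀ Y ∈ Ω, ContinuousOn (fun X => G X Y) (closure Ω \ {Y})
  harmonic : ∀ Y ∈ Ω, IsHarmonicOn (fun X => G X Y) (Ω \ {Y})
  grad_L2 : ∀ Y ∈ Ω, ∀ r : ℝ, 0 < r →
    IntegrableOn (fun X => ‖gradient (fun Z => G Z Y) X‖ ^ 2) (Ω \ ball Y r) volume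
  grad_L1 : ∀ Y ∈ Ω, IntegrableOn (fun X => ‖gradient (fun Z => G Z Y) X‖) Ω volume
  weak : ∀ Y ∈ Ω, ∀ φ : EuclideanSpace ℝ (Fin n) → ℝ,
    ContDiff ℝ (⊤ : ℕ∞) φ → HasCompactSupport φ →
    (∫ X in Ω, ⟪gradient (fun Z => G Z Y) X, gradient φ X⟫) +
      a * ∫ P in frontier Ω, G P Y * φ P ∂σ = φ Y

/-- A Dirichlet Green function for the Laplacian on `Ω`. -/
structure IsDirichletGreen {n : ℕ} (Ω : Set (EuclideanSpace ℝ (Fin n)))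
    (G : EuclideanSpace ℝ (Fin n) → EuclideanSpace ℝ (Fin n) → ℝ) : Prop where
  nonneg : ∀ Y ∈ Ω, ∀ X ∈ closure Ω \ {Y}, 0 ≤ G X Y
  contOn : ∀ Y ∈ Ω, ContinuousOn (fun X => G X Y) (closure Ω \ {Y})
  boundary_zero : ∀ Y ∈ Ω, ∀ Q ∈ frontier Ω, G Q Y = 0
  harmonic : ∀ Y ∈ Ω, IsHarmonicOn (fun X => G X Y) (Ω \ {Y})
  grad_L2 : ∀ Y ∈ Ω, ∀ r : ℝ, 0 < r →
    IntegrableOn (fun X => ‖gradient (fun Z => G Z Y) X‖ ^ 2) (Ω \ ball Y r) volume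
  grad_L1 : ∀ Y ∈ Ω, IntegrableOn (fun X => ‖gradient (fun Z => G Z Y) X‖) Ω volume
  weak : ∀ Y ∈ Ω, ∀ φ : EuclideanSpace ℝ (Fin n) → ℝ,
    ContDiff ℝ (⊤ : ℕ∞) φ → HasCompactSupport φ → tsupport φ ⊆ Ω →
    (∫ X in Ω, ⟪gradient (fun Z => G Z Y) X, gradient φ X⟫) = φ Y

/-- A solution with pole at `Y` and vanishing Robin condition (parameter `a`). -/
structure IsRobinPoleSolution {n : ℕ} (Ω : Set (EuclideanSpace ℝ (Fin n)))
    (σ : Measure (EuclideanSpace ℝ (Fin n))) (a : ℝ) (Y : EuclideanSpace ℝ (Fin n))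
    (u : EuclideanSpace ℝ (Fin n) → ℝ) : Prop where
  contOn : ContinuousOn u (closure Ω \ {Y})
  harmonic : IsHarmonicOn u (Ω \ {Y})
  grad_L2 : ∀ r : ℝ, 0 < r → IntegrableOn (fun X => ‖gradient u X‖ ^ 2) (Ω \ ball Y r) volume
  weak : ∀ φ : EuclideanSpace ℝ (Fin n) → ℝ,
    ContDiff ℝ (⊤ : ℕ∞) φ → HasCompactSupport φ → Y ∉ tsupport φ →
    (∫ X in Ω, ⟪gradient u X, gradient φ X⟫) + a * ∫ P in frontier Ω, u P * φ P ∂σ = 0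

/-- A nonnegative weak solution of the homogeneous Robin problem in `B(Q, ρ)` (parameter `a`). -/
structure IsRobinLocalSolution {n : ℕ} (Ω : Set (EuclideanSpace ℝ (Fin n)))
    (σ : Measure (EuclideanSpace ℝ (Fin n))) (a : ℝ) (Q : EuclideanSpace ℝ (Fin n)) (ρ : ℝ)
    (u : EuclideanSpace ℝ (Fin n) → ℝ) : Prop where
  nonneg : ∀ X ∈ closure Ω ∩ ball Q ρ, 0 ≤ u X
  contOn : ContinuousOn u (closure Ω ∩ ball Q ρ)
  harmonic : IsHarmonicOn u (Ω ∩ ball Q ρ)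
  grad_L2 : ∀ ρ' : ℝ, ρ' < ρ →
    IntegrableOn (fun X => ‖gradient u X‖ ^ 2) (Ω ∩ ball Q ρ') volume
  weak : ∀ φ : EuclideanSpace ℝ (Fin n) → ℝ,
    ContDiff ℝ (⊤ : ℕ∞) φ → HasCompactSupport φ → tsupport φ ⊆ ball Q ρ →
    (∫ X in Ω, ⟪gradient u X, gradient φ X⟫) + a * ∫ P in frontier Ω, u P * φ P ∂σ = 0

/-- A flux solution: `u = 1` on `cl B(0,1)`, harmonic outside, homogeneous Robin condition. -/
structure IsFluxSolution {n : ℕ} (Ω : Set (EuclideanSpace ℝ (Fin n)))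
    (σ : Measure (EuclideanSpace ℝ (Fin n))) (a : ℝ)
    (u : EuclideanSpace ℝ (Fin n) → ℝ) : Prop where
  contOn : ContinuousOn u (closure Ω)
  one_on_ball : ∀ X ∈ closedBall (0 : EuclideanSpace ℝ (Fin n)) 1, u X = 1
  harmonic : IsHarmonicOn u (Ω \ closedBall (0 : EuclideanSpace ℝ (Fin n)) 1)
  grad_L2 : IntegrableOn (fun X => ‖gradient u X‖ ^ 2)
    (Ω \ closedBall (0 : EuclideanSpace ℝ (Fin n)) 1) volume
  weak : ∀ φ : EuclideanSpace ℝ (Fin n) → ℝ,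
    ContDiff ℝ (⊤ : ℕ∞) φ → HasCompactSupport φ →
    tsupport φ ⊆ (closedBall (0 : EuclideanSpace ℝ (Fin n)) 1)ᶜ →
    (∫ X in Ω, ⟪gradient u X, gradient φ X⟫) + a * ∫ P in frontier Ω, u P * φ P ∂σ = 0

/-- A Dirichlet harmonic measure for `Ω`: a family of probability measures on `∂Ω` solving the
Dirichlet problem for continuous boundary data. -/
structure IsDirichletHM {n : ℕ} (Ω : Set (EuclideanSpace ℝ (Fin n)))
    (ω : EuclideanSpace ℝ (Fin n) → Measure (EuclideanSpace ℝ (Fin n))) : Prop where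
  prob : ∀ X ∈ Ω, IsProbabilityMeasure (ω X)
  supported : ∀ X ∈ Ω, (ω X) (frontier Ω)ᶜ = 0
  solves : ∀ f : EuclideanSpace ℝ (Fin n) → ℝ, ContinuousOn f (frontier Ω) →
    ∃ h : EuclideanSpace ℝ (Fin n) → ℝ,
      ContinuousOn h (closure Ω) ∧ IsHarmonicOn h Ω ∧
      (∀ X ∈ Ω, h X = ∫ y, f y ∂(ω X)) ∧ (∀ Q ∈ frontier Ω, h Q = f Q)

end


open MeasureTheory Metric Set
open scoped RealInnerProductSpace ENNReal NNReal Topology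

lemma rb_cutoff {n : ℕ} {K U : Set (EuclideanSpace ℝ (Fin n))} (hK : IsCompact K)
    (hU : IsOpen U) (h : K ⊆ U) :
    ∃ χ : EuclideanSpace ℝ (Fin n) → ℝ, ContDiff ℝ (⊤ : ℕ∞) χ ∧ HasCompactSupport χ ∧
      tsupport χ ⊆ U ∧ (∀ᶠ x in 𝓝ˢ K, χ x = 1) ∧ ∀ x, χ x ∈ Icc (0 : ℝ) 1 := by
  obtain ⟨L, hL, hKL, hLU⟩ := exists_compact_between hK hU h
  obtain ⟨f, h1, h0, hf⟩ := exists_contMDiffMap_one_nhds_of_subset_interior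
    (n := (⊤ : ℕ∞)) (modelWithCornersSelf ℝ (EuclideanSpace ℝ (Fin n))) hK.isClosed hKL
  have hs : tsupport f ⊆ L := by
    apply closure_minimal _ hL.isClosed
    intro x hx
    by_contra hxL
    exact hx (h0 x hxL)
  exact ⟨f, f.contMDiff.contDiff, HasCompactSupport.intro hL h0, hs.trans hLU, h1, hf⟩

lemma rb_extend {n : ℕ} (m : ℕ) {K U : Set (EuclideanSpace ℝ (Fin n))} (hK : IsCompact K)
    (hU : IsOpen U) (h : K ⊆ U) {w : EuclideanSpace ℝ (Fin n) → ℝ}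
    (hw : ∀ x ∈ U, ContDiffAt ℝ m w x) :
    ∃ g : EuclideanSpace ℝ (Fin n) → ℝ, ContDiff ℝ m g ∧ HasCompactSupport g ∧
      ∀ᶠ x in 𝓝ˢ K, g x = w x := by
  obtain ⟨χ, h1, h2, h3, h4, h5⟩ := rb_cutoff hK hU h
  refine ⟨fun x => χ x * w x, ?_, h2.mul_right, ?_⟩
  · rw [contDiff_iff_contDiffAt]
    intro x
    by_cases hx : x ∈ U
    · exact (h1.contDiffAt.of_le (by exact_mod_cast le_top)).mul (hw x hx)
    · have hx' : x ∉ tsupport χ := fun h => hx (h3 h)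
      have : (fun x => χ x * w x) =ᶠ[𝓝 x] fun _ => 0 := by
        filter_upwards [notMem_tsupport_iff_eventuallyEq.1 hx'] with y hy
        simp [hy]
      exact contDiffAt_const.congr_of_eventuallyEq this
  · filter_upwards [h4] with x hx
    simp [hx]

lemma rb_inner_grad {n : ℕ} (f g : EuclideanSpace ℝ (Fin n) → ℝ) (x : EuclideanSpace ℝ (Fin n)) :
    ⟪gradient f x, gradient g x⟫ = ∑ i : Fin n, fderiv ℝ f x (EuclideanSpace.single i (1 : ℝ)) *
      fderiv ℝ g x (EuclideanSpace.single i (1 : ℝ)) := by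
  rw [← (EuclideanSpace.basisFun (Fin n) ℝ).sum_inner_mul_inner]
  refine Finset.sum_congr rfl fun i _ => ?_
  rw [inner_gradient_left, inner_gradient_right]
  simp

lemma rb_norm_grad {n : ℕ} (f : EuclideanSpace ℝ (Fin n) → ℝ) (x : EuclideanSpace ℝ (Fin n)) :
    ‖gradient f x‖ = ‖fderiv ℝ f x‖ := by
  rw [← toDual_gradient, LinearIsometryEquiv.norm_map]

lemma rb_weak {n : ℕ} {U : Set (EuclideanSpace ℝ (Fin n))} (hU : IsOpen U)
    {w θ : EuclideanSpace ℝ (Fin n) → ℝ} (hw : IsHarmonicOn w U) (hθ : ContDiff ℝ 1 θ)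
    (hc : HasCompactSupport θ) (hs : tsupport θ ⊆ U) :
    ∫ x, ⟪gradient w x, gradient θ x⟫ = 0 := by
  obtain ⟨g, g1, g2, g3⟩ := rb_extend 2 hc hU hs (fun x hx => (hw x hx).1)
  have g3' : ∀ x ∈ tsupport θ, g =ᶠ[𝓝 x] w := fun x hx =>
    (eventually_nhdsSet_iff_forall.1 g3 x hx)
  have e1 : ∀ x, ⟪gradient w x, gradient θ x⟫ =
      ∑ i : Fin n, fderiv ℝ g x (EuclideanSpace.single i (1 : ℝ)) *
      fderiv ℝ θ x (EuclideanSpace.single i (1 : ℝ)) := by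
    intro x
    by_cases hx : x ∈ tsupport θ
    · rw [rb_inner_grad, (g3' x hx).fderiv_eq]
    · have : fderiv ℝ θ x = 0 := by
        rw [(notMem_tsupport_iff_eventuallyEq.1 hx).fderiv_eq]; simp
      rw [rb_inner_grad, this]; simp
  have hg1 : ContDiff ℝ 1 (fderiv ℝ g) := g1.fderiv_right (by norm_num)
  have hgi : ∀ v, ContDiff ℝ 1 (fun x => fderiv ℝ g x v) := fun v => hg1.clm_apply contDiff_const
  have hcθ := hθ.continuous
  have c1 : ∀ v, Continuous (fun x => fderiv ℝ θ x v) := fun v =>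
    (hθ.continuous_fderiv (by norm_num)).clm_apply continuous_const
  have c2 : ∀ v, HasCompactSupport (fun x => fderiv ℝ θ x v) := fun v => hc.fderiv_apply ℝ v
  simp_rw [e1]
  have c3 : ∀ v, Continuous (fun x => fderiv ℝ (fun x => fderiv ℝ g x v) x v) := fun v =>
    ((hgi v).continuous_fderiv (by norm_num)).clm_apply continuous_const
  have i2 : ∀ v, Integrable (fun x => fderiv ℝ g x v * fderiv ℝ θ x v) := fun v =>
    ((hgi v).continuous.mul (c1 v)).integrable_of_hasCompactSupport (c2 v).mul_left
  have i3 : ∀ v, Integrable (fun x => fderiv ℝ (fun x => fderiv ℝ g x v) x v * θ x) := fun v =>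
    ((c3 v).mul hcθ).integrable_of_hasCompactSupport hc.mul_left
  rw [integral_finsetSum _ (fun i _ => i2 _)]
  have e2 : ∀ v, ∫ x, fderiv ℝ g x v * fderiv ℝ θ x v =
      - ∫ x, fderiv ℝ (fun x => fderiv ℝ g x v) x v * θ x := by
    intro v
    apply integral_mul_fderiv_eq_neg_fderiv_mul_of_integrable (i3 v) (i2 v)
    · exact ((hgi v).continuous.mul hcθ).integrable_of_hasCompactSupport hc.mul_left
    · intro x _
      exact (hgi v).differentiable (by norm_num) x
    · intro x _
      exact hθ.differentiable (by norm_num) x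
  simp_rw [e2]
  rw [Finset.sum_neg_distrib, ← integral_finsetSum _ (fun i _ => i3 _), neg_eq_zero]
  apply integral_eq_zero_of_ae
  refine Filter.Eventually.of_forall fun x => ?_
  simp only [Pi.zero_apply]
  rw [← Finset.sum_mul]
  by_cases hx : x ∈ tsupport θ
  · have h2 := (hw x (hs hx)).2
    refine mul_eq_zero_of_left ?_ _
    refine Eq.trans ?_ h2
    refine Finset.sum_congr rfl fun i _ => ?_
    rw [iteratedFDeriv_two_apply]
    have : fderiv ℝ g =ᶠ[𝓝 x] fderiv ℝ w := (g3' x hx).fderiv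
    rw [← this.fderiv_eq]
    rw [fderiv_clm_apply (hg1.differentiable (by norm_num) x) (by fun_prop)]
    simp
  · rw [image_eq_zero_of_notMem_tsupport hx, mul_zero]

open MeasureTheory Metric Set
open scoped RealInnerProductSpace ENNReal NNReal Topology

lemma rb_sq (y : ℝ) : HasDerivAt (fun y : ℝ => (max y 0) ^ 2) (2 * max y 0) y := by
  rcases lt_trichotomy y 0 with h | h | h
  · have : (fun y : ℝ => (max y 0) ^ 2) =ᶠ[𝓝 y] fun _ => 0 := by
      filter_upwards [Iio_mem_nhds h] with z hz
      rw [max_eq_right (le_of_lt hz)]; norm_num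
    rw [max_eq_right h.le, mul_zero]
    exact (hasDerivAt_const y (0 : ℝ)).congr_of_eventuallyEq this
  · subst h
    rw [max_self, mul_zero, hasDerivAt_iff_isLittleO]
    simp only [max_self, sub_zero, smul_zero]
    have : (fun y : ℝ => (max y 0) ^ 2 - 0 ^ 2) =O[𝓝 0] fun y => y ^ 2 := by
      refine Asymptotics.IsBigO.of_bound 1 (Filter.Eventually.of_forall fun z => ?_)
      rcases le_total z 0 with hz | hz
      · rw [max_eq_right hz]; simp; positivity
      · rw [max_eq_left hz]; simp
    refine this.trans_isLittleO ?_
    exact Asymptotics.isLittleO_pow_id (by norm_num)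
  · have : (fun y : ℝ => (max y 0) ^ 2) =ᶠ[𝓝 y] fun y => y ^ 2 := by
      filter_upwards [Ioi_mem_nhds h] with z hz
      rw [max_eq_left (le_of_lt hz)]
    rw [max_eq_left h.le]
    have h2 := hasDerivAt_pow 2 y
    simp only [Nat.cast_ofNat, Nat.add_one_sub_one, pow_one] at h2
    exact h2.congr_of_eventuallyEq this

lemma rb_cb_eq (y : ℝ) : (max y 0) ^ 3 = y * (max y 0) ^ 2 := by
  rcases le_total y 0 with h | h
  · rw [max_eq_right h]; simp
  · rw [max_eq_left h]; ring

lemma rb_cb (y : ℝ) : HasDerivAt (fun y : ℝ => (max y 0) ^ 3) (3 * (max y 0) ^ 2) y := by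
  have h : HasDerivAt (fun y : ℝ => y * (max y 0) ^ 2) (1 * (max y 0) ^ 2 + y * (2 * max y 0)) y :=
    (hasDerivAt_id y).mul (rb_sq y)
  have e : (fun y : ℝ => (max y 0) ^ 3) = fun y : ℝ => y * (max y 0) ^ 2 := by
    ext z; exact rb_cb_eq z
  have e2 : 3 * (max y 0) ^ 2 = 1 * (max y 0) ^ 2 + y * (2 * max y 0) := by
    rcases le_total y 0 with h | h
    · rw [max_eq_right h]; simp
    · rw [max_eq_left h]; ring
  rw [e, e2]
  exact h

lemma rb_cd_sq : ContDiff ℝ 1 (fun y : ℝ => (max y 0) ^ 2) := by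
  rw [contDiff_one_iff_deriv]
  refine ⟨fun y => (rb_sq y).differentiableAt, ?_⟩
  have : deriv (fun y : ℝ => (max y 0) ^ 2) = fun y => 2 * max y 0 := by
    ext y; exact (rb_sq y).deriv
  rw [this]; fun_prop

lemma rb_cd_cb : ContDiff ℝ 1 (fun y : ℝ => (max y 0) ^ 3) := by
  rw [contDiff_one_iff_deriv]
  refine ⟨fun y => (rb_cb y).differentiableAt, ?_⟩
  have : deriv (fun y : ℝ => (max y 0) ^ 3) = fun y => 3 * (max y 0) ^ 2 := by
    ext y; exact (rb_cb y).deriv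
  rw [this]; fun_prop

/-- kernel -/
noncomputable def rbK {n : ℕ} (z : EuclideanSpace ℝ (Fin n)) : ℝ := (max (1 - ‖z‖ ^ 2) 0) ^ 2

lemma rbK_nonneg {n : ℕ} (z : EuclideanSpace ℝ (Fin n)) : 0 ≤ rbK z := by unfold rbK; positivity

lemma rbK_le {n : ℕ} (z : EuclideanSpace ℝ (Fin n)) : rbK z ≤ 1 := by
  unfold rbK
  have h1 : max (1 - ‖z‖ ^ 2) 0 ≤ 1 := max_le (by nlinarith [sq_nonneg ‖z‖]) (by norm_num)
  have h0 : 0 ≤ max (1 - ‖z‖ ^ 2) 0 := le_max_right _ _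
  nlinarith

lemma rbK_zero {n : ℕ} {z : EuclideanSpace ℝ (Fin n)} (h : 1 ≤ ‖z‖) : rbK z = 0 := by
  unfold rbK
  rw [max_eq_right (by nlinarith)]; norm_num

lemma rbK_ge {n : ℕ} {z : EuclideanSpace ℝ (Fin n)} (h : ‖z‖ ≤ 2 / 3) : 1 / 4 ≤ rbK z := by
  unfold rbK
  have h1 : 5 / 9 ≤ max (1 - ‖z‖ ^ 2) 0 := le_max_of_le_left (by nlinarith [norm_nonneg z])
  nlinarith

lemma rbK_cont {n : ℕ} : Continuous (rbK : EuclideanSpace ℝ (Fin n) → ℝ) := by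
  unfold rbK; fun_prop

lemma rbK_supp {n : ℕ} : HasCompactSupport (rbK : EuclideanSpace ℝ (Fin n) → ℝ) :=
  HasCompactSupport.intro (isCompact_closedBall (0 : EuclideanSpace ℝ (Fin n)) 1) fun x hx =>
    rbK_zero (by simp at hx; exact hx.le)

lemma rbK_int {n : ℕ} : Integrable (rbK : EuclideanSpace ℝ (Fin n) → ℝ) :=
  rbK_cont.integrable_of_hasCompactSupport rbK_supp

/-- mass of the kernel -/
noncomputable def rbκ (n : ℕ) : ℝ := ∫ z : EuclideanSpace ℝ (Fin n), rbK z

lemma rbκ_pos (n : ℕ) : 0 < rbκ n := by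
  refine Continuous.integral_pos_of_hasCompactSupport_nonneg_nonzero rbK_cont rbK_supp
    rbK_nonneg (x := 0) ?_
  have := rbK_ge (z := (0 : EuclideanSpace ℝ (Fin n))) (by simp; norm_num)
  linarith

/-- weighted average -/
noncomputable def rbAvg {n : ℕ} (F : EuclideanSpace ℝ (Fin n) → ℝ) (p : EuclideanSpace ℝ (Fin n))
    (r : ℝ) : ℝ := ∫ z, rbK z * F (p + r • z)

lemma rbAvg_congr {n : ℕ} {F G : EuclideanSpace ℝ (Fin n) → ℝ} {p : EuclideanSpace ℝ (Fin n)}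
    {r : ℝ} (hr : 0 < r) (h : ∀ x ∈ ball p r, F x = G x) : rbAvg F p r = rbAvg G p r := by
  unfold rbAvg
  congr 1; ext z
  by_cases hz : 1 ≤ ‖z‖
  · rw [rbK_zero hz]; simp
  · rw [h]
    rw [mem_ball, dist_eq_norm, add_sub_cancel_left, norm_smul, Real.norm_of_nonneg hr.le]
    push Not at hz
    nlinarith

lemma rb_cov {n : ℕ} (H : EuclideanSpace ℝ (Fin n) → ℝ) (p : EuclideanSpace ℝ (Fin n))
    {r : ℝ} (hr : 0 < r) : ∫ z, H (p + r • z) = (r ^ n)⁻¹ * ∫ x, H x := by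
  have h := Measure.integral_comp_smul (volume : Measure (EuclideanSpace ℝ (Fin n)))
    (fun y => H (p + y)) r
  rw [h, integral_add_left_eq_self, finrank_euclideanSpace_fin, abs_of_pos (by positivity),
    smul_eq_mul]

lemma rbAvg_hasDerivAt {n : ℕ} {F : EuclideanSpace ℝ (Fin n) → ℝ} (hF : ContDiff ℝ 1 F)
    (hc : HasCompactSupport F) (p v : EuclideanSpace ℝ (Fin n)) (r s t : ℝ) :
    HasDerivAt (fun t : ℝ => rbAvg F (p + t • v) (r + t * s))
      (∫ z, rbK z * fderiv ℝ F (p + t • v + (r + t * s) • z) (v + s • z)) t := by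
  have hd := hF.continuous_fderiv (by norm_num)
  obtain ⟨C, hC⟩ := hd.bounded_above_of_compact_support (hc.fderiv ℝ)
  have hC0 : 0 ≤ C := (norm_nonneg _).trans (hC 0)
  have hk := rbK_cont (n := n)
  have hFc := hF.continuous
  refine (hasDerivAt_integral_of_dominated_loc_of_deriv_le (𝕜 := ℝ) (μ := volume) (s := univ) (x₀ := t)
    (F := fun t z => rbK z * F (p + t • v + (r + t * s) • z))
    (F' := fun t z => rbK z * fderiv ℝ F (p + t • v + (r + t * s) • z) (v + s • z))
    (bound := fun z : EuclideanSpace ℝ (Fin n) => rbK z * (C * (‖v‖ + |s|)))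
    Filter.univ_mem ?_ ?_ ?_ ?_ ?_ ?_).2
  · refine Filter.Eventually.of_forall fun t => Continuous.aestronglyMeasurable ?_
    fun_prop
  · refine Continuous.integrable_of_hasCompactSupport (by fun_prop) rbK_supp.mul_right
  · refine Continuous.aestronglyMeasurable ?_
    fun_prop
  · refine Filter.Eventually.of_forall fun z t _ => ?_
    rw [norm_mul, Real.norm_of_nonneg (rbK_nonneg z)]
    by_cases hz : 1 ≤ ‖z‖
    · rw [rbK_zero hz]; simp
    · push Not at hz
      refine mul_le_mul_of_nonneg_left ?_ (rbK_nonneg z)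
      refine (ContinuousLinearMap.le_opNorm _ _).trans ?_
      refine mul_le_mul (hC _) ?_ (norm_nonneg _) hC0
      refine (norm_add_le _ _).trans ?_
      rw [norm_smul, Real.norm_eq_abs]
      nlinarith [abs_nonneg s]
  · exact rbK_int.mul_const _
  · refine Filter.Eventually.of_forall fun z t _ => ?_
    have h1 : HasDerivAt (fun t : ℝ => p + t • v + (r + t * s) • z) (v + s • z) t := by
      have a1 : HasDerivAt (fun t : ℝ => p + t • v) v t := by
        simpa using ((hasDerivAt_id t).smul_const v).const_add p
      have a2 : HasDerivAt (fun t : ℝ => (r + t * s) • z) (s • z) t := by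
        have : HasDerivAt (fun t : ℝ => r + t * s) s t := by
          simpa using ((hasDerivAt_id t).mul_const s).const_add r
        exact this.smul_const z
      exact a1.add a2
    have h2 := ((hF.differentiable (by norm_num)) (p + t • v + (r + t * s) • z)).hasFDerivAt
    exact (h2.comp_hasDerivAt t h1).const_mul _

open MeasureTheory Metric Set
open scoped RealInnerProductSpace ENNReal NNReal Topology

lemma rb_norm_seg {n : ℕ} {z : EuclideanSpace ℝ (Fin n)} {p c : EuclideanSpace ℝ (Fin n)} {r R : ℝ}
    (hr : 0 < r) (h : dist p c + r ≤ R) (hz : ‖z‖ < 1) : p + r • z ∈ ball c R := by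
  rw [mem_ball]
  have : dist (p + r • z) p < r := by
    rw [dist_eq_norm, add_sub_cancel_left, norm_smul, Real.norm_of_nonneg hr.le]
    nlinarith
  linarith [dist_triangle (p + r • z) p c]

lemma rb_cs {n : ℕ} {h : EuclideanSpace ℝ (Fin n) → ℝ} (hh : Continuous h) :
    (∫ z, rbK z * h z) ^ 2 ≤ rbκ n * ∫ z, rbK z * h z ^ 2 := by
  have hk := rbK_cont (n := n)
  have i1 : Integrable (fun z => rbK z * h z) :=
    Continuous.integrable_of_hasCompactSupport (by fun_prop) rbK_supp.mul_right
  have i2 : Integrable (fun z => rbK z * h z ^ 2) :=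
    Continuous.integrable_of_hasCompactSupport (by fun_prop) rbK_supp.mul_right
  set m := (∫ z, rbK z * h z) / rbκ n with hm
  have hκ := rbκ_pos n
  have h0 : 0 ≤ ∫ z, rbK z * (h z - m) ^ 2 :=
    integral_nonneg fun z => mul_nonneg (rbK_nonneg z) (sq_nonneg _)
  have e : ∫ z, rbK z * (h z - m) ^ 2 =
      (∫ z, rbK z * h z ^ 2) - 2 * m * (∫ z, rbK z * h z) + m ^ 2 * rbκ n := by
    have i3 : Integrable (fun z => rbK z * h z ^ 2 - 2 * m * (rbK z * h z)) := i2.sub (i1.const_mul _)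
    unfold rbκ
    rw [← integral_const_mul, ← integral_const_mul, ← integral_sub i2 (i1.const_mul _),
      ← integral_add i3 (rbK_int.const_mul _)]
    congr 1; ext z; ring
  have e2 : ∫ z, rbK z * h z = m * rbκ n := by rw [hm]; field_simp
  rw [e, e2] at h0
  rw [e2]
  nlinarith

lemma rb_avg_diff {n : ℕ} {F : EuclideanSpace ℝ (Fin n) → ℝ} {c p q : EuclideanSpace ℝ (Fin n)}
    {R r0 r1 r2 : ℝ} (hF : ∀ x ∈ ball c (2 * R), ContDiffAt ℝ 1 F x) (h0 : 0 < r0)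
    (h1 : r0 ≤ r1) (h2 : r0 ≤ r2) (hp : dist p c + r1 ≤ R) (hq : dist q c + r2 ≤ R) :
    (rbAvg F p r1 - rbAvg F q r2) ^ 2 ≤ (dist p q + |r1 - r2|) ^ 2 * rbκ n * (r0 ^ n)⁻¹ *
      ∫ x in ball c R, ‖fderiv ℝ F x‖ ^ 2 := by
  have hR : 0 < R := by linarith [dist_nonneg (x := p) (y := c)]
  obtain ⟨g, g1, g2, g3⟩ := rb_extend 1 (isCompact_closedBall c R) isOpen_ball
    (closedBall_subset_ball (by linarith : R < 2 * R)) (w := F) (by simpa using hF)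
  have hg : ∀ x ∈ ball c R, g =ᶠ[𝓝 x] F := fun x hx =>
    eventually_nhdsSet_iff_forall.1 g3 x (ball_subset_closedBall hx)
  have hd : Continuous (fun x => fderiv ℝ g x) := g1.continuous_fderiv (by norm_num)
  have sub1 : ball p r1 ⊆ ball c R := fun x hx => by
    rw [mem_ball] at hx ⊢; linarith [dist_triangle x p c]
  have sub2 : ball q r2 ⊆ ball c R := fun x hx => by
    rw [mem_ball] at hx ⊢; linarith [dist_triangle x q c]
  rw [rbAvg_congr (by linarith) (fun x hx => ((hg x (sub1 hx)).self_of_nhds).symm),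
    rbAvg_congr (by linarith) (fun x hx => ((hg x (sub2 hx)).self_of_nhds).symm)]
  have eI : ∫ x in ball c R, ‖fderiv ℝ F x‖ ^ 2 = ∫ x in ball c R, ‖fderiv ℝ g x‖ ^ 2 :=
    setIntegral_congr_fun measurableSet_ball fun x hx => by
      rw [(hg x hx).fderiv_eq]
  rw [eI]
  set I := ∫ x in ball c R, ‖fderiv ℝ g x‖ ^ 2 with hI
  have hI0 : 0 ≤ I := integral_nonneg fun x => by positivity
  set L := dist p q + |r1 - r2| with hL
  have hL0 : 0 ≤ L := by positivity
  have hκ := rbκ_pos n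
  have hIint : Integrable (indicator (ball c R) fun x => ‖fderiv ℝ g x‖ ^ 2) := by
    rw [integrable_indicator_iff measurableSet_ball]
    refine (ContinuousOn.integrableOn_compact (isCompact_closedBall c R) ?_).mono_set
      ball_subset_closedBall
    fun_prop
  have key : ∀ t ∈ Ico (0 : ℝ) 1, ‖∫ z, rbK z * fderiv ℝ g (p + t • (q - p) +
      (r1 + t * (r2 - r1)) • z) ((q - p) + (r2 - r1) • z)‖ ≤
      √(L ^ 2 * rbκ n * (r0 ^ n)⁻¹ * I) := by
    intro t ht
    set P := p + t • (q - p) with hP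
    set ρ := r1 + t * (r2 - r1) with hρ
    have hρ0 : r0 ≤ ρ := by rw [hρ]; nlinarith [ht.1, ht.2]
    have hPc : dist P c + ρ ≤ R := by
      have e : P - c = (1 - t) • (p - c) + t • (q - c) := by rw [hP]; module
      have : dist P c ≤ (1 - t) * dist p c + t * dist q c := by
        rw [dist_eq_norm, e]
        refine (norm_add_le _ _).trans ?_
        rw [norm_smul, norm_smul, Real.norm_of_nonneg ht.1, Real.norm_of_nonneg (by linarith [ht.2]),
          ← dist_eq_norm, ← dist_eq_norm]
      rw [hρ]; nlinarith [ht.1, ht.2]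
    have hh : Continuous (fun z => ‖fderiv ℝ g (P + ρ • z)‖) := by fun_prop
    have hk := rbK_cont (n := n)
    have b1 : ‖∫ z, rbK z * fderiv ℝ g (P + ρ • z) ((q - p) + (r2 - r1) • z)‖ ≤
        L * ∫ z, rbK z * ‖fderiv ℝ g (P + ρ • z)‖ := by
      rw [← integral_const_mul]
      refine norm_integral_le_of_norm_le ?_ (Filter.Eventually.of_forall fun z => ?_)
      · refine Integrable.const_mul ?_ _
        exact Continuous.integrable_of_hasCompactSupport (by fun_prop) rbK_supp.mul_right
      rw [norm_mul, Real.norm_of_nonneg (rbK_nonneg z)]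
      by_cases hz : 1 ≤ ‖z‖
      · rw [rbK_zero hz]; simp
      · push Not at hz
        have : ‖(q - p) + (r2 - r1) • z‖ ≤ L := by
          refine (norm_add_le _ _).trans ?_
          rw [norm_smul, Real.norm_eq_abs, hL, dist_comm, dist_eq_norm, abs_sub_comm]
          nlinarith [abs_nonneg (r1 - r2)]
        have h3 := (ContinuousLinearMap.le_opNorm (fderiv ℝ g (P + ρ • z)) ((q - p) + (r2 - r1) • z))
        have h4 := rbK_nonneg z
        calc _ ≤ rbK z * (‖fderiv ℝ g (P + ρ • z)‖ * L) := by gcongr; exact h3.trans (by gcongr)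
          _ = _ := by ring
    have b2 : ∫ z, rbK z * ‖fderiv ℝ g (P + ρ • z)‖ ^ 2 ≤ (r0 ^ n)⁻¹ * I := by
      have c1 : ∫ z, rbK z * ‖fderiv ℝ g (P + ρ • z)‖ ^ 2 ≤
          ∫ z, indicator (ball c R) (fun x => ‖fderiv ℝ g x‖ ^ 2) (P + ρ • z) := by
        refine integral_mono_of_nonneg (Filter.Eventually.of_forall fun z =>
          mul_nonneg (rbK_nonneg z) (by positivity)) ?_ (Filter.Eventually.of_forall fun z => ?_)
        · exact (hIint.comp_add_left P).comp_smul (by linarith : ρ ≠ 0)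
        · by_cases hz : 1 ≤ ‖z‖
          · simp only [rbK_zero hz, zero_mul]
            exact indicator_nonneg (fun x _ => by positivity) _
          · push Not at hz
            simp only
            rw [indicator_of_mem (rb_norm_seg (by linarith) hPc hz)]
            have := rbK_le z
            nlinarith [sq_nonneg ‖fderiv ℝ g (P + ρ • z)‖]
      rw [rb_cov _ _ (by linarith), integral_indicator measurableSet_ball] at c1
      refine c1.trans ?_
      gcongr
    have b3 := rb_cs hh
    refine b1.trans (Real.le_sqrt_of_sq_le ?_)
    rw [mul_pow]
    calc _ ≤ L ^ 2 * (rbκ n * ((r0 ^ n)⁻¹ * I)) := by gcongr; exact b3.trans (by gcongr)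
      _ = _ := by ring
  have mv := norm_image_sub_le_of_norm_deriv_le_segment_01'
    (f := fun t : ℝ => rbAvg g (p + t • (q - p)) (r1 + t * (r2 - r1)))
    (fun t _ => (rbAvg_hasDerivAt (by exact_mod_cast g1) g2 p (q - p) r1 (r2 - r1) t).hasDerivWithinAt) key
  simp only [one_smul, add_sub_cancel, one_mul, zero_smul, add_zero, zero_mul] at mv
  rw [← sq_abs, abs_sub_comm]
  calc _ ≤ (√(L ^ 2 * rbκ n * (r0 ^ n)⁻¹ * I)) ^ 2 := by gcongr; exact mv
    _ = _ := Real.sq_sqrt (by positivity)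

lemma rb_mvp {n : ℕ} {w : EuclideanSpace ℝ (Fin n) → ℝ} {x : EuclideanSpace ℝ (Fin n)} {r R : ℝ}
    (hw : IsHarmonicOn w (ball x R)) (hr : 0 < r) (hrR : r < R) :
    rbAvg w x r = rbκ n * w x := by
  obtain ⟨g, g1, g2, g3⟩ := rb_extend 2 (isCompact_closedBall x r) isOpen_ball
    (closedBall_subset_ball hrR) (w := w) (fun y hy => (hw y hy).1)
  have hg : ∀ y ∈ closedBall x r, g =ᶠ[𝓝 y] w := fun y hy =>
    eventually_nhdsSet_iff_forall.1 g3 y hy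
  have g1' : ContDiff ℝ 1 g := g1.of_le (by norm_num)
  have hgh : IsHarmonicOn g (ball x r) := by
    intro y hy
    refine ⟨g1.contDiffAt, ?_⟩
    rw [((hg y (ball_subset_closedBall hy)).iteratedFDeriv (𝕜 := ℝ) 2).self_of_nhds]
    exact (hw y (ball_subset_ball hrR.le hy)).2
  rw [← rbAvg_congr hr (fun y hy => (hg y (ball_subset_closedBall hy)).self_of_nhds),
    ← (hg x (mem_closedBall_self hr.le)).self_of_nhds]
  have hder : ∀ t : ℝ, HasDerivAt (fun t : ℝ => rbAvg g x t)
      (∫ z, rbK z * fderiv ℝ g (x + t • z) z) t := by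
    intro t
    have := rbAvg_hasDerivAt g1' g2 x 0 0 1 t
    simpa using this
  have hzero : ∀ t ∈ Ioo 0 r, ∫ z, rbK z * fderiv ℝ g (x + t • z) z = 0 := by
    intro t ht
    have ht0 := ht.1
    set θ : EuclideanSpace ℝ (Fin n) → ℝ := fun p => (max (1 - ‖p - x‖ ^ 2 / t ^ 2) 0) ^ 3 with hθ
    have hθz : ∀ p ∉ closedBall x t, θ p = 0 := by
      intro p hp
      rw [mem_closedBall, dist_eq_norm, not_le] at hp
      simp only [hθ]
      rw [max_eq_right]
      · norm_num
      · rw [sub_nonpos, one_le_div (by positivity)]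
        gcongr
    have ht1 : tsupport θ ⊆ closedBall x t := by
      refine closure_minimal (fun p hp => ?_) isClosed_closedBall
      by_contra h
      exact hp (hθz p h)
    have c1 : ContDiff ℝ 1 θ := by
      refine rb_cd_cb.comp ?_
      have : ContDiff ℝ 1 (fun p : EuclideanSpace ℝ (Fin n) => ‖p - x‖ ^ 2) :=
        (contDiff_id.sub contDiff_const).norm_sq ℝ
      exact contDiff_const.sub (this.div_const _)
    have hd : ∀ p, gradient θ p = (-6 / t * rbK (t⁻¹ • (p - x))) • (t⁻¹ • (p - x)) := by
      intro p
      have a1 : HasFDerivAt (fun p : EuclideanSpace ℝ (Fin n) => ‖p - x‖ ^ 2)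
          (2 • (innerSL ℝ (p - x))) p := by
        have := ((hasFDerivAt_id p).sub_const x).norm_sq
        exact this
      have a2 := (rb_cb (1 - ‖p - x‖ ^ 2 / t ^ 2)).comp_hasFDerivAt p
        ((a1.mul_const ((t ^ 2)⁻¹)).const_sub 1)
      have a3 : HasGradientAt θ ((-6 / t * rbK (t⁻¹ • (p - x))) • (t⁻¹ • (p - x))) p := by
        rw [hasGradientAt_iff_hasFDerivAt]
        convert! a2 using 1
        ext v
        have e1 : ‖t⁻¹ • (p - x)‖ ^ 2 = ‖p - x‖ ^ 2 / t ^ 2 := by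
          rw [norm_smul, Real.norm_of_nonneg (by positivity)]; field_simp
        simp only [rbK, e1, InnerProductSpace.toDual_apply_apply, inner_smul_left]
        simp [inner_sub_left]
        field_simp
        ring
      exact a3.gradient
    have h0 := rb_weak isOpen_ball hgh c1 (HasCompactSupport.intro (isCompact_closedBall x t) hθz)
      (ht1.trans (closedBall_subset_ball ht.2))
    have h1 : ∀ p, ⟪gradient g p, gradient θ p⟫ =
        (-6 / t) * (rbK (t⁻¹ • (p - x)) * fderiv ℝ g p (t⁻¹ • (p - x))) := by
      intro p
      rw [hd, inner_smul_right, inner_gradient_left]; ring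
    simp_rw [h1] at h0
    rw [integral_const_mul] at h0
    have h2 : ∫ p, rbK (t⁻¹ • (p - x)) * fderiv ℝ g p (t⁻¹ • (p - x)) = 0 := by
      rcases mul_eq_zero.1 h0 with h | h
      · exfalso; have : -6 / t < 0 := div_neg_of_neg_of_pos (by norm_num) ht0
        linarith
      · exact h
    have h3 := rb_cov (fun p => rbK (t⁻¹ • (p - x)) * fderiv ℝ g p (t⁻¹ • (p - x))) x ht0
    rw [h2, mul_zero] at h3
    rw [← h3]
    congr 1; ext z
    simp [smul_smul, inv_mul_cancel₀ ht0.ne']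
  obtain ⟨t, ht, he⟩ := exists_hasDerivAt_eq_slope (fun t : ℝ => rbAvg g x t) _ hr
    (fun t _ => (hder t).continuousAt.continuousWithinAt) (fun t _ => hder t)
  rw [hzero t ht] at he
  have h4 : rbAvg g x 0 = rbκ n * g x := by
    simp [rbAvg, integral_mul_const, rbκ]
  have h5 : rbAvg g x r - rbAvg g x 0 = 0 := by
    have := he.symm
    rw [div_eq_zero_iff] at this
    rcases this with h | h
    · exact h
    · exfalso; linarith
  linarith

open MeasureTheory Metric Set
open scoped RealInnerProductSpace ENNReal NNReal Topology

lemma rbAvg_eq {n : ℕ} (F : EuclideanSpace ℝ (Fin n) → ℝ) (p : EuclideanSpace ℝ (Fin n)) {r : ℝ}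
    (hr : 0 < r) : rbAvg F p r = (r ^ n)⁻¹ * ∫ x, rbK (r⁻¹ • (x - p)) * F x := by
  rw [← rb_cov _ p hr, rbAvg]
  congr 1; ext z
  rw [add_sub_cancel_left, smul_smul, inv_mul_cancel₀ hr.ne', one_smul]

lemma rbKs_supp {n : ℕ} (p : EuclideanSpace ℝ (Fin n)) {r : ℝ} (hr : 0 < r)
    {x : EuclideanSpace ℝ (Fin n)} (hx : r ≤ dist x p) : rbK (r⁻¹ • (x - p)) = 0 := by
  apply rbK_zero
  rw [norm_smul, Real.norm_of_nonneg (by positivity), ← dist_eq_norm, inv_mul_eq_div,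
    one_le_div hr]
  exact hx

lemma rbKs_compact {n : ℕ} (p : EuclideanSpace ℝ (Fin n)) {r : ℝ} (hr : 0 < r) :
    HasCompactSupport fun x : EuclideanSpace ℝ (Fin n) => rbK (r⁻¹ • (x - p)) :=
  HasCompactSupport.intro (isCompact_closedBall p r) fun x hx =>
    rbKs_supp p hr (by simp at hx; exact hx.le)

lemma rb_harnack {n : ℕ} {g : EuclideanSpace ℝ (Fin n) → ℝ} {x y : EuclideanSpace ℝ (Fin n)}
    {ρ R : ℝ} (hρ : 0 < ρ) (hR : 3 * ρ < R) (hg : IsHarmonicOn g (ball x R))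
    (h0 : ∀ z ∈ ball x R, 0 ≤ g z) (hy : dist y x ≤ ρ) : g y ≤ 4 * 3 ^ n * g x := by
  have e1 : rbAvg g x (3 * ρ) = rbκ n * g x := rb_mvp hg (by positivity) hR
  have e2 : rbAvg g y ρ = rbκ n * g y := by
    refine rb_mvp (R := R - ρ) (fun z hz => hg z ?_) hρ (by linarith)
    rw [mem_ball] at hz ⊢; linarith [dist_triangle z y x]
  have hκ := rbκ_pos n
  rw [rbAvg_eq _ _ (by positivity)] at e1
  rw [rbAvg_eq _ _ hρ] at e2
  have hk := rbK_cont (n := n)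
  have hle : ∫ p, rbK (ρ⁻¹ • (p - y)) * g p ≤ ∫ p, 4 * (rbK ((3 * ρ)⁻¹ • (p - x)) * g p) := by
    refine integral_mono_of_nonneg (Filter.Eventually.of_forall fun p => ?_) ?_
      (Filter.Eventually.of_forall fun p => ?_)
    · by_cases hp : ρ ≤ dist p y
      · simp [rbKs_supp y hρ hp]
      · push Not at hp
        exact mul_nonneg (rbK_nonneg _) (h0 p (by rw [mem_ball]; linarith [dist_triangle p y x]))
    · refine Integrable.const_mul ?_ 4
      obtain ⟨G, G1, G2, G3⟩ := rb_extend 0 (isCompact_closedBall x (3 * ρ)) isOpen_ball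
        (closedBall_subset_ball hR) (w := g) (fun z hz => (hg z hz).1.of_le (by norm_num))
      have : (fun p => rbK ((3 * ρ)⁻¹ • (p - x)) * g p) =
          fun p => rbK ((3 * ρ)⁻¹ • (p - x)) * G p := by
        ext p
        by_cases hp : 3 * ρ ≤ dist p x
        · rw [rbKs_supp x (by positivity : 0 < 3 * ρ) hp, zero_mul, zero_mul]
        · push Not at hp
          rw [(eventually_nhdsSet_iff_forall.1 G3 p (mem_closedBall.2 hp.le)).self_of_nhds]
      rw [this]
      have := G1.continuous
      exact Continuous.integrable_of_hasCompactSupport (by fun_prop)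
        (rbKs_compact x (by positivity)).mul_right
    · simp only
      by_cases hp : ρ ≤ dist p y
      · rw [rbKs_supp y hρ hp, zero_mul]
        by_cases hp2 : 3 * ρ ≤ dist p x
        · rw [rbKs_supp x (by positivity : 0 < 3 * ρ) hp2]; simp
        · push Not at hp2
          exact mul_nonneg (by norm_num) (mul_nonneg (rbK_nonneg _) (h0 p (by rw [mem_ball]; linarith)))
      · push Not at hp
        have hpx : dist p x ≤ 2 * ρ := by linarith [dist_triangle p y x]
        have h1 : 1 / 4 ≤ rbK ((3 * ρ)⁻¹ • (p - x)) := by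
          apply rbK_ge
          rw [norm_smul, Real.norm_of_nonneg (by positivity), ← dist_eq_norm, inv_mul_eq_div,
            div_le_iff₀ (by positivity)]
          linarith
        have h2 := rbK_le (ρ⁻¹ • (p - y))
        have h3 := h0 p (by rw [mem_ball]; linarith)
        nlinarith
  rw [integral_const_mul] at hle
  rw [inv_mul_eq_div, div_eq_iff (by positivity)] at e1 e2
  rw [e1, e2, mul_pow] at hle
  have : (rbκ n * ρ ^ n) * g y ≤ (rbκ n * ρ ^ n) * (4 * 3 ^ n * g x) := by linarith
  exact le_of_mul_le_mul_left this (by positivity)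

lemma rb_sup {n : ℕ} {w : EuclideanSpace ℝ (Fin n) → ℝ} {x : EuclideanSpace ℝ (Fin n)}
    {r R α : ℝ} (hr : 0 < r) (hR : r < R) (hw : IsHarmonicOn w (ball x R)) (hα : 0 < α)
    (h : ∫ z in ball x r, (max (w z) 0) ^ 4 ≤ α ^ 4 * (rbκ n * r ^ n)) : w x ≤ 2 * α := by
  have e1 : rbAvg w x r = rbκ n * w x := rb_mvp hw hr hR
  have hκ := rbκ_pos n
  obtain ⟨G, G1, G2, G3⟩ := rb_extend 0 (isCompact_closedBall x r) isOpen_ball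
    (closedBall_subset_ball hR) (w := w) (fun z hz => (hw z hz).1.of_le (by norm_num))
  have G3' : ∀ p ∈ ball x r, G p = w p := fun p hp =>
    (eventually_nhdsSet_iff_forall.1 G3 p (ball_subset_closedBall hp)).self_of_nhds
  rw [← rbAvg_congr hr G3'] at e1
  have hI : ∫ z in ball x r, (max (w z) 0) ^ 4 = ∫ z in ball x r, (max (G z) 0) ^ 4 :=
    setIntegral_congr_fun measurableSet_ball fun z hz => by simp only [G3' z hz]
  rw [hI] at h
  have hc := G1.continuous
  have hk := rbK_cont (n := n)
  have hint : Integrable (indicator (ball x r) fun z => (max (G z) 0) ^ 4) := by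
    rw [integrable_indicator_iff measurableSet_ball]
    refine (ContinuousOn.integrableOn_compact (isCompact_closedBall x r) ?_).mono_set
      ball_subset_closedBall
    fun_prop
  have hle : rbAvg G x r ≤ ∫ z, (α * rbK z + (α ^ 3)⁻¹ *
      indicator (ball x r) (fun z => (max (G z) 0) ^ 4) (x + r • z)) := by
    refine integral_mono ?_ ?_ fun z => ?_
    · exact Continuous.integrable_of_hasCompactSupport (by fun_prop) rbK_supp.mul_right
    · exact (rbK_int.const_mul _).add (((hint.comp_add_left x).comp_smul hr.ne').const_mul _)
    · simp only
      by_cases hz : 1 ≤ ‖z‖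
      · rw [rbK_zero hz]
        simp only [zero_mul, mul_zero, zero_add]
        exact mul_nonneg (by positivity) (indicator_nonneg (fun x _ => by positivity) _)
      · push Not at hz
        rw [indicator_of_mem (rb_norm_seg hr (by simp) hz)]
        set t := max (G (x + r • z)) 0 with ht
        have ht0 : 0 ≤ t := le_max_right _ _
        have h1 : G (x + r • z) ≤ t := le_max_left _ _
        have h2 : t ≤ α + (α ^ 3)⁻¹ * t ^ 4 := by
          rcases le_total t α with h | h
          · have : 0 ≤ (α ^ 3)⁻¹ * t ^ 4 := by positivity
            linarith
          · have : t ≤ (α ^ 3)⁻¹ * t ^ 4 := by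
              rw [inv_mul_eq_div, le_div_iff₀ (by positivity)]
              have : α ^ 3 ≤ t ^ 3 := by gcongr
              nlinarith
            linarith
        have h3 := rbK_nonneg z
        have h4 := rbK_le z
        have h5 : 0 ≤ (α ^ 3)⁻¹ * t ^ 4 := by positivity
        nlinarith
  rw [integral_add (rbK_int.const_mul _) (((hint.comp_add_left x).comp_smul hr.ne').const_mul _),
    integral_const_mul, integral_const_mul, rb_cov _ _ hr, integral_indicator measurableSet_ball, e1] at hle
  have h6 : (α ^ 3)⁻¹ * ((r ^ n)⁻¹ * ∫ z in ball x r, (max (G z) 0) ^ 4) ≤ α * rbκ n := by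
    calc _ ≤ (α ^ 3)⁻¹ * ((r ^ n)⁻¹ * (α ^ 4 * (rbκ n * r ^ n))) := by gcongr
      _ = _ := by field_simp
  have : rbκ n * w x ≤ rbκ n * (2 * α) := by
    change _ ≤ α * rbκ n + _ at hle
    linarith
  exact le_of_mul_le_mul_left this hκ

open MeasureTheory Metric Set
open scoped RealInnerProductSpace ENNReal NNReal Topology

lemma rb_ball {n : ℕ} {Ω : Set (EuclideanSpace ℝ (Fin n))} {x : EuclideanSpace ℝ (Fin n)}
    (hx : x ∈ Ω) : ball x (infDist x (frontier Ω)) ⊆ Ω := by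
  intro z hz
  by_contra h
  have h0 : 0 < infDist x (frontier Ω) := dist_nonneg.trans_lt hz
  have hno : ∀ q ∈ ball x (infDist x (frontier Ω)), q ∉ frontier Ω := by
    intro q hq1 hq2
    have := infDist_le_dist_of_mem (x := x) hq2
    rw [mem_ball, dist_comm] at hq1
    linarith
  have hd : ∀ q ∈ ball x (infDist x (frontier Ω)), q ∈ interior Ω ∨ q ∉ closure Ω := by
    intro q hq
    by_contra hc
    push Not at hc
    exact hno q hq ⟨hc.2, hc.1⟩
  obtain ⟨q, hq1, hq2, hq3⟩ := (convex_ball x (infDist x (frontier Ω))).isPreconnected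
    (interior Ω) (closure Ω)ᶜ isOpen_interior isClosed_closure.isOpen_compl (fun q hq => hd q hq)
    ⟨x, mem_ball_self h0, (hd x (mem_ball_self h0)).resolve_right (fun h => h (subset_closure hx))⟩
    ⟨z, hz, (hd z hz).resolve_left (fun h' => h (interior_subset h'))⟩
  exact hq3 (subset_closure (interior_subset hq2))

lemma rb_id {n : ℕ} (Ω : Set (EuclideanSpace ℝ (Fin n))) (x y : EuclideanSpace ℝ (Fin n)) :
    infDist x (frontier Ω) ≤ infDist y (frontier Ω) + dist x y := infDist_le_infDist_add_dist

lemma rb_near {n : ℕ} {Ω : Set (EuclideanSpace ℝ (Fin n))} (hF : (frontier Ω).Nonempty)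
    (x : EuclideanSpace ℝ (Fin n)) : ∃ q ∈ frontier Ω, dist x q = infDist x (frontier Ω) := by
  obtain ⟨q, h1, h2⟩ := isClosed_frontier.exists_infDist_eq_dist hF x
  exact ⟨q, h1, h2.symm⟩

lemma rb_ipos {n : ℕ} {Ω : Set (EuclideanSpace ℝ (Fin n))} (hO : IsOpen Ω)
    (hF : (frontier Ω).Nonempty) {x : EuclideanSpace ℝ (Fin n)} (hx : x ∈ Ω) :
    0 < infDist x (frontier Ω) := by
  rw [← isClosed_frontier.notMem_iff_infDist_pos hF]
  intro h
  rw [hO.frontier_eq] at h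
  exact h.2 hx

lemma rb_ck {n : ℕ} {M : ℝ} {Ω : Set (EuclideanSpace ℝ (Fin n))} (hN : IsOneSidedNTA M Ω)
    (hF : (frontier Ω).Nonempty) {x : EuclideanSpace ℝ (Fin n)} (hx : x ∈ closure Ω) {s : ℝ} (hs : 0 < s)
    (hs2 : s < diam Ω / 10) : ∃ A ∈ Ω, dist A x ≤ 2 * s ∧ s / M ≤ infDist A (frontier Ω) ∧
      (s ≤ infDist x (frontier Ω) → A = x) := by
  have hM := hN.M_gt_one
  by_cases h : s ≤ infDist x (frontier Ω)
  · refine ⟨x, ?_, by simp [hs.le], (div_le_self hs.le hM.le).trans h, fun _ => rfl⟩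
    by_contra hc
    have : x ∈ frontier Ω := by rw [hN.isOpen.frontier_eq]; exact ⟨hx, hc⟩
    rw [infDist_zero_of_mem this] at h
    linarith
  · obtain ⟨q, q1, q2⟩ := rb_near hF x
    obtain ⟨A, ⟨A1, A2⟩, A3⟩ := hN.corkscrew q q1 s hs hs2
    push Not at h
    refine ⟨A, A1, ?_, A3, fun h' => absurd h' (not_le.2 h)⟩
    rw [mem_ball] at A2
    linarith [dist_triangle A q x, dist_comm q x]

lemma rb_chain (n : ℕ) (M Λ : ℝ) (hΛ : 1 ≤ Λ) : ∃ (N : ℕ) (K : ℝ), 1 ≤ N ∧ 1 ≤ K ∧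
    ∀ Ω : Set (EuclideanSpace ℝ (Fin n)), IsOneSidedNTA M Ω → ∀ x ∈ Ω, ∀ y ∈ Ω, ∀ ε : ℝ, 0 < ε →
      ε ≤ infDist x (frontier Ω) → ε ≤ infDist y (frontier Ω) → dist x y ≤ Λ * ε →
      Λ * ε < diam Ω / 10 →
      ∃ (c : ℕ → EuclideanSpace ℝ (Fin n)) (ρ : ℕ → ℝ), c 0 = x ∧ c N = y ∧
        ∀ i, c i ∈ Ω ∧ ε / K ≤ ρ i ∧ ρ i ≤ K * ε ∧ dist (c (i + 1)) (c i) ≤ ρ i ∧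
          10 * ρ i ≤ infDist (c i) (frontier Ω) ∧ dist (c i) x ≤ K * ε := by
  obtain ⟨k0, hk0⟩ := pow_unbounded_of_one_lt Λ (by norm_num : (1 : ℝ) < 2)
  set k := k0 + 1 with hk
  have hk2 : Λ ≤ 2 ^ k := by
    have : (2 : ℝ) ^ k0 ≤ 2 ^ k := pow_le_pow_right₀ (by norm_num) (by omega)
    linarith
  set L := ⌈M * (k : ℝ)⌉₊ with hL
  have hp1 : (1 : ℝ) ≤ 2 ^ L := one_le_pow₀ (by norm_num)
  refine ⟨L + 1, 10 * Λ * 2 ^ L * 2 ^ L, by omega, by nlinarith [mul_le_mul hp1 hp1 (by norm_num) (by positivity)], ?_⟩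
  set K := 10 * Λ * 2 ^ L * 2 ^ L with hK
  have hK10 : 10 * Λ ≤ K := by
    rw [hK]; nlinarith [mul_le_mul hp1 hp1 (by norm_num) (by positivity)]
  intro Ω hN x hx y hy ε hε hx2 hy2 hd hdiam
  by_cases hc1 : 10 * Λ * ε ≤ infDist x (frontier Ω)
  · refine ⟨fun i => if i = 0 then x else y, fun i => if i = 0 then Λ * ε else ε / 10, by simp,
      by simp, fun i => ?_⟩
    have a1 : ε / K ≤ ε / 10 := by gcongr; linarith
    by_cases hi : i = 0
    · subst hi
      simp only [if_true, zero_add, one_ne_zero, if_false, dist_self]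
      refine ⟨hx, a1.trans ?_, ?_, by rwa [dist_comm], by linarith, by positivity⟩
      · nlinarith
      · gcongr; linarith
    · simp only [hi, if_false, Nat.succ_ne_zero, dist_self]
      refine ⟨hy, a1, by nlinarith, by positivity, by linarith, ?_⟩
      rw [dist_comm]; refine hd.trans ?_
      gcongr; linarith
  by_cases hxy : x = y
  · subst hxy
    refine ⟨fun i => x, fun i => ε / 10, rfl, rfl, fun i => ?_⟩
    simp only [dist_self]
    refine ⟨hx, ?_, by nlinarith, by positivity, by linarith, by positivity⟩
    gcongr; linarith
  push Not at hc1
  have hM := hN.M_gt_one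
  obtain ⟨c, ρ, c1, c2, c3⟩ := hN.harnack (dist x y) ε k (dist_pos.2 hxy) (by linarith) hε (by omega)
    x hx y hy rfl hx2 hy2 (hd.trans (by gcongr))
  rw [← hL] at c2 c3
  have hL1 : 1 ≤ L := by
    rw [hL, Nat.one_le_ceil_iff]
    have : (0 : ℝ) < k := by rw [hk]; positivity
    positivity
  set c' : ℕ → EuclideanSpace ℝ (Fin n) := fun i => c (min (i + 1) L) with hc'
  have f1 : ∀ i, c' i ∈ Ω := fun i => by
    obtain ⟨h1, h2, h3, h4⟩ := c3 (min (i + 1) L) (by omega) (by omega)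
    exact h3 (mem_ball_self h1)
  have f2 : ∀ i, dist (c' (i + 1)) (c' i) ≤ infDist (c' i) (frontier Ω) / 10 := fun i => by
    obtain ⟨h1, h2, h3, h4⟩ := c3 (min (i + 1) L) (by omega) (by omega)
    by_cases hi : i + 1 < L
    · have e1 : min (i + 1) L = i + 1 := by omega
      have e2 : min (i + 1 + 1) L = i + 1 + 1 := by omega
      simp only [hc', e2]
      rw [e1] at h4 h2 ⊢
      have := h4 hi
      rw [mem_ball] at this
      linarith
    · have e1 : min (i + 1) L = L := by omega
      have e2 : min (i + 1 + 1) L = L := by omega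
      simp only [hc', e1, e2, dist_self]
      have := infDist_nonneg (x := c L) (s := frontier Ω)
      positivity
  have hp : c' 0 = x := by simp only [hc']; rw [show min (0 + 1) L = 1 by omega]; exact c1
  have f3 : ∀ i ≤ L, infDist x (frontier Ω) / 2 ^ i ≤ infDist (c' i) (frontier Ω) ∧
      infDist (c' i) (frontier Ω) ≤ 2 ^ i * infDist x (frontier Ω) ∧
      dist (c' i) x ≤ 2 ^ i * infDist x (frontier Ω) := by
    intro i
    induction i with
    | zero => intro _; rw [hp]; simp [infDist_nonneg]
    | succ i ih =>
      intro hi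
      obtain ⟨i1, i2, i3⟩ := ih (by omega)
      have g1 := rb_id Ω (c' (i + 1)) (c' i)
      have g2 := rb_id Ω (c' i) (c' (i + 1))
      rw [dist_comm] at g2
      have g3 := f2 i
      have g4 := infDist_nonneg (x := c' i) (s := frontier Ω)
      refine ⟨?_, ?_, ?_⟩
      · rw [pow_succ, ← div_div, div_le_iff₀ (by norm_num)]; linarith
      · rw [pow_succ]; linarith
      · rw [pow_succ]; linarith [dist_triangle (c' (i + 1)) (c' i) x]
  have f3' : ∀ i, infDist x (frontier Ω) / 2 ^ L ≤ infDist (c' i) (frontier Ω) ∧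
      infDist (c' i) (frontier Ω) ≤ 2 ^ L * infDist x (frontier Ω) ∧
      dist (c' i) x ≤ 2 ^ L * infDist x (frontier Ω) := by
    intro i
    have hpos := infDist_nonneg (x := x) (s := frontier Ω)
    have e : c' i = c' (min i L) := by
      simp only [hc']; congr 1; omega
    rw [e]
    obtain ⟨i1, i2, i3⟩ := f3 (min i L) (by omega)
    have hpw : (2 : ℝ) ^ (min i L) ≤ 2 ^ L := pow_le_pow_right₀ (by norm_num) (by omega)
    refine ⟨le_trans (by gcongr) i1, i2.trans (by gcongr), i3.trans (by gcongr)⟩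
  have hKe : 2 ^ L * infDist x (frontier Ω) ≤ K * ε := by
    calc _ ≤ 2 ^ L * (10 * Λ * ε) := by gcongr
      _ = 1 * (10 * Λ * 2 ^ L * ε) := by ring
      _ ≤ 2 ^ L * (10 * Λ * 2 ^ L * ε) := by gcongr
      _ = _ := by rw [hK]; ring
  refine ⟨c', fun i => infDist (c' i) (frontier Ω) / 10, hp, ?_, fun i => ?_⟩
  · simp only [hc']; rw [show min (L + 1 + 1) L = L by omega]; exact c2
  · obtain ⟨i1, i2, i3⟩ := f3' i
    refine ⟨f1 i, ?_, by linarith [infDist_nonneg (x := c' i) (s := frontier Ω)], f2 i, by linarith, i3.trans hKe⟩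
    have : ε / K ≤ infDist x (frontier Ω) / 2 ^ L / 10 := by
      rw [div_div]
      have : 2 ^ L * 10 ≤ K := by
        rw [hK]
        calc (2 : ℝ) ^ L * 10 = 10 * 1 * 1 * 2 ^ L := by ring
          _ ≤ _ := by gcongr
      have hpos := infDist_nonneg (x := x) (s := frontier Ω)
      gcongr
    refine this.trans ?_
    linarith

lemma rb_hc (n : ℕ) (M Λ : ℝ) (hΛ : 1 ≤ Λ) : ∃ K : ℝ, 1 ≤ K ∧
    ∀ Ω : Set (EuclideanSpace ℝ (Fin n)), IsOneSidedNTA M Ω → ∀ x ∈ Ω, ∀ y ∈ Ω, ∀ ε : ℝ, 0 < ε →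
      ε ≤ infDist x (frontier Ω) → ε ≤ infDist y (frontier Ω) → dist x y ≤ Λ * ε →
      Λ * ε < diam Ω / 10 →
      ∀ g : EuclideanSpace ℝ (Fin n) → ℝ, IsHarmonicOn g (Ω ∩ ball x (K * ε)) →
        (∀ z ∈ Ω ∩ ball x (K * ε), ε / K ≤ infDist z (frontier Ω) → 0 ≤ g z) → g y ≤ K * g x := by
  obtain ⟨N, K, hN1, hK, H⟩ := rb_chain n M Λ hΛ
  set B : ℝ := (4 * 3 ^ n) ^ N with hB
  have h3 : (1 : ℝ) ≤ 3 ^ n := one_le_pow₀ (by norm_num)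
  have hB1 : 1 ≤ B := one_le_pow₀ (by linarith)
  have hle : 10 * K ≤ 10 * K * B := by nlinarith
  have hBle : B ≤ 10 * K * B := by nlinarith
  refine ⟨10 * K * B, by linarith, ?_⟩
  intro Ω hΩ x hx y hy ε hε hx2 hy2 hd hD g hg h0
  obtain ⟨c, ρ, c0, cN, hc⟩ := H Ω hΩ x hx y hy ε hε hx2 hy2 hd hD
  have sub : ∀ i, ∀ z ∈ ball (c i) (4 * ρ i), z ∈ Ω ∩ ball x (10 * K * B * ε) ∧
      ε / (10 * K * B) ≤ infDist z (frontier Ω) := by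
    intro i z hz
    obtain ⟨h1, h2, h3, h4, h5, h6⟩ := hc i
    have hρ : 0 < ρ i := lt_of_lt_of_le (by positivity) h2
    refine ⟨⟨rb_ball h1 (ball_subset_ball (by linarith) hz), ?_⟩, ?_⟩
    · rw [mem_ball] at hz ⊢
      have := dist_triangle z (c i) x
      have : 10 * K * ε ≤ 10 * K * B * ε := by gcongr
      nlinarith
    · have a1 := rb_id Ω (c i) z
      rw [mem_ball, dist_comm] at hz
      have : ε / (10 * K * B) ≤ ε / K := by gcongr; linarith
      linarith
  have step : ∀ i, g (c (i + 1)) ≤ 4 * 3 ^ n * g (c i) := by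
    intro i
    obtain ⟨h1, h2, h3, h4, h5, h6⟩ := hc i
    have hρ : 0 < ρ i := lt_of_lt_of_le (by positivity) h2
    exact rb_harnack hρ (by linarith : 3 * ρ i < 4 * ρ i) (fun z hz => hg z (sub i z hz).1)
      (fun z hz => h0 z (sub i z hz).1 (sub i z hz).2) h4
  have all : ∀ i, g (c i) ≤ (4 * 3 ^ n) ^ i * g x := by
    intro i
    induction i with
    | zero => simp [c0]
    | succ i ih =>
      refine (step i).trans ?_
      calc _ ≤ 4 * 3 ^ n * ((4 * 3 ^ n) ^ i * g x) := by gcongr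
        _ = _ := by ring
  have gx : 0 ≤ g x := by
    refine h0 x ⟨hx, mem_ball_self (by positivity)⟩ (le_trans ?_ hx2)
    exact div_le_self hε.le (by linarith)
  have := all N
  rw [cN] at this
  exact this.trans (by gcongr)

lemma rb_sumsq (N : ℕ) (f : ℕ → ℝ) (B : ℝ) (h : ∀ i < N, (f i - f (i + 1)) ^ 2 ≤ B) :
    (f 0 - f N) ^ 2 ≤ (N : ℝ) ^ 2 * B := by
  by_cases hN : N = 0
  · subst hN; simp
  have hB : 0 ≤ B := (sq_nonneg _).trans (h 0 (by omega))
  have h1 : ∀ i < N, |f i - f (i + 1)| ≤ √B := fun i hi => Real.abs_le_sqrt (h i hi)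
  have h2 : |f 0 - f N| ≤ N * √B := by
    rw [← Finset.sum_range_sub' f N]
    refine (Finset.abs_sum_le_sum_abs _ _).trans ?_
    refine (Finset.sum_le_sum fun i hi => h1 i (Finset.mem_range.1 hi)).trans ?_
    simp
  rw [← sq_abs]
  calc _ ≤ (N * √B) ^ 2 := by gcongr
    _ = _ := by rw [mul_pow, Real.sq_sqrt hB]

lemma rb_ac (n : ℕ) (M Λ : ℝ) (hΛ : 1 ≤ Λ) : ∃ K B : ℝ, 1 ≤ K ∧ 0 < B ∧
    ∀ Ω : Set (EuclideanSpace ℝ (Fin n)), IsOneSidedNTA M Ω → ∀ x ∈ Ω, ∀ y ∈ Ω, ∀ ε : ℝ, 0 < ε →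
      ε ≤ infDist x (frontier Ω) → ε ≤ infDist y (frontier Ω) → dist x y ≤ Λ * ε →
      Λ * ε < diam Ω / 10 → ∀ r1 r2 : ℝ, ε / (2 * K) ≤ r1 → r1 ≤ ε / K → ε / (2 * K) ≤ r2 →
      r2 ≤ ε / K →
      ∀ F : EuclideanSpace ℝ (Fin n) → ℝ, (∀ z ∈ Ω ∩ ball x (K * ε), ContDiffAt ℝ 1 F z) →
        IntegrableOn (fun z => ‖fderiv ℝ F z‖ ^ 2) (Ω ∩ ball x (K * ε)) →
        (rbAvg F x r1 - rbAvg F y r2) ^ 2 ≤ B * (ε ^ 2 * (ε ^ n)⁻¹ *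
          ∫ z in Ω ∩ ball x (K * ε), ‖fderiv ℝ F z‖ ^ 2) := by
  obtain ⟨N, K, hN1, hK, H⟩ := rb_chain n M Λ hΛ
  have hκ := rbκ_pos n
  refine ⟨10 * K, N ^ 2 * ((2 * K) ^ 2 * rbκ n * (20 * K) ^ n), by linarith, ?_, ?_⟩
  · have : (0 : ℝ) < N := by exact_mod_cast hN1
    positivity
  intro Ω hΩ x hx y hy ε hε hx2 hy2 hd hD r1 r2 h11 h12 h21 h22 F hF hI
  obtain ⟨c, ρ, c0, cN, hc⟩ := H Ω hΩ x hx y hy ε hε hx2 hy2 hd hD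
  have hp : 0 < ε / (2 * (10 * K)) := by positivity
  have sub : ∀ i, ∀ z ∈ ball (c i) (4 * ρ i), z ∈ Ω ∩ ball x (10 * K * ε) := by
    intro i z hz
    obtain ⟨h1, h2, h3, h4, h5, h6⟩ := hc i
    have hρ : 0 < ρ i := lt_of_lt_of_le (by positivity) h2
    refine ⟨rb_ball h1 (ball_subset_ball (by linarith) hz), ?_⟩
    rw [mem_ball] at hz ⊢
    have := dist_triangle z (c i) x
    nlinarith
  set I := ∫ z in Ω ∩ ball x (10 * K * ε), ‖fderiv ℝ F z‖ ^ 2 with hIdef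
  have hr : ∀ i : ℕ, ε / (2 * (10 * K)) ≤ (if i = 0 then r1 else r2) ∧
      (if i = 0 then r1 else r2) ≤ ε / (10 * K) := by
    intro i; split_ifs
    · exact ⟨h11, h12⟩
    · exact ⟨h21, h22⟩
  have step := rb_sumsq N (fun i => rbAvg F (c i) (if i = 0 then r1 else r2))
    ((2 * K * ε) ^ 2 * rbκ n * ((ε / (2 * (10 * K))) ^ n)⁻¹ * I) (by
      intro i _
      obtain ⟨h1, h2, h3, h4, h5, h6⟩ := hc i
      have hρ : 0 < ρ i := lt_of_lt_of_le (by positivity) h2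
      obtain ⟨a1, a2⟩ := hr i
      obtain ⟨b1, b2⟩ := hr (i + 1)
      have hlt : ε / (10 * K) ≤ ρ i := le_trans (by gcongr; linarith) h2
      have := rb_avg_diff (F := F) (c := c i) (p := c i) (q := c (i + 1)) (R := 2 * ρ i)
        (fun z hz => hF z (sub i z (by convert hz using 2; ring))) hp a1 b1
        (by rw [dist_self]; linarith) (by linarith)
      refine this.trans ?_
      have e1 : dist (c i) (c (i + 1)) + |(if i = 0 then r1 else r2) -
          (if i + 1 = 0 then r1 else r2)| ≤ 2 * K * ε := by
        have : |(if i = 0 then r1 else r2) - (if i + 1 = 0 then r1 else r2)| ≤ ρ i :=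
          abs_le.2 ⟨by linarith, by linarith⟩
        rw [dist_comm]; linarith
      have e2 : ∫ z in ball (c i) (2 * ρ i), ‖fderiv ℝ F z‖ ^ 2 ≤ I :=
        setIntegral_mono_set hI (Filter.Eventually.of_forall fun z => by positivity)
          (Filter.Eventually.of_forall fun z hz => sub i z (ball_subset_ball (by linarith) hz))
      gcongr)
  simp only [c0, cN, if_true, show N ≠ 0 by omega, if_false] at step
  refine step.trans (le_of_eq ?_)
  rw [div_pow]
  field_simp
  ring

open MeasureTheory Metric Set
open scoped RealInnerProductSpace ENNReal NNReal Topology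

lemma rb_avg_lim {n : ℕ} {F : EuclideanSpace ℝ (Fin n) → ℝ} {x : EuclideanSpace ℝ (Fin n)} {R : ℝ}
    (hR : 0 < R) (hF : ∀ z ∈ ball x R, ContDiffAt ℝ 1 F z) :
    Filter.Tendsto (fun r => rbAvg F x r) (𝓝[>] 0) (𝓝 (rbκ n * F x)) := by
  obtain ⟨g, g1, g2, g3⟩ := rb_extend 1 (isCompact_closedBall x (R / 2)) isOpen_ball
    (closedBall_subset_ball (by linarith : R / 2 < R)) (w := F) (by simpa using hF)
  have hg : ∀ z ∈ closedBall x (R / 2), g z = F z := fun z hz =>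
    (eventually_nhdsSet_iff_forall.1 g3 z hz).self_of_nhds
  have h1 := (rbAvg_hasDerivAt (by exact_mod_cast g1) g2 x 0 0 1 0).continuousAt
  have h2 : Filter.Tendsto (fun r => rbAvg g x r) (𝓝 0) (𝓝 (rbκ n * g x)) := by
    have e : rbAvg g x 0 = rbκ n * g x := by simp [rbAvg, integral_mul_const, rbκ]
    rw [← e]
    simpa [ContinuousAt] using h1
  rw [hg x (mem_closedBall_self (by positivity))] at h2
  refine (h2.mono_left nhdsWithin_le_nhds).congr' ?_
  filter_upwards [Ioo_mem_nhdsGT (by positivity : (0 : ℝ) < R / 2)] with r hr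
  exact rbAvg_congr hr.1 fun z hz => hg z (closedBall_subset_closedBall hr.2.le (ball_subset_closedBall hz))

lemma rb_fub_meas {n : ℕ} {H : EuclideanSpace ℝ (Fin n) → ℝ≥0∞} (hH : Measurable H) (t : ℝ) :
    Measurable fun x => ∫⁻ z in ball x t, H z := by
  have : (fun x => ∫⁻ z in ball x t, H z) = fun x => ∫⁻ z,
      indicator {p : EuclideanSpace ℝ (Fin n) × EuclideanSpace ℝ (Fin n) | dist p.2 p.1 < t}
        (fun p => H p.2) (x, z) := by
    ext x
    rw [← lintegral_indicator measurableSet_ball]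
    rfl
  rw [this]
  refine Measurable.lintegral_prod_right' (f := indicator {p : EuclideanSpace ℝ (Fin n) × EuclideanSpace ℝ (Fin n) | dist p.2 p.1 < t}
        (fun p => H p.2)) ?_
  refine Measurable.indicator (hH.comp measurable_snd) ?_
  exact measurableSet_lt (measurable_snd.dist measurable_fst) measurable_const

lemma rb_fub {n : ℕ} {H : EuclideanSpace ℝ (Fin n) → ℝ≥0∞} (hH : Measurable H) (t : ℝ) :
    ∫⁻ x, ∫⁻ z in ball x t, H z =
      volume (ball (0 : EuclideanSpace ℝ (Fin n)) t) * ∫⁻ z, H z := by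
  have e : ∀ x, ∫⁻ z in ball x t, H z = ∫⁻ z,
      indicator {p : EuclideanSpace ℝ (Fin n) × EuclideanSpace ℝ (Fin n) | dist p.2 p.1 < t}
        (fun p => H p.2) (x, z) := by
    intro x
    rw [← lintegral_indicator measurableSet_ball]
    rfl
  simp_rw [e]
  rw [lintegral_lintegral_swap]
  · rw [← lintegral_const_mul _ hH]
    congr 1; ext z
    have : (fun x => indicator {p : EuclideanSpace ℝ (Fin n) × EuclideanSpace ℝ (Fin n) | dist p.2 p.1 < t}
        (fun p => H p.2) (x, z)) = indicator (ball z t) (fun _ => H z) := by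
      ext x
      simp only [indicator, mem_ofPred_eq, mem_ball, dist_comm]
    rw [this, lintegral_indicator measurableSet_ball, setLIntegral_const, mul_comm,
      Measure.addHaar_ball_center]
  · refine Measurable.aemeasurable ?_
    refine Measurable.indicator (hH.comp measurable_snd) ?_
    exact measurableSet_lt (measurable_snd.dist measurable_fst) measurable_const

lemma rb_vol {n : ℕ} {t : ℝ} (ht : 0 < t) :
    volume (ball (0 : EuclideanSpace ℝ (Fin n)) t) =
      ENNReal.ofReal (t ^ n * (volume (ball (0 : EuclideanSpace ℝ (Fin n)) 1)).toReal) := by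
  rw [Measure.addHaar_ball_of_pos _ _ ht, finrank_euclideanSpace_fin,
    ENNReal.ofReal_mul (by positivity), ENNReal.ofReal_toReal measure_ball_lt_top.ne]

lemma rb_csum (J : ℕ) (a s b : ℕ → ℝ) (s0 B : ℝ) (ha : a 0 = 0) (hs : ∀ j, s j = s0 * (1 / 2) ^ j)
    (hs0 : 0 < s0) (hb : ∀ j, (a j - a (j + 1)) ^ 2 ≤ B * (s j ^ 2 * b j)) :
    a J ^ 2 ≤ ∑ j ∈ Finset.range J, 2 * s0 * B * s j * b j := by
  have hsp : ∀ j, 0 < s j := fun j => by rw [hs]; positivity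
  have e : a J = ∑ j ∈ Finset.range J, (a (j + 1) - a j) := by
    rw [Finset.sum_range_sub, ha, sub_zero]
  by_cases hJ : J = 0
  · subst hJ; simp [ha]
  have h1 := Finset.sq_sum_div_le_sum_sq_div (Finset.range J) (fun j => a (j + 1) - a j)
    (g := s) (fun j _ => hsp j)
  rw [← e] at h1
  have hS : 0 < ∑ j ∈ Finset.range J, s j :=
    Finset.sum_pos (fun j _ => hsp j) ⟨0, Finset.mem_range.2 (by omega)⟩
  have hS2 : ∑ j ∈ Finset.range J, s j ≤ 2 * s0 := by
    simp_rw [hs]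
    rw [← Finset.mul_sum, mul_comm]
    gcongr
    rw [geom_sum_eq (by norm_num)]
    have : (0 : ℝ) < (1 / 2) ^ J := by positivity
    rw [div_le_iff_of_neg (by norm_num)]
    linarith
  rw [div_le_iff₀ hS] at h1
  have h3 : ∑ j ∈ Finset.range J, (a (j + 1) - a j) ^ 2 / s j ≤ ∑ j ∈ Finset.range J, B * s j * b j := by
    refine Finset.sum_le_sum fun j _ => ?_
    rw [div_le_iff₀ (hsp j)]
    have := hb j
    nlinarith
  have h4 : 0 ≤ ∑ j ∈ Finset.range J, (a (j + 1) - a j) ^ 2 / s j :=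
    Finset.sum_nonneg fun j _ => by have := hsp j; positivity
  calc a J ^ 2 ≤ _ := h1
    _ ≤ (∑ j ∈ Finset.range J, (a (j + 1) - a j) ^ 2 / s j) * (2 * s0) := by gcongr
    _ ≤ (∑ j ∈ Finset.range J, B * s j * b j) * (2 * s0) := by gcongr
    _ = _ := by rw [Finset.sum_mul]; refine Finset.sum_congr rfl fun j _ => by ring

set_option maxHeartbeats 1600000 in
lemma rb_poincare (n : ℕ) (M : ℝ) : ∃ K : ℝ, 1 ≤ K ∧
    ∀ Ω : Set (EuclideanSpace ℝ (Fin n)), IsOneSidedNTA M Ω → (frontier Ω).Nonempty →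
    ∀ (q : EuclideanSpace ℝ (Fin n)) (ρ η : ℝ), 0 < η → K * η < diam Ω →
    ∀ F : EuclideanSpace ℝ (Fin n) → ℝ, (∀ z ∈ Ω ∩ ball q (ρ + K * η), ContDiffAt ℝ 1 F z) →
      IntegrableOn (fun z => ‖fderiv ℝ F z‖ ^ 2) (Ω ∩ ball q (ρ + K * η)) →
      (∀ z ∈ Ω ∩ ball q (ρ + K * η), η ≤ infDist z (frontier Ω) → F z = 0) →
      ∫ z in Ω ∩ ball q ρ, F z ^ 2 ≤ K * η ^ 2 *
        ∫ z in Ω ∩ ball q (ρ + K * η), ‖fderiv ℝ F z‖ ^ 2 := by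
  by_cases hM1 : 1 < M
  swap
  · exact ⟨1, le_rfl, fun Ω h => absurd h.M_gt_one hM1⟩
  obtain ⟨K1, B, hK1, hB, H⟩ := rb_ac n M (6 * M) (by linarith)
  have hκ := rbκ_pos n
  set V := (volume (ball (0 : EuclideanSpace ℝ (Fin n)) 1)).toReal with hV
  have hV0 : 0 ≤ V := ENNReal.toReal_nonneg
  set K2 := 2 + K1 with hK2
  -- bound constant
  set B1 : ℝ := 4 * (2 * M) ^ 2 * (B * (2 * M) ^ n) * (K2 ^ n * V) / rbκ n ^ 2 with hB1
  have hB10 : 0 ≤ B1 := by positivity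
  set K := 60 * M ^ 2 * K2 + B1 with hK
  have hMsq : 1 < M ^ 2 := by nlinarith
  have hMM : M ≤ M ^ 2 := by nlinarith
  have hKa : 60 * M ≤ K := by rw [hK]; nlinarith
  have hKb : 2 * M * (2 * K2) ≤ K := by
    rw [hK]
    have : M * K2 ≤ M ^ 2 * K2 := by gcongr
    have : 0 ≤ M ^ 2 * K2 := by positivity
    linarith
  refine ⟨K, by linarith, ?_⟩
  intro Ω hN hFr q ρ η hη hD F hF hI h0
  set S := Ω ∩ ball q (ρ + K * η) with hS
  have hSm : MeasurableSet S := hN.isOpen.measurableSet.inter measurableSet_ball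
  set s0 := 2 * M * η with hs0
  have hs0p : 0 < s0 := by positivity
  set s : ℕ → ℝ := fun j => s0 * (1 / 2) ^ j with hs
  have hsp : ∀ j, 0 < s j := fun j => by simp only [hs]; positivity
  have hss : ∀ j, s (j + 1) = s j / 2 := fun j => by simp only [hs]; ring
  have hsl : ∀ j, s j ≤ s0 := fun j => by
    simp only [hs]
    have : ((1 : ℝ) / 2) ^ j ≤ 1 := pow_le_one₀ (by norm_num) (by norm_num)
    exact mul_le_of_le_one_right hs0p.le this
  have hKη : 60 * M * η ≤ K * η := by gcongr
  have hKη2 : 2 * M * (2 * K2) * η ≤ K * η := by gcongr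
  have hs0d : 6 * s0 < diam Ω / 5 := by rw [hs0]; linarith
  set Hh : EuclideanSpace ℝ (Fin n) → ℝ≥0∞ :=
    indicator S fun z => ENNReal.ofReal (‖fderiv ℝ F z‖ ^ 2) with hHh
  have hHm : Measurable Hh := by
    refine Measurable.indicator ?_ hSm
    exact ((measurable_fderiv ℝ F).norm.pow_const 2).ennreal_ofReal
  set cc : ℕ → ℝ := fun j => 2 * s0 * (B * (2 * M) ^ n) * s j * (s j ^ n)⁻¹ with hcc
  have hcc0 : ∀ j, 0 ≤ cc j := fun j => by have := hsp j; simp only [hcc]; positivity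
  have pt : ∀ x ∈ Ω ∩ ball q ρ, ENNReal.ofReal (rbκ n ^ 2 * F x ^ 2) ≤
      ∑' j, ENNReal.ofReal (cc j) * ∫⁻ z in ball x (K2 * s j), Hh z := by
    rintro x ⟨hx, hxq⟩
    rw [mem_ball] at hxq
    have hch : ∀ j, ∃ A ∈ Ω, dist A x ≤ 2 * s j ∧ s j / M ≤ infDist A (frontier Ω) ∧
      (s j ≤ infDist x (frontier Ω) → A = x) := fun j =>
      rb_ck hN hFr (subset_closure hx) (hsp j) (by linarith [hsl j])
    choose A A1 A2 A3 A4 using hch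
    set β := 1 / (2 * M * K1) with hβ
    have hβ0 : 0 < β := by positivity
    set a : ℕ → ℝ := fun j => rbAvg F (A j) (β * s j) with ha
    have hε : ∀ j, β * s j = s j / (2 * M) / K1 := fun j => by rw [hβ]; field_simp
    have hball : ∀ j, ball (A j) (K1 * (s j / (2 * M))) ⊆ ball x (K2 * s j) := by
      intro j z hz
      rw [mem_ball] at hz ⊢
      have h1 : s j / (2 * M) ≤ s j := div_le_self (hsp j).le (by linarith)
      have h2 : K1 * (s j / (2 * M)) ≤ K1 * s j := by gcongr
      have h3 := dist_triangle z (A j) x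
      have h4 := A2 j
      rw [hK2]; linarith
    have hballq : ∀ j, ball x (K2 * s j) ⊆ ball q (ρ + K * η) := by
      intro j z hz
      rw [mem_ball] at hz ⊢
      have h3 := dist_triangle z x q
      have : K2 * s j ≤ K2 * s0 := by gcongr; exact hsl j
      have : K2 * s0 = 2 * M * K2 * η := by rw [hs0]; ring
      have : 0 ≤ 2 * M * K2 * η := by positivity
      linarith
    have hsubS : ∀ j, Ω ∩ ball (A j) (K1 * (s j / (2 * M))) ⊆ S := fun j z hz =>
      ⟨hz.1, hballq j (hball j hz.2)⟩
    have hb : ∀ j, (a j - a (j + 1)) ^ 2 ≤ (B * (2 * M) ^ n) * (s j ^ 2 * ((s j ^ n)⁻¹ *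
        ∫ z in Ω ∩ ball (A j) (K1 * (s j / (2 * M))), ‖fderiv ℝ F z‖ ^ 2)) := by
      intro j
      have hsj := hsp j
      have := H Ω hN (A j) (A1 j) (A (j + 1)) (A1 (j + 1)) (s j / (2 * M)) (by positivity)
        (by refine le_trans ?_ (A3 j); gcongr; linarith)
        (by refine le_of_eq_of_le ?_ (A3 (j + 1)); rw [hss]; field_simp)
        (by
          have h1 := dist_triangle (A j) x (A (j + 1))
          rw [dist_comm x] at h1
          have h2 := A2 j
          have h3 := A2 (j + 1)
          rw [hss] at h3
          have : 6 * M * (s j / (2 * M)) = 3 * s j := by field_simp; norm_num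
          rw [this]; linarith)
        (by
          have : 6 * M * (s j / (2 * M)) = 3 * s j := by field_simp; norm_num
          rw [this]; linarith [hsl j])
        (β * s j) (β * s (j + 1))
        (by rw [hε]; gcongr; linarith) (by rw [hε])
        (by rw [hε, hss]; apply le_of_eq; field_simp) (by rw [hε, hss]; gcongr; linarith)
        F (fun z hz => hF z (hsubS j hz)) (hI.mono_set (hsubS j))
      refine this.trans ?_
      set I := ∫ z in Ω ∩ ball (A j) (K1 * (s j / (2 * M))), ‖fderiv ℝ F z‖ ^ 2
      have hI0 : 0 ≤ I := integral_nonneg fun z => by positivity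
      have e : (s j / (2 * M)) ^ 2 * ((s j / (2 * M)) ^ n)⁻¹ * I =
        (s j ^ 2 / (2 * M) ^ 2) * ((2 * M) ^ n * ((s j ^ n)⁻¹ * I)) := by
        rw [div_pow, div_pow]; field_simp
      rw [e]
      have : s j ^ 2 / (2 * M) ^ 2 ≤ s j ^ 2 := div_le_self (by positivity) (one_le_pow₀ (by linarith))
      calc _ ≤ B * (s j ^ 2 * ((2 * M) ^ n * ((s j ^ n)⁻¹ * I))) := by gcongr
        _ = _ := by ring
    have ha0 : a 0 = 0 := by
      have e : β * s 0 = η / K1 := by rw [hε]; simp only [hs, hs0]; field_simp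
      have hlt : η / K1 ≤ η := div_le_self hη.le hK1
      have hz : ∀ z ∈ ball (A 0) (β * s 0), F z = 0 := by
        intro z hz
        rw [e, mem_ball] at hz
        have h1 := A3 0
        have h2 : s 0 / M = 2 * η := by simp only [hs, hs0]; field_simp
        rw [h2] at h1
        have h3 := rb_id Ω (A 0) z
        rw [dist_comm] at h3
        refine h0 z ⟨rb_ball (A1 0) (mem_ball.2 (by linarith)), ?_⟩ (by linarith)
        rw [mem_ball]
        have h4 := A2 0
        have h5 := hsl 0
        have := dist_triangle z (A 0) q
        have := dist_triangle (A 0) x q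
        have : η ≤ M * η := le_mul_of_one_le_left hη.le (by linarith)
        rw [hs0] at h5
        linarith
      simp only [ha]
      rw [rbAvg_congr (G := fun _ => 0) (by rw [e]; positivity) hz]
      simp [rbAvg]
    have hJ := fun J => rb_csum J a s _ s0 (B * (2 * M) ^ n) ha0 (fun j => rfl) hs0p hb
    have hlim : Filter.Tendsto a Filter.atTop (𝓝 (rbκ n * F x)) := by
      have hδ := rb_ipos hN.isOpen hFr hx
      have hst : Filter.Tendsto s Filter.atTop (𝓝 0) := by
        have := (tendsto_pow_atTop_nhds_zero_of_lt_one (by norm_num : (0 : ℝ) ≤ 1 / 2)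
          (by norm_num)).const_mul s0
        simpa [hs] using this
      have hRpos : 0 < min (infDist x (frontier Ω)) (K * η) := lt_min hδ (by positivity)
      have l1 := rb_avg_lim hRpos (F := F) (x := x) (fun z hz => hF z ⟨rb_ball hx
        (ball_subset_ball (min_le_left _ _) hz), by
          rw [mem_ball] at hz ⊢
          linarith [min_le_right (infDist x (frontier Ω)) (K * η), dist_triangle z x q]⟩)
      have l2 : Filter.Tendsto (fun j => β * s j) Filter.atTop (𝓝[>] 0) := by
        rw [tendsto_nhdsWithin_iff]
        refine ⟨by simpa using hst.const_mul β, Filter.Eventually.of_forall fun j => ?_⟩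
        have := hsp j
        exact mem_Ioi.2 (by positivity)
      refine (l1.comp l2).congr' ?_
      filter_upwards [hst.eventually (ge_mem_nhds hδ)] with j hj
      simp only [Function.comp, ha]
      rw [A4 j hj]
    have hlim2 : Filter.Tendsto (fun j => ENNReal.ofReal (a j ^ 2)) Filter.atTop
        (𝓝 (ENNReal.ofReal (rbκ n ^ 2 * F x ^ 2))) := by
      rw [← mul_pow]
      exact ENNReal.tendsto_ofReal (hlim.pow 2)
    refine le_of_tendsto hlim2 (Filter.Eventually.of_forall fun J => ?_)
    refine (ENNReal.ofReal_le_ofReal (hJ J)).trans ?_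
    have hnn : ∀ j, 0 ≤ ∫ z in Ω ∩ ball (A j) (K1 * (s j / (2 * M))), ‖fderiv ℝ F z‖ ^ 2 :=
      fun j => integral_nonneg fun z => by positivity
    rw [ENNReal.ofReal_sum_of_nonneg (fun j _ => by
      have := hnn j; have := hsp j; positivity)]
    refine le_trans (Finset.sum_le_sum fun j _ => ?_) (ENNReal.sum_le_tsum (Finset.range J))
    rw [← mul_assoc, ENNReal.ofReal_mul (hcc0 j)]
    gcongr
    rw [ofReal_integral_eq_lintegral_ofReal (hI.mono_set (hsubS j))
      (Filter.Eventually.of_forall fun z => by positivity)]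
    rw [hHh, setLIntegral_indicator hSm]
    exact lintegral_mono_set fun z hz => ⟨hsubS j hz, hball j hz.2⟩
  have main : ∫⁻ x in Ω ∩ ball q ρ, ENNReal.ofReal (rbκ n ^ 2 * F x ^ 2) ≤
      ENNReal.ofReal (4 * s0 ^ 2 * (B * (2 * M) ^ n) * (K2 ^ n * V) *
        ∫ z in S, ‖fderiv ℝ F z‖ ^ 2) := by
    have hSm2 : MeasurableSet (Ω ∩ ball q ρ) := hN.isOpen.measurableSet.inter measurableSet_ball
    refine (setLIntegral_mono' hSm2 pt).trans ?_
    refine (setLIntegral_le_lintegral _ _).trans ?_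
    rw [lintegral_tsum (fun j => ((rb_fub_meas hHm _).const_mul _).aemeasurable)]
    have e : ∀ j, ∫⁻ x, ENNReal.ofReal (cc j) * ∫⁻ z in ball x (K2 * s j), Hh z =
        ENNReal.ofReal (2 * s0 * (B * (2 * M) ^ n) * (K2 ^ n * V) *
          (∫ z in S, ‖fderiv ℝ F z‖ ^ 2) * s0 * (1 / 2) ^ j) := by
      intro j
      have hsj := hsp j
      rw [lintegral_const_mul _ (rb_fub_meas hHm _), rb_fub hHm, rb_vol (by positivity), hHh,
        lintegral_indicator hSm, ← ofReal_integral_eq_lintegral_ofReal hI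
        (Filter.Eventually.of_forall fun z => by positivity), ← ENNReal.ofReal_mul (by positivity),
        ← ENNReal.ofReal_mul (hcc0 j)]
      congr 1
      simp only [hcc]
      rw [mul_pow]
      have e1 : s j = s0 * (1 / 2) ^ j := rfl
      rw [← hV]
      have : s j ^ n ≠ 0 := by positivity
      field_simp
      rw [e1]; field_simp; rw [mul_pow]; ring
    simp_rw [e]
    set Q := 2 * s0 * (B * (2 * M) ^ n) * (K2 ^ n * V) *
          (∫ z in S, ‖fderiv ℝ F z‖ ^ 2) * s0 with hQ
    have hI0 : 0 ≤ ∫ z in S, ‖fderiv ℝ F z‖ ^ 2 := integral_nonneg fun z => by positivity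
    have hQ0 : 0 ≤ Q := by positivity
    have hsum : HasSum (fun j : ℕ => Q * ((1 : ℝ) / 2) ^ j) (Q * 2) := hasSum_geometric_two.mul_left Q
    rw [← ENNReal.ofReal_tsum_of_nonneg (fun j => by positivity) hsum.summable, hsum.tsum_eq]
    apply ENNReal.ofReal_le_ofReal
    rw [hQ]; apply le_of_eq; ring
  have hI0 : 0 ≤ ∫ z in S, ‖fderiv ℝ F z‖ ^ 2 := integral_nonneg fun z => by positivity
  have hmeas : AEStronglyMeasurable (fun x => rbκ n ^ 2 * F x ^ 2) (volume.restrict (Ω ∩ ball q ρ)) := by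
    refine ContinuousOn.aestronglyMeasurable (fun z hz => ?_)
      (hN.isOpen.measurableSet.inter measurableSet_ball)
    have := (hF z ⟨hz.1, ball_subset_ball (by nlinarith) hz.2⟩).continuousAt
    exact (this.pow 2).const_mul _ |>.continuousWithinAt
  have fin : ∫ x in Ω ∩ ball q ρ, rbκ n ^ 2 * F x ^ 2 ≤ 4 * s0 ^ 2 * (B * (2 * M) ^ n) * (K2 ^ n * V) *
        ∫ z in S, ‖fderiv ℝ F z‖ ^ 2 := by
    rw [integral_eq_lintegral_of_nonneg_ae (Filter.Eventually.of_forall fun z => by positivity) hmeas]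
    exact ENNReal.toReal_le_of_le_ofReal (by positivity) main
  rw [integral_const_mul] at fin
  have : ∫ x in Ω ∩ ball q ρ, F x ^ 2 ≤ B1 * η ^ 2 * ∫ z in S, ‖fderiv ℝ F z‖ ^ 2 := by
    rw [mul_comm, ← le_div_iff₀ (by positivity)] at fin
    refine fin.trans (le_of_eq ?_)
    rw [hB1, hs0]; field_simp
  refine this.trans ?_
  have : B1 ≤ K := by rw [hK]; have : 0 ≤ 60 * M ^ 2 * K2 := by positivity
                      linarith
  gcongr

open MeasureTheory Metric Set
open scoped RealInnerProductSpace ENNReal NNReal Topology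

/-- scaled floor -/
noncomputable def rbFl {n : ℕ} (ε : ℝ) (y : EuclideanSpace ℝ (Fin n)) : EuclideanSpace ℝ (Fin n) :=
  WithLp.toLp 2 fun i => ε * (⌊y i / ε⌋ : ℝ)

lemma rbFl_dist {n : ℕ} {ε : ℝ} (hε : 0 < ε) (y : EuclideanSpace ℝ (Fin n)) :
    dist (rbFl ε y) y ≤ n * ε := by
  rw [EuclideanSpace.dist_eq]
  apply Real.sqrt_le_iff.2
  refine ⟨by positivity, ?_⟩
  have h : ∀ i : Fin n, dist ((rbFl ε y) i) (y i) ^ 2 ≤ ε ^ 2 := by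
    intro i
    have h1 := Int.floor_le (y i / ε)
    have h2 := Int.lt_floor_add_one (y i / ε)
    rw [le_div_iff₀ hε] at h1
    rw [div_lt_iff₀ hε] at h2
    rw [Real.dist_eq, sq_abs]
    simp only [rbFl]
    nlinarith
  refine (Finset.sum_le_sum fun i _ => h i).trans ?_
  simp only [Finset.sum_const, Finset.card_univ, Fintype.card_fin, nsmul_eq_mul, mul_pow]
  gcongr
  rcases Nat.eq_zero_or_pos n with h0 | h0
  · subst h0; simp
  · have : (1 : ℝ) ≤ n := by exact_mod_cast h0
    nlinarith

lemma rbFl_meas {n : ℕ} (ε : ℝ) (T : EuclideanSpace ℝ (Fin n) → ℝ) :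
    Measurable fun y => T (rbFl ε y) := by
  have h1 : Measurable fun y : EuclideanSpace ℝ (Fin n) => fun i => ⌊y i / ε⌋ := by
    refine measurable_pi_lambda _ fun i => Int.measurable_floor.comp ?_
    have : Continuous fun y : EuclideanSpace ℝ (Fin n) => y i / ε := by fun_prop
    exact this.measurable
  have h2 : Measurable fun k : Fin n → ℤ => T (WithLp.toLp 2 fun i => ε * (k i : ℝ)) :=
    measurable_of_countable _
  exact h2.comp h1

lemma rb_bump (n : ℕ) : ∃ (b : EuclideanSpace ℝ (Fin n) → ℝ) (L : ℝ≥0), ContDiff ℝ (⊤ : ℕ∞) b ∧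
    (∀ z, 1 ≤ ‖z‖ → b z = 0) ∧ (∀ z, 0 ≤ b z) ∧ ∫ z, b z = 1 ∧ LipschitzWith L b := by
  let φ : ContDiffBump (0 : EuclideanSpace ℝ (Fin n)) := ⟨1 / 2, 1, by norm_num, by norm_num⟩
  have h1 : ContDiff ℝ (⊤ : ℕ∞) (φ.normed volume) := φ.contDiff_normed
  obtain ⟨L, hL⟩ := ContDiff.lipschitzWith_of_hasCompactSupport φ.hasCompactSupport_normed h1 (by simp)
  refine ⟨φ.normed volume, L, h1, fun z hz => ?_, φ.nonneg_normed, φ.integral_normed, hL⟩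
  by_contra h
  have : z ∈ Function.support (φ.normed volume) := h
  rw [φ.support_normed_eq] at this
  simp at this
  change ‖z‖ < 1 at this
  linarith

/-- general mollification facts -/
lemma rb_moll (n : ℕ) : ∃ C : ℝ, 0 < C ∧ ∀ (e : EuclideanSpace ℝ (Fin n) → ℝ) (B : ℝ),
    Measurable e → (∀ t, |e t| ≤ B) → ∀ ε : ℝ, 0 < ε →
    ∃ g : EuclideanSpace ℝ (Fin n) → ℝ, ContDiff ℝ (⊤ : ℕ∞) g ∧
      (∀ x, (∀ t ∈ ball x ε, e t = 0) → g x = 0) ∧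
      (∀ x m s, (∀ t ∈ ball x ε, |e t - m| ≤ s) → |g x - m| ≤ s) ∧
      (∀ x m s, (∀ t ∈ ball x (2 * ε), |e t - m| ≤ s) → ‖fderiv ℝ g x‖ ≤ C * s / ε) := by
  obtain ⟨b, L, b1, b2, b3, b4, b5⟩ := rb_bump n
  set V := (volume (ball (0 : EuclideanSpace ℝ (Fin n)) 1)).toReal with hV
  have hV0 : 0 ≤ V := ENNReal.toReal_nonneg
  refine ⟨L * (2 ^ n * V) + 1, by positivity, fun e B he hB ε hε => ?_⟩
  set r : EuclideanSpace ℝ (Fin n) → ℝ := fun z => (ε ^ n)⁻¹ * b (ε⁻¹ • z) with hr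
  have hrs : ContDiff ℝ (⊤ : ℕ∞) r := by
    have : ContDiff ℝ (⊤ : ℕ∞) (fun z : EuclideanSpace ℝ (Fin n) => ε⁻¹ • z) := contDiff_const_smul _
    exact contDiff_const.mul (b1.comp this)
  have hrc : Continuous r := hrs.continuous
  have hrz : ∀ z, ε ≤ ‖z‖ → r z = 0 := fun z hz => by
    simp only [hr]
    rw [b2, mul_zero]
    rw [norm_smul, Real.norm_of_nonneg (by positivity), inv_mul_eq_div, one_le_div hε]
    exact hz
  have hr0 : ∀ z, 0 ≤ r z := fun z => mul_nonneg (by positivity) (b3 _)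
  have hrsupp : HasCompactSupport r :=
    HasCompactSupport.intro (isCompact_closedBall (0 : EuclideanSpace ℝ (Fin n)) ε) fun z hz =>
      hrz z (by simp at hz; exact hz.le)
  have hrint : ∫ z, r z = 1 := by
    have := rb_cov r 0 hε
    simp only [zero_add] at this
    have e1 : ∀ z : EuclideanSpace ℝ (Fin n), r (ε • z) = (ε ^ n)⁻¹ * b z := fun z => by
      simp only [hr]; rw [smul_smul, inv_mul_cancel₀ hε.ne', one_smul]
    simp_rw [e1] at this
    rw [integral_const_mul, b4] at this
    have h0 : (ε ^ n)⁻¹ ≠ 0 := by positivity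
    exact (mul_left_cancel₀ h0 this).symm
  have hrx : ∀ x : EuclideanSpace ℝ (Fin n), ∫ t, r (x - t) = 1 := fun x => by
    rw [integral_sub_left_eq_self r]; exact hrint
  have hrxi : ∀ x : EuclideanSpace ℝ (Fin n), Integrable fun t => r (x - t) := fun x =>
    (hrc.integrable_of_hasCompactSupport hrsupp).comp_sub_left x
  have hei : ∀ x : EuclideanSpace ℝ (Fin n), Integrable fun t => e t * r (x - t) := fun x =>
    (hrxi x).bdd_mul (c := B) he.aestronglyMeasurable (Filter.Eventually.of_forall hB)
  have hel : LocallyIntegrable e volume := by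
    have : LocallyIntegrable (fun _ : EuclideanSpace ℝ (Fin n) => B) volume := locallyIntegrable_const B
    exact this.mono he.aestronglyMeasurable (Filter.Eventually.of_forall fun t =>
      (hB t).trans (le_abs_self B))
  have gd : ∀ x m, (∫ t, e t * r (x - t)) - m = ∫ t, (e t - m) * r (x - t) := fun x m => by
    have : ∀ t, (e t - m) * r (x - t) = e t * r (x - t) - m * r (x - t) := fun t => by ring
    simp_rw [this]
    rw [integral_sub (hei x) ((hrxi x).const_mul m), integral_const_mul, hrx, mul_one]
  refine ⟨fun x => ∫ t, e t * r (x - t), ?_, ?_, ?_, ?_⟩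
  · have := hrsupp.contDiff_convolution_right (𝕜 := ℝ) (n := (⊤ : ℕ∞)) (ContinuousLinearMap.mul ℝ ℝ) hel hrs
    exact this
  · intro x hx
    have : ∀ t, e t * r (x - t) = 0 := fun t => by
      by_cases h : t ∈ ball x ε
      · rw [hx t h, zero_mul]
      · rw [hrz, mul_zero]
        rw [mem_ball, not_lt, dist_comm, dist_eq_norm] at h
        exact h
    simp [this]
  · intro x m s hs
    simp only
    rw [gd]
    rw [← Real.norm_eq_abs]
    have : ∫ t, s * r (x - t) = s := by rw [integral_const_mul, hrx, mul_one]
    rw [← this]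
    refine norm_integral_le_of_norm_le ((hrxi x).const_mul s) (Filter.Eventually.of_forall fun t => ?_)
    rw [norm_mul, Real.norm_of_nonneg (hr0 _)]
    by_cases h : t ∈ ball x ε
    · exact mul_le_mul_of_nonneg_right (hs t h) (hr0 _)
    · rw [hrz, mul_zero, mul_zero]
      rw [mem_ball, not_lt, dist_comm, dist_eq_norm] at h
      exact h
  · intro x m s hs
    have hs0 : 0 ≤ s := (abs_nonneg _).trans (hs x (mem_ball_self (by positivity)))
    have hC : 0 ≤ L * (2 ^ n * V) * s / ε := by positivity
    have hle : L * (2 ^ n * V) * s / ε ≤ (L * (2 ^ n * V) + 1) * s / ε := by gcongr; linarith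
    refine le_trans ?_ hle
    refine norm_fderiv_le_of_lip' ℝ hC ?_
    filter_upwards [ball_mem_nhds x hε] with y hy
    have e1 : (∫ t, e t * r (y - t)) - (∫ t, e t * r (x - t)) =
        ∫ t, (e t - m) * (r (y - t) - r (x - t)) := by
      have h1 := gd y m
      have h2 := gd x m
      have : ∀ t, (e t - m) * (r (y - t) - r (x - t)) = (e t - m) * r (y - t) - (e t - m) * r (x - t) :=
        fun t => by ring
      simp_rw [this]
      have i : ∀ x, Integrable fun t => (e t - m) * r (x - t) := fun x => by
        have : ∀ t, (e t - m) * r (x - t) = e t * r (x - t) - m * r (x - t) := fun t => by ring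
        simp_rw [this]
        exact (hei x).sub ((hrxi x).const_mul m)
      rw [integral_sub (i y) (i x), ← h1, ← h2]; ring
    rw [e1]
    have hb : ∀ t, ‖(e t - m) * (r (y - t) - r (x - t))‖ ≤
        indicator (ball x (2 * ε)) (fun _ => s * ((ε ^ n)⁻¹ * (L * (ε⁻¹ * ‖y - x‖)))) t := by
      intro t
      by_cases h : t ∈ ball x (2 * ε)
      · rw [indicator_of_mem h, norm_mul]
        refine mul_le_mul (hs t h) ?_ (norm_nonneg _) hs0
        simp only [hr]
        rw [← mul_sub, norm_mul, Real.norm_of_nonneg (by positivity : 0 ≤ (ε ^ n)⁻¹)]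
        gcongr
        have := b5.dist_le_mul (ε⁻¹ • (y - t)) (ε⁻¹ • (x - t))
        rw [dist_eq_norm, dist_eq_norm, ← smul_sub, norm_smul, sub_sub_sub_cancel_right,
          Real.norm_of_nonneg (by positivity : 0 ≤ ε⁻¹)] at this
        exact this
      · rw [indicator_of_notMem h]
        rw [mem_ball, not_lt] at h
        rw [mem_ball] at hy
        have h1 : ε ≤ ‖x - t‖ := by rw [← dist_eq_norm, dist_comm]; linarith
        have h2 : ε ≤ ‖y - t‖ := by
          rw [← dist_eq_norm, dist_comm]; linarith [dist_triangle t y x]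
        rw [hrz _ h1, hrz _ h2]; simp
    refine (norm_integral_le_of_norm_le ?_ (Filter.Eventually.of_forall hb)).trans (le_of_eq ?_)
    · rw [integrable_indicator_iff measurableSet_ball]
      exact integrableOn_const measure_ball_lt_top.ne
    · rw [integral_indicator measurableSet_ball, setIntegral_const, measureReal_def,
        Measure.addHaar_ball_center, rb_vol (by positivity), ENNReal.toReal_ofReal (by positivity), mul_pow, smul_eq_mul]
      rw [← hV]
      field_simp

open MeasureTheory Metric Set
open scoped RealInnerProductSpace ENNReal NNReal Topology

lemma rb_avg_near {n : ℕ} {F : EuclideanSpace ℝ (Fin n) → ℝ} {p : EuclideanSpace ℝ (Fin n)}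
    {r m s : ℝ} (hr : 0 < r) (hF : ContinuousOn F (closedBall p r)) (h : ∀ z ∈ ball p r, |F z - m| ≤ s) :
    |rbAvg F p r / rbκ n - m| ≤ s := by
  have hκ := rbκ_pos n
  have hb : ∀ z, ‖rbK z * (F (p + r • z) - m)‖ ≤ s * rbK z := fun z => by
    by_cases hz : 1 ≤ ‖z‖
    · rw [rbK_zero hz]; simp
    · push Not at hz
      rw [norm_mul, Real.norm_of_nonneg (rbK_nonneg z), mul_comm]
      exact mul_le_mul_of_nonneg_right (h _ (rb_norm_seg hr (by simp) hz)) (rbK_nonneg z)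
  have hi : Integrable fun z => rbK z * F (p + r • z) := by
    have h1 : IntegrableOn (fun z => rbK z * F (p + r • z)) (closedBall 0 1) := by
      refine ContinuousOn.integrableOn_compact (isCompact_closedBall _ _) ?_
      refine rbK_cont.continuousOn.mul (hF.comp (by fun_prop) fun z hz => ?_)
      rw [mem_closedBall, dist_eq_norm, add_sub_cancel_left, norm_smul, Real.norm_of_nonneg hr.le]
      simp at hz
      nlinarith
    refine (integrableOn_iff_integrable_of_support_subset fun z hz => ?_).1 h1
    simp only [mem_closedBall, dist_zero_right]
    by_contra hc
    push Not at hc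
    exact hz (by simp [rbK_zero hc.le])
  have e : rbAvg F p r / rbκ n - m = (∫ z, rbK z * (F (p + r • z) - m)) / rbκ n := by
    have : ∀ z, rbK z * (F (p + r • z) - m) = rbK z * F (p + r • z) - rbK z * m := fun z => by ring
    simp_rw [this]
    rw [integral_sub hi (rbK_int.mul_const m), integral_mul_const]
    change _ = (rbAvg F p r - rbκ n * m) / rbκ n
    field_simp
  rw [e, abs_div, abs_of_pos hκ, div_le_iff₀ hκ, ← Real.norm_eq_abs]
  refine (norm_integral_le_of_norm_le (rbK_int.const_mul s) (Filter.Eventually.of_forall hb)).trans ?_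
  rw [integral_const_mul]; rfl

set_option maxHeartbeats 1600000 in
lemma rb_approx (n : ℕ) (M : ℝ) : ∃ C : ℝ, 0 < C ∧
    ∀ Ω : Set (EuclideanSpace ℝ (Fin n)), IsOneSidedNTA M Ω → Bornology.IsBounded Ω →
    (frontier Ω).Nonempty → 0 < diam Ω → ∀ (Q : EuclideanSpace ℝ (Fin n)) (ρ1 : ℝ)
    (ψ : EuclideanSpace ℝ (Fin n) → ℝ), ContinuousOn ψ (closure Ω) →
    (∀ z ∈ Ω, ContDiffAt ℝ 1 ψ z) → IntegrableOn (fun z => ‖fderiv ℝ ψ z‖ ^ 2) Ω →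
    (∀ z ∉ ball Q ρ1, ψ z = 0) → ∀ τ : ℝ, 0 < τ →
    ∃ g : EuclideanSpace ℝ (Fin n) → ℝ, ContDiff ℝ (⊤ : ℕ∞) g ∧ HasCompactSupport g ∧
      tsupport g ⊆ closedBall Q (ρ1 + τ) ∧ (∀ x ∈ closure Ω, |g x - ψ x| ≤ τ) ∧
      IntegrableOn (fun z => ‖fderiv ℝ g z‖ ^ 2) Ω ∧
      ∫ z in Ω, ‖fderiv ℝ g z‖ ^ 2 ≤ C * ∫ z in Ω, ‖fderiv ℝ ψ z‖ ^ 2 := by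
  by_cases hM1 : 1 < M
  swap
  · exact ⟨1, one_pos, fun Ω h => absurd h.M_gt_one hM1⟩
  obtain ⟨C1, hC1, HM⟩ := rb_moll n
  set m0 : ℝ := 4 * n + 12 with hm0
  have hm1 : 12 ≤ m0 := by rw [hm0]; have : (0 : ℝ) ≤ n := by positivity
                           linarith
  obtain ⟨K, B, hK, hB, HA⟩ := rb_ac n M (m0 * M) (by nlinarith)
  have hκ := rbκ_pos n
  set V := (volume (ball (0 : EuclideanSpace ℝ (Fin n)) 1)).toReal with hV
  have hV0 : 0 ≤ V := ENNReal.toReal_nonneg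
  set K2 := m0 + K with hK2
  refine ⟨C1 ^ 2 * (B * M ^ n / rbκ n ^ 2) * (K2 ^ n * V) + 1, by positivity, ?_⟩
  intro Ω hN hbd hFr hD Q ρ1 ψ hψc hψd hψI hψ0 τ hτ
  have hcomp : IsCompact (closure Ω) := hbd.isCompact_closure
  obtain ⟨B0, hB0⟩ := hcomp.exists_bound_of_continuousOn hψc
  have huc := hcomp.uniformContinuousOn_of_continuous hψc
  obtain ⟨d0, hd0, hd⟩ := Metric.uniformContinuousOn_iff.1 huc τ hτ
  -- choose ε
  obtain ⟨ε, hε, hε1, hε2, hε3⟩ : ∃ ε : ℝ, 0 < ε ∧ m0 * ε < diam Ω / 10 ∧ m0 * ε < d0 ∧ m0 * ε < τ := by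
    set t := min (diam Ω / 10) (min d0 τ) with ht
    have ht0 : 0 < t := lt_min (by positivity) (lt_min hd0 hτ)
    refine ⟨t / (2 * m0), by positivity, ?_, ?_, ?_⟩
    all_goals
      have e : m0 * (t / (2 * m0)) = t / 2 := by field_simp
      rw [e]
    · have := min_le_left (diam Ω / 10) (min d0 τ); linarith
    · have := (min_le_right (diam Ω / 10) (min d0 τ)).trans (min_le_left _ _); linarith
    · have := (min_le_right (diam Ω / 10) (min d0 τ)).trans (min_le_right _ _); linarith
  have hεd : ε < diam Ω / 10 := by nlinarith
  have hn0 : (0 : ℝ) ≤ n := by positivity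
  set r := ε / M / K with hr
  have hr0 : 0 < r := by positivity
  have hrM : r ≤ ε / M := div_le_self (by positivity) hK
  have hMε : ε / M ≤ ε := div_le_self hε.le hM1.le
  -- selection
  have hsel : ∀ p : EuclideanSpace ℝ (Fin n), ∃ A : EuclideanSpace ℝ (Fin n),
      (∃ z ∈ Ω, dist z p ≤ (n + 2) * ε) → A ∈ Ω ∧ dist A p ≤ (n + 4) * ε ∧
        ε / M ≤ infDist A (frontier Ω) := by
    intro p
    by_cases h : ∃ z ∈ Ω, dist z p ≤ (n + 2) * ε
    · obtain ⟨z, hz, hzp⟩ := h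
      obtain ⟨A, A1, A2, A3, _⟩ := rb_ck hN hFr (subset_closure hz) hε hεd
      refine ⟨A, fun _ => ⟨A1, ?_, A3⟩⟩
      linarith [dist_triangle A z p]
    · exact ⟨p, fun h' => absurd h' h⟩
  choose A hA using hsel
  classical
  set T : EuclideanSpace ℝ (Fin n) → ℝ := fun p =>
    if (∃ z ∈ Ω, dist z p ≤ (n + 2) * ε) then rbAvg ψ (A p) r / rbκ n else 0 with hT
  set e : EuclideanSpace ℝ (Fin n) → ℝ := fun y => T (rbFl ε y) with he
  have hcb : ∀ p, (∃ z ∈ Ω, dist z p ≤ (n + 2) * ε) → closedBall (A p) r ⊆ closure Ω := by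
    intro p hp
    obtain ⟨h1, h2, h3⟩ := hA p hp
    calc closedBall (A p) r = closure (ball (A p) r) := (closure_ball _ hr0.ne').symm
      _ ⊆ closure Ω := closure_mono ((ball_subset_ball (by linarith)).trans (rb_ball h1))
  have hTm : ∀ p m s, (∃ z ∈ Ω, dist z p ≤ (n + 2) * ε) → (∀ z ∈ ball (A p) r, |ψ z - m| ≤ s) →
      |T p - m| ≤ s := by
    intro p m s hp h
    simp only [hT]
    rw [if_pos hp]
    exact rb_avg_near hr0 (hψc.mono (hcb p hp)) h
  have hBnn : 0 ≤ B0 := by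
    obtain ⟨q, hq⟩ := hFr
    exact (norm_nonneg _).trans (hB0 q (frontier_subset_closure hq))
  have hTb : ∀ p, |T p| ≤ B0 := by
    intro p
    by_cases hp : ∃ z ∈ Ω, dist z p ≤ (n + 2) * ε
    · have := hTm p 0 B0 hp (fun z hz => by
        rw [sub_zero]; exact hB0 z (hcb p hp (ball_subset_closedBall hz)))
      simpa using this
    · simp only [hT]; rw [if_neg hp]; simpa using hBnn
  obtain ⟨g, g1, g2, g3, g4⟩ := HM e B0 (rbFl_meas ε T) (fun t => hTb _) ε hε
  -- near facts
  have hnear : ∀ x ∈ closure Ω, ∀ t ∈ ball x (2 * ε), (∃ z ∈ Ω, dist z (rbFl ε t) ≤ (n + 2) * ε) := by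
    intro x hx t ht
    rw [mem_ball] at ht
    obtain ⟨z, hz, hzx⟩ := Metric.mem_closure_iff.1 hx (2 * ε - dist t x) (by linarith)
    refine ⟨z, hz, ?_⟩
    have h1 := rbFl_dist hε t
    have h2 := dist_triangle z x (rbFl ε t)
    have h3 := dist_triangle x t (rbFl ε t)
    rw [dist_comm] at hzx
    rw [dist_comm t] at h3
    rw [dist_comm x t] at h3
    linarith
  have hAx : ∀ x ∈ closure Ω, ∀ t ∈ ball x (2 * ε), dist (A (rbFl ε t)) x ≤ (2 * n + 6) * ε := by
    intro x hx t ht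
    obtain ⟨h1, h2, h3⟩ := hA _ (hnear x hx t ht)
    have h4 := rbFl_dist hε t
    rw [mem_ball] at ht
    linarith [dist_triangle (A (rbFl ε t)) (rbFl ε t) x, dist_triangle (rbFl ε t) t x]
  have hsupp : ∀ x ∉ closedBall Q (ρ1 + τ), g x = 0 := by
    intro x hx
    apply g2
    intro t ht
    rw [mem_closedBall, not_le] at hx
    rw [mem_ball, dist_comm] at ht
    simp only [he]
    by_cases hp : ∃ z ∈ Ω, dist z (rbFl ε t) ≤ (n + 2) * ε
    · obtain ⟨h1, h2, h3⟩ := hA _ hp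
      have h4 := rbFl_dist hε t
      have : |T (rbFl ε t) - 0| ≤ 0 := by
        refine hTm _ _ _ hp fun z hz => ?_
        rw [hψ0 z, sub_zero, abs_zero]
        rw [mem_ball, not_lt]
        rw [mem_ball] at hz
        have q1 := dist_triangle x t Q
        have q2 := dist_triangle t (rbFl ε t) Q
        have q3 := dist_triangle (rbFl ε t) (A (rbFl ε t)) Q
        have q4 := dist_triangle (A (rbFl ε t)) z Q
        rw [dist_comm (rbFl ε t) (A _)] at q3
        rw [dist_comm t (rbFl ε t)] at q2
        rw [dist_comm (A _) z] at q4
        have q5 : (2 * n + 7) * ε ≤ m0 * ε := by rw [hm0]; gcongr <;> linarith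
        ring_nf at q5 h2 h4
        linarith
      simpa using this
    · simp only [hT]; rw [if_neg hp]
  have hcs : HasCompactSupport g := HasCompactSupport.intro (isCompact_closedBall _ _) hsupp
  refine ⟨g, g1, hcs, ?_, ?_, ?_, ?_⟩
  · refine closure_minimal (fun x hx => ?_) isClosed_closedBall
    by_contra h
    exact hx (hsupp x h)
  · intro x hx
    apply g3
    intro t ht
    have ht2 : t ∈ ball x (2 * ε) := ball_subset_ball (by linarith) ht
    refine hTm _ _ _ (hnear x hx t ht2) fun z hz => ?_
    have := hd z (hcb _ (hnear x hx t ht2) (ball_subset_closedBall hz)) x hx (by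
      have h1 := hAx x hx t ht2
      rw [mem_ball] at hz
      have := dist_triangle z (A (rbFl ε t)) x
      have : (2 * n + 7) * ε ≤ m0 * ε := by rw [hm0]; gcongr <;> linarith
      linarith)
    rw [Real.dist_eq] at this
    exact this.le
  · have : Continuous fun z => ‖fderiv ℝ g z‖ ^ 2 := by
      have := g1.continuous_fderiv (by simp)
      fun_prop
    exact ((this.continuousOn.integrableOn_compact hcomp).mono_set subset_closure)
  · -- gradient bound
    set Hh : EuclideanSpace ℝ (Fin n) → ℝ≥0∞ :=
      indicator Ω fun z => ENNReal.ofReal (‖fderiv ℝ ψ z‖ ^ 2) with hHh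
    have hΩm := hN.isOpen.measurableSet
    have hHm : Measurable Hh := by
      refine Measurable.indicator ?_ hΩm
      exact ((measurable_fderiv ℝ ψ).norm.pow_const 2).ennreal_ofReal
    have pt : ∀ x ∈ Ω, ENNReal.ofReal (‖fderiv ℝ g x‖ ^ 2) ≤
        ENNReal.ofReal (C1 ^ 2 * (B * M ^ n / rbκ n ^ 2) * (ε ^ n)⁻¹) *
          ∫⁻ z in ball x (K2 * ε), Hh z := by
      intro x hx
      have hxc := subset_closure hx
      have hxx : x ∈ ball x (2 * ε) := mem_ball_self (by positivity)
      set I := ∫ z in Ω ∩ ball x (K2 * ε), ‖fderiv ℝ ψ z‖ ^ 2 with hI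
      have hI0 : 0 ≤ I := integral_nonneg fun z => by positivity
      have hIi : IntegrableOn (fun z => ‖fderiv ℝ ψ z‖ ^ 2) (Ω ∩ ball x (K2 * ε)) :=
        hψI.mono_set inter_subset_left
      have key : ∀ t ∈ ball x (2 * ε), |e t - e x| ≤
          √(B * M ^ n / rbκ n ^ 2 * (ε ^ 2 * (ε ^ n)⁻¹ * I)) := by
        intro t ht
        have n1 := hnear x hxc t ht
        have n2 := hnear x hxc x hxx
        obtain ⟨a1, a2, a3⟩ := hA _ n1
        obtain ⟨b1, b2, b3⟩ := hA _ n2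
        have d1 := hAx x hxc t ht
        have d2 := hAx x hxc x hxx
        have eM : m0 * M * (ε / M) = m0 * ε := by field_simp
        have hsub : Ω ∩ ball (A (rbFl ε t)) (K * (ε / M)) ⊆ Ω ∩ ball x (K2 * ε) := by
          refine inter_subset_inter_right _ fun z hz => ?_
          rw [mem_ball] at hz ⊢
          have h1 := dist_triangle z (A (rbFl ε t)) x
          have h2 : K * (ε / M) ≤ K * ε := by gcongr
          have h3 : (2 * n + 6) * ε ≤ m0 * ε := by rw [hm0]; gcongr <;> linarith
          rw [hK2]; linarith
        have hac := HA Ω hN _ a1 _ b1 (ε / M) (by positivity) a3 b3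
          (by
            rw [eM, hm0]
            have := dist_triangle (A (rbFl ε t)) x (A (rbFl ε x))
            rw [dist_comm x] at this
            linarith) (by rw [eM]; exact hε1) r r
          (by rw [hr]; gcongr; linarith) le_rfl (by rw [hr]; gcongr; linarith) le_rfl ψ
          (fun z hz => hψd z hz.1) (hψI.mono_set inter_subset_left)
        have hIle : ∫ z in Ω ∩ ball (A (rbFl ε t)) (K * (ε / M)), ‖fderiv ℝ ψ z‖ ^ 2 ≤ I :=
          setIntegral_mono_set hIi (Filter.Eventually.of_forall fun z => by positivity)
            (Filter.Eventually.of_forall hsub)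
        apply Real.abs_le_sqrt
        have ee : e t - e x = (rbAvg ψ (A (rbFl ε t)) r - rbAvg ψ (A (rbFl ε x)) r) / rbκ n := by
          simp only [he, hT]
          rw [if_pos n1, if_pos n2]; ring
        rw [ee, div_pow, div_le_iff₀ (by positivity)]
        refine hac.trans ?_
        calc _ ≤ B * ((ε / M) ^ 2 * ((ε / M) ^ n)⁻¹ * I) := by gcongr
          _ = B * M ^ n * (ε ^ n)⁻¹ * I * (ε / M) ^ 2 := by rw [div_pow _ _ n]; field_simp
          _ ≤ B * M ^ n * (ε ^ n)⁻¹ * I * ε ^ 2 := by gcongr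
          _ = _ := by field_simp
      have hg := g4 x (e x) _ key
      have hsq : ‖fderiv ℝ g x‖ ^ 2 ≤ C1 ^ 2 * (B * M ^ n / rbκ n ^ 2) * (ε ^ n)⁻¹ * I := by
        calc _ ≤ (C1 * √(B * M ^ n / rbκ n ^ 2 * (ε ^ 2 * (ε ^ n)⁻¹ * I)) / ε) ^ 2 := by gcongr
          _ = _ := by
            rw [div_pow, mul_pow, Real.sq_sqrt (by positivity)]; field_simp
      refine (ENNReal.ofReal_le_ofReal hsq).trans ?_
      rw [ENNReal.ofReal_mul (by positivity)]
      gcongr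
      rw [hI, ofReal_integral_eq_lintegral_ofReal hIi
        (Filter.Eventually.of_forall fun z => by positivity), hHh, setLIntegral_indicator hΩm]
    have main : ∫⁻ x in Ω, ENNReal.ofReal (‖fderiv ℝ g x‖ ^ 2) ≤
        ENNReal.ofReal (C1 ^ 2 * (B * M ^ n / rbκ n ^ 2) * (K2 ^ n * V) *
          ∫ z in Ω, ‖fderiv ℝ ψ z‖ ^ 2) := by
      refine (setLIntegral_mono' hΩm pt).trans ?_
      refine (setLIntegral_le_lintegral _ _).trans ?_
      rw [lintegral_const_mul _ (rb_fub_meas hHm _), rb_fub hHm, rb_vol (by positivity), hHh,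
        lintegral_indicator hΩm, ← ofReal_integral_eq_lintegral_ofReal hψI
        (Filter.Eventually.of_forall fun z => by positivity), ← ENNReal.ofReal_mul (by positivity),
        ← ENNReal.ofReal_mul (by positivity)]
      apply ENNReal.ofReal_le_ofReal
      rw [mul_pow, ← hV]
      apply le_of_eq
      field_simp
    have hI0 : 0 ≤ ∫ z in Ω, ‖fderiv ℝ ψ z‖ ^ 2 := integral_nonneg fun z => by positivity
    have hm : AEStronglyMeasurable (fun z => ‖fderiv ℝ g z‖ ^ 2) (volume.restrict Ω) := by
      have h1 : Continuous fun z => ‖fderiv ℝ g z‖ ^ 2 := by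
        have := g1.continuous_fderiv (by simp)
        fun_prop
      exact h1.aestronglyMeasurable
    rw [integral_eq_lintegral_of_nonneg_ae (Filter.Eventually.of_forall fun z => by positivity) hm]
    refine (ENNReal.toReal_le_of_le_ofReal (by positivity) main).trans ?_
    gcongr
    linarith

open MeasureTheory Metric Set
open scoped RealInnerProductSpace ENNReal NNReal Topology

structure RbSol {n : ℕ} (Ω : Set (EuclideanSpace ℝ (Fin n)))
    (σ : Measure (EuclideanSpace ℝ (Fin n))) (a : ℝ) (Q : EuclideanSpace ℝ (Fin n)) (ρ : ℝ)
    (u : EuclideanSpace ℝ (Fin n) → ℝ) : Prop where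
  contOn : ContinuousOn u (closure Ω ∩ ball Q ρ)
  harmonic : IsHarmonicOn u (Ω ∩ ball Q ρ)
  grad_L2 : ∀ ρ' : ℝ, ρ' < ρ →
    IntegrableOn (fun X => ‖gradient u X‖ ^ 2) (Ω ∩ ball Q ρ') volume
  weak : ∀ φ : EuclideanSpace ℝ (Fin n) → ℝ,
    ContDiff ℝ (⊤ : ℕ∞) φ → HasCompactSupport φ → tsupport φ ⊆ ball Q ρ →
    (∫ X in Ω, ⟪gradient u X, gradient φ X⟫) + a * ∫ P in frontier Ω, u P * φ P ∂σ = 0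

lemma rb_grad_meas {n : ℕ} (f : EuclideanSpace ℝ (Fin n) → ℝ) : Measurable (gradient f) := by
  unfold gradient
  exact (LinearIsometryEquiv.continuous _).measurable.comp (measurable_fderiv ℝ f)

lemma rb_inner_int {n : ℕ} {f g : EuclideanSpace ℝ (Fin n) → ℝ} {S : Set (EuclideanSpace ℝ (Fin n))}
    (hf : IntegrableOn (fun X => ‖gradient f X‖ ^ 2) S)
    (hg : IntegrableOn (fun X => ‖gradient g X‖ ^ 2) S) :
    IntegrableOn (fun X => ⟪gradient f X, gradient g X⟫) S := by
  refine Integrable.mono' (Integrable.add hf hg)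
    ((rb_grad_meas f).inner (rb_grad_meas g)).aestronglyMeasurable ?_
  refine Filter.Eventually.of_forall fun x => ?_
  refine (norm_inner_le_norm _ _).trans ?_
  show _ ≤ ‖gradient f x‖ ^ 2 + ‖gradient g x‖ ^ 2
  nlinarith [sq_nonneg (‖gradient f x‖ - ‖gradient g x‖), norm_nonneg (gradient f x),
    norm_nonneg (gradient g x)]

set_option maxHeartbeats 1600000 in
/-- interior cancellation -/
lemma rb_interior {n : ℕ} {S : Set (EuclideanSpace ℝ (Fin n))} (hS : IsOpen S)
    (hSb : Bornology.IsBounded S) {w : EuclideanSpace ℝ (Fin n) → ℝ} (hw : IsHarmonicOn w S)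
    (hwI : IntegrableOn (fun X => ‖gradient w X‖ ^ 2) S) {s G : ℝ} (hs : 0 < s) (hG : 0 ≤ G) :
    ∃ N : ℝ, 0 ≤ N ∧ ∀ θ : EuclideanSpace ℝ (Fin n) → ℝ, ∀ τ : ℝ,
      (∀ x ∈ S, ContDiffAt ℝ 1 θ x) → (∀ x ∈ S, |θ x| ≤ τ) →
      IntegrableOn (fun X => ‖gradient θ X‖ ^ 2) S → ∫ X in S, ‖gradient θ X‖ ^ 2 ≤ G →
      |∫ X in S, ⟪gradient w X, gradient θ X⟫| ≤ s * (1 + G) + N * τ := by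
  obtain ⟨F, F1, F2, F3, F4⟩ := hS.exists_iUnion_isClosed
  have hSm := hS.measurableSet
  have hlim := tendsto_setIntegral_of_monotone (μ := volume) (fun i => (F1 i).measurableSet) F4
    (f := fun X => ‖gradient w X‖ ^ 2) (by rw [F3]; exact hwI)
  rw [F3] at hlim
  obtain ⟨m, hm⟩ := ((tendsto_order.1 hlim).1 ((∫ X in S, ‖gradient w X‖ ^ 2) - s ^ 2)
    (by linarith [pow_pos hs 2])).exists
  set K := F m with hK
  have hKc : IsCompact K := isCompact_of_isClosed_isBounded (F1 m) (hSb.subset (F2 m))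
  have hKm := (F1 m).measurableSet
  have hdiff : ∫ X in S \ K, ‖gradient w X‖ ^ 2 ≤ s ^ 2 := by
    rw [setIntegral_diff hKm hwI (F2 m)]; linarith
  obtain ⟨χ, c1, c2, c3, c4, c5⟩ := rb_cutoff hKc hS (F2 m)
  have hχI : IntegrableOn (fun X => ‖gradient χ X‖ ^ 2) S := by
    have h1 : Continuous fun z => ‖gradient χ z‖ ^ 2 := by
      simp only [rb_norm_grad]
      have := c1.continuous_fderiv (by simp)
      fun_prop
    refine Integrable.integrableOn ?_
    refine h1.integrable_of_hasCompactSupport ?_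
    refine c2.mono' ?_
    intro x hx
    by_contra h
    apply hx
    have := notMem_tsupport_iff_eventuallyEq.1 h
    simp only [rb_norm_grad]
    rw [this.fderiv_eq]
    simp
  have hwχ := rb_inner_int hwI hχI
  refine ⟨∫ X in S, |⟪gradient w X, gradient χ X⟫|, integral_nonneg fun _ => abs_nonneg _, ?_⟩
  intro θ τ hθ hθτ hθI hθG
  have hχθ : ContDiff ℝ 1 (fun x => χ x * θ x) := by
    rw [contDiff_iff_contDiffAt]
    intro x
    by_cases hx : x ∈ S
    · exact ((c1.of_le (by simp)).contDiffAt).mul (hθ x hx)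
    · have : x ∉ tsupport χ := fun h => hx (c3 h)
      have := notMem_tsupport_iff_eventuallyEq.1 this
      refine (contDiffAt_const (c := (0 : ℝ))).congr_of_eventuallyEq ?_
      filter_upwards [this] with y hy
      simp [hy]
  have hz := rb_weak hS hw hχθ c2.mul_right
    ((tsupport_mul_subset_left (f := χ) (g := θ)).trans c3)
  have hz2 : ∫ x in S, ⟪gradient w x, gradient (fun x => χ x * θ x) x⟫ = 0 := by
    rw [setIntegral_eq_integral_of_forall_compl_eq_zero, hz]
    intro x hx
    have : x ∉ tsupport χ := fun h => hx (c3 h)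
    have := notMem_tsupport_iff_eventuallyEq.1 this
    have h0 : (fun x => χ x * θ x) =ᶠ[𝓝 x] fun _ => 0 := by
      filter_upwards [this] with y hy
      simp [hy]
    rw [inner_gradient_right, h0.fderiv_eq]
    simp
  have hpt : ∀ x ∈ S, ⟪gradient w x, gradient (fun x => χ x * θ x) x⟫ =
      χ x * ⟪gradient w x, gradient θ x⟫ + θ x * ⟪gradient w x, gradient χ x⟫ := by
    intro x hx
    simp only [inner_gradient_right]
    rw [fderiv_fun_mul ((c1.differentiable (by simp)) x) ((hθ x hx).differentiableAt (by simp))]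
    simp
  rw [setIntegral_congr_fun hSm hpt] at hz2
  have hwθ := rb_inner_int hwI hθI
  have i1 : IntegrableOn (fun x => χ x * ⟪gradient w x, gradient θ x⟫) S := by
    refine Integrable.bdd_mul (c := 1) hwθ c1.continuous.aestronglyMeasurable ?_
    refine Filter.Eventually.of_forall fun x => ?_
    rw [Real.norm_eq_abs, abs_le]
    constructor <;> linarith [(c5 x).1, (c5 x).2]
  have hθc : ContinuousOn θ S := fun x hx => (hθ x hx).continuousAt.continuousWithinAt
  have i2 : IntegrableOn (fun x => θ x * ⟪gradient w x, gradient χ x⟫) S := by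
    refine Integrable.bdd_mul (c := τ) hwχ (hθc.aestronglyMeasurable hSm) ?_
    filter_upwards [ae_restrict_mem hSm] with x hx
    exact hθτ x hx
  rw [integral_add i1 i2] at hz2
  have e1 : ∫ x in S, ⟪gradient w x, gradient θ x⟫ =
      (∫ x in S, (1 - χ x) * ⟪gradient w x, gradient θ x⟫) -
        ∫ x in S, θ x * ⟪gradient w x, gradient χ x⟫ := by
    have : ∫ x in S, (1 - χ x) * ⟪gradient w x, gradient θ x⟫ =
      (∫ x in S, ⟪gradient w x, gradient θ x⟫) - ∫ x in S, χ x * ⟪gradient w x, gradient θ x⟫ := by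
      rw [← integral_sub hwθ i1]
      refine setIntegral_congr_fun hSm fun x _ => ?_
      ring
    linarith
  have b2 : |∫ x in S, θ x * ⟪gradient w x, gradient χ x⟫| ≤
      (∫ X in S, |⟪gradient w X, gradient χ X⟫|) * τ := by
    refine abs_integral_le_integral_abs.trans ?_
    rw [← integral_mul_const]
    refine setIntegral_mono_on i2.abs (hwχ.abs.mul_const _) hSm fun x hx => ?_
    rw [abs_mul, mul_comm]
    gcongr
    exact hθτ x hx
  have b1 : |∫ x in S, (1 - χ x) * ⟪gradient w x, gradient θ x⟫| ≤ s * (1 + G) := by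
    refine abs_integral_le_integral_abs.trans ?_
    have i3 : IntegrableOn (indicator (S \ K) fun X => ‖gradient w X‖ ^ 2) S := by
      exact hwI.indicator (hSm.diff hKm)
    have i4 : IntegrableOn (fun x => (1 - χ x) * ⟪gradient w x, gradient θ x⟫) S := by
      refine (Integrable.sub hwθ i1).congr ?_
      refine Filter.Eventually.of_forall fun x => ?_
      simp; ring
    have : ∫ x in S, |(1 - χ x) * ⟪gradient w x, gradient θ x⟫| ≤
        ∫ x in S, (s⁻¹ * (indicator (S \ K) fun X => ‖gradient w X‖ ^ 2) x + s * ‖gradient θ x‖ ^ 2) := by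
      refine setIntegral_mono_on i4.abs ((i3.const_mul _).add (hθI.const_mul _)) hSm fun x hx => ?_
      by_cases hxK : x ∈ K
      · have : χ x = 1 := eventually_nhdsSet_iff_forall.1 c4 x hxK |>.self_of_nhds
        rw [this]
        simp only [sub_self, zero_mul, abs_zero]
        have : 0 ≤ (indicator (S \ K) fun X => ‖gradient w X‖ ^ 2) x :=
          indicator_nonneg (fun _ _ => by positivity) _
        positivity
      · rw [indicator_of_mem (show x ∈ S \ K from ⟨hx, hxK⟩), abs_mul]
        have h1 : |1 - χ x| ≤ 1 := by
          rw [abs_le]; constructor <;> linarith [(c5 x).1, (c5 x).2]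
        have h2 := abs_real_inner_le_norm (gradient w x) (gradient θ x)
        set p := ‖gradient w x‖
        set q := ‖gradient θ x‖
        have h3 : p * q ≤ s⁻¹ * p ^ 2 + s * q ^ 2 := by
          have hp : 0 ≤ p := norm_nonneg _
          have hq : 0 ≤ q := norm_nonneg _
          have e : s⁻¹ * p ^ 2 + s * q ^ 2 - p * q = s⁻¹ * ((p - s * q) ^ 2 + s * (p * q)) := by
            field_simp; ring
          have : 0 ≤ s⁻¹ * ((p - s * q) ^ 2 + s * (p * q)) := by positivity
          linarith
        calc _ ≤ 1 * (p * q) := by gcongr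
          _ ≤ _ := by linarith
    refine this.trans ?_
    rw [integral_add (i3.const_mul _) (hθI.const_mul _), integral_const_mul, integral_const_mul,
      setIntegral_indicator (hSm.diff hKm), inter_eq_self_of_subset_right diff_subset]
    have : s⁻¹ * ∫ X in S \ K, ‖gradient w X‖ ^ 2 ≤ s⁻¹ * s ^ 2 := by gcongr
    have e : s⁻¹ * s ^ 2 = s := by field_simp
    have : s * ∫ X in S, ‖gradient θ X‖ ^ 2 ≤ s * G := by gcongr
    linarith
  rw [e1]
  refine (abs_sub _ _).trans ?_
  linarith

open MeasureTheory Metric Set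
open scoped RealInnerProductSpace ENNReal NNReal Topology

set_option maxHeartbeats 1600000 in
lemma rb_test {n : ℕ} {M : ℝ} {Ω : Set (EuclideanSpace ℝ (Fin n))}
    {σ : Measure (EuclideanSpace ℝ (Fin n))} {a : ℝ} {Q : EuclideanSpace ℝ (Fin n)} {ρ : ℝ}
    {w : EuclideanSpace ℝ (Fin n) → ℝ} (hN : IsOneSidedNTA M Ω) (hb : Bornology.IsBounded Ω)
    (hF : (frontier Ω).Nonempty) (hD : 0 < diam Ω) (hσ : σ (frontier Ω) ≠ ⊤) (ha : 0 < a)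
    (hw : RbSol Ω σ a Q ρ w) {ρ1 : ℝ} (hρ : ρ1 < ρ) {ψ : EuclideanSpace ℝ (Fin n) → ℝ}
    (hψc : ContinuousOn ψ (closure Ω)) (hψd : ∀ z ∈ Ω, ContDiffAt ℝ 1 ψ z)
    (hψI : IntegrableOn (fun z => ‖fderiv ℝ ψ z‖ ^ 2) Ω) (hψ0 : ∀ z ∉ ball Q ρ1, ψ z = 0)
    (hpos : ∀ P ∈ frontier Ω ∩ ball Q ρ1, 0 ≤ w P * ψ P) :
    ∫ X in Ω, ⟪gradient w X, gradient ψ X⟫ ≤ 0 := by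
  obtain ⟨C, hC, HA⟩ := rb_approx n M
  have hO := hN.isOpen
  set ρ2 := (ρ1 + ρ) / 2 with hρ2
  have h12 : ρ1 < ρ2 := by linarith
  have h2 : ρ2 < ρ := by linarith
  set S := Ω ∩ ball Q ρ2 with hS
  have hSo : IsOpen S := hO.inter isOpen_ball
  have hSm := hSo.measurableSet
  have hSb : Bornology.IsBounded S := hb.subset inter_subset_left
  have hwS : IsHarmonicOn w S := fun x hx => hw.harmonic x ⟨hx.1, ball_subset_ball h2.le hx.2⟩
  have hwI := hw.grad_L2 ρ2 h2
  obtain ⟨W, hW⟩ : ∃ W : ℝ, ∀ x ∈ closure Ω ∩ closedBall Q ρ2, |w x| ≤ W := by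
    obtain ⟨W, hW⟩ := IsCompact.exists_bound_of_continuousOn
      (hb.isCompact_closure.inter_right isClosed_closedBall)
      (hw.contOn.mono (inter_subset_inter_right _ (closedBall_subset_ball h2)))
    exact ⟨W, fun x hx => hW x hx⟩
  set I := ∫ X in Ω, ‖fderiv ℝ ψ X‖ ^ 2 with hI
  have hI0 : 0 ≤ I := integral_nonneg fun _ => by positivity
  set G := 2 * (C + 1) * I with hG
  have hG0 : 0 ≤ G := by positivity
  set T := (σ (frontier Ω)).toReal with hT
  have hT0 : 0 ≤ T := ENNReal.toReal_nonneg
  have hψI' : IntegrableOn (fun z => ‖gradient ψ z‖ ^ 2) Ω := by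
    simpa only [rb_norm_grad] using hψI
  have key : ∀ s : ℝ, 0 < s → ∫ X in Ω, ⟪gradient w X, gradient ψ X⟫ ≤ s * (2 + G) := by
    intro s hs
    obtain ⟨N, hN0, HN⟩ := rb_interior hSo hSb hwS hwI hs hG0
    set τ := min ((ρ2 - ρ1) / 2) (s / (N + a * |W| * T + 1)) with hτ
    have hden : 0 < N + a * |W| * T + 1 := by positivity
    have hτ0 : 0 < τ := lt_min (by linarith) (by positivity)
    have hτ1 : ρ1 + τ < ρ2 := by
      have := min_le_left ((ρ2 - ρ1) / 2) (s / (N + a * |W| * T + 1)); linarith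
    have hτ2 : (N + a * |W| * T) * τ ≤ s := by
      have h := min_le_right ((ρ2 - ρ1) / 2) (s / (N + a * |W| * T + 1))
      rw [← hτ, le_div_iff₀ hden] at h
      nlinarith
    obtain ⟨g, g1, g2, g3, g4, g5, g6⟩ := HA Ω hN hb hF hD Q ρ1 ψ hψc hψd hψI hψ0 τ hτ0
    have hgs : tsupport g ⊆ ball Q ρ2 := g3.trans (closedBall_subset_ball hτ1)
    have g0 : ∀ x ∉ ball Q ρ2, g x = 0 := fun x hx => by
      by_contra h
      exact hx (hgs (subset_tsupport g h))
    have hweak := hw.weak g g1 g2 (hgs.trans (ball_subset_ball h2.le))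
    have hgI' : IntegrableOn (fun z => ‖gradient g z‖ ^ 2) Ω := by
      simpa only [rb_norm_grad] using g5
    have gd : Differentiable ℝ g := g1.differentiable (by simp)
    -- boundary term
    have hbd : -(a * ∫ P in frontier Ω, w P * g P ∂σ) ≤ a * |W| * T * τ := by
      by_cases hi : IntegrableOn (fun P => w P * g P) (frontier Ω) σ
      · have : ∫ P in frontier Ω, -(w P * g P) ∂σ ≤ ∫ P in frontier Ω, |W| * τ ∂σ := by
          refine setIntegral_mono_on hi.neg ?_ isClosed_frontier.measurableSet fun P hP => ?_
          · exact integrableOn_const hσ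
          · by_cases hPb : P ∈ ball Q ρ2
            · have hPc := frontier_subset_closure hP
              have h1 := hW P ⟨hPc, ball_subset_closedBall hPb⟩
              have h3 := g4 P hPc
              have h4 : 0 ≤ w P * ψ P := by
                by_cases hP1 : P ∈ ball Q ρ1
                · exact hpos P ⟨hP, hP1⟩
                · rw [hψ0 P hP1]; simp
              have h5 : |w P * (g P - ψ P)| ≤ |W| * τ := by
                rw [abs_mul]
                have := h1.trans (le_abs_self W)
                gcongr
              have := neg_abs_le (w P * (g P - ψ P))
              nlinarith
            · rw [g0 P hPb]
              have := abs_nonneg W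
              simp only [mul_zero, neg_zero]
              positivity
        rw [integral_neg, setIntegral_const, Measure.real, ← hT, smul_eq_mul] at this
        nlinarith
      · rw [integral_undef hi]
        have := abs_nonneg W
        simp only [mul_zero, neg_zero]
        positivity
    -- interior term
    have hz : ∀ f : EuclideanSpace ℝ (Fin n) → ℝ, (∀ x ∉ closedBall Q (ρ1 + τ), f x = 0) →
        ∫ X in Ω, ⟪gradient w X, gradient f X⟫ = ∫ X in S, ⟪gradient w X, gradient f X⟫ := by
      intro f hf
      refine setIntegral_eq_of_subset_of_forall_sdiff_eq_zero hO.measurableSet inter_subset_left ?_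
      intro x hx
      have hx' : x ∉ closedBall Q (ρ1 + τ) := fun h =>
        hx.2 ⟨hx.1, closedBall_subset_ball hτ1 h⟩
      have : f =ᶠ[𝓝 x] fun _ => 0 := by
        filter_upwards [isClosed_closedBall.isOpen_compl.mem_nhds hx'] with y hy using hf y hy
      rw [inner_gradient_right, this.fderiv_eq]
      simp
    have hψz := hz ψ (fun x hx => hψ0 x (fun h => hx (closedBall_subset_closedBall (by linarith)
      (ball_subset_closedBall h))))
    have hgz := hz g (fun x hx => by
      by_contra h
      exact hx (g3 (subset_tsupport g h)))
    have hθd : ∀ x ∈ S, ContDiffAt ℝ 1 (fun x => g x - ψ x) x := fun x hx =>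
      ((g1.of_le (by simp)).contDiffAt).sub (hψd x hx.1)
    have hθg : ∀ x ∈ Ω, gradient (fun x => g x - ψ x) x = gradient g x - gradient ψ x := by
      intro x hx
      unfold gradient
      rw [fderiv_fun_sub (gd x) ((hψd x hx).differentiableAt (by simp)), map_sub]
    have hθsq : ∀ x ∈ Ω, ‖gradient (fun x => g x - ψ x) x‖ ^ 2 ≤
        2 * ‖gradient g x‖ ^ 2 + 2 * ‖gradient ψ x‖ ^ 2 := by
      intro x hx
      rw [hθg x hx]
      have := norm_sub_le (gradient g x) (gradient ψ x)
      have h0 := norm_nonneg (gradient g x - gradient ψ x)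
      nlinarith [sq_nonneg (‖gradient g x‖ - ‖gradient ψ x‖)]
    have hθI : IntegrableOn (fun X => ‖gradient (fun x => g x - ψ x) X‖ ^ 2) Ω := by
      refine Integrable.mono' ((hgI'.const_mul 2).add (hψI'.const_mul 2))
        ((rb_grad_meas _).norm.pow_const 2).aestronglyMeasurable ?_
      filter_upwards [ae_restrict_mem hO.measurableSet] with x hx
      rw [Real.norm_eq_abs, abs_of_nonneg (by positivity)]
      exact hθsq x hx
    have hsum : IntegrableOn (fun X => 2 * ‖gradient g X‖ ^ 2 + 2 * ‖gradient ψ X‖ ^ 2) Ω :=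
      Integrable.add (hgI'.const_mul 2) (hψI'.const_mul 2)
    have hθG : ∫ X in S, ‖gradient (fun x => g x - ψ x) X‖ ^ 2 ≤ G := by
      calc _ ≤ ∫ X in Ω, ‖gradient (fun x => g x - ψ x) X‖ ^ 2 :=
            setIntegral_mono_set hθI (Filter.Eventually.of_forall fun _ => by positivity)
              (Filter.Eventually.of_forall fun x hx => hx.1)
        _ ≤ ∫ X in Ω, (2 * ‖gradient g X‖ ^ 2 + 2 * ‖gradient ψ X‖ ^ 2) :=
            setIntegral_mono_on hθI hsum
              hO.measurableSet hθsq
        _ = 2 * (∫ X in Ω, ‖fderiv ℝ g X‖ ^ 2) + 2 * I := by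
            rw [integral_add (hgI'.const_mul 2) (hψI'.const_mul 2), integral_const_mul,
              integral_const_mul]
            simp only [rb_norm_grad, hI]
        _ ≤ 2 * (C * I) + 2 * I := by gcongr
        _ = G := by rw [hG]; ring
    have hint := HN (fun x => g x - ψ x) τ hθd (fun x hx => g4 x (subset_closure hx.1))
      (hθI.mono_set inter_subset_left) hθG
    have hsplit : ∫ X in S, ⟪gradient w X, gradient (fun x => g x - ψ x) X⟫ =
        (∫ X in S, ⟪gradient w X, gradient g X⟫) - ∫ X in S, ⟪gradient w X, gradient ψ X⟫ := by
      rw [← integral_sub (rb_inner_int hwI (hgI'.mono_set inter_subset_left))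
        (rb_inner_int hwI (hψI'.mono_set inter_subset_left))]
      refine setIntegral_congr_fun hSm fun x hx => ?_
      rw [hθg x hx.1, inner_sub_right]
    have h7 := neg_abs_le (∫ X in S, ⟪gradient w X, gradient (fun x => g x - ψ x) X⟫)
    rw [hψz]
    rw [hgz] at hweak
    nlinarith
  by_contra hcon
  push Not at hcon
  have := key ((∫ X in Ω, ⟪gradient w X, gradient ψ X⟫) / (2 * (2 + G))) (by positivity)
  have e : (∫ X in Ω, ⟪gradient w X, gradient ψ X⟫) / (2 * (2 + G)) * (2 + G) =
    (∫ X in Ω, ⟪gradient w X, gradient ψ X⟫) / 2 := by field_simp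
  rw [e] at this
  linarith

open MeasureTheory Metric Set
open scoped RealInnerProductSpace ENNReal NNReal Topology

lemma rb_cut2 (n : ℕ) : ∃ L : ℝ, 0 < L ∧ ∀ (q : EuclideanSpace ℝ (Fin n)) (r1 r2 : ℝ),
    0 ≤ r1 → r1 < r2 → ∃ φ : EuclideanSpace ℝ (Fin n) → ℝ, ContDiff ℝ (⊤ : ℕ∞) φ ∧
      (∀ x ∈ ball q r1, φ x = 1) ∧ (∀ x ∉ ball q r2, φ x = 0) ∧ (∀ x, φ x ∈ Icc (0 : ℝ) 1) ∧
      ∀ x, ‖fderiv ℝ φ x‖ ≤ L / (r2 - r1) := by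
  have hst : ContDiff ℝ (⊤ : ℕ∞) Real.smoothTransition := Real.smoothTransition.contDiff
  obtain ⟨L0, hL0⟩ : ∃ L0, ∀ t ∈ Icc (0 : ℝ) 1, ‖deriv Real.smoothTransition t‖ ≤ L0 :=
    isCompact_Icc.exists_bound_of_continuousOn (hst.continuous_deriv (by simp)).continuousOn
  have hL00 : 0 ≤ L0 := (norm_nonneg _).trans (hL0 0 (by simp))
  refine ⟨2 * L0 + 1, by positivity, fun q r1 r2 h1 h12 => ?_⟩
  have hd : 0 < r2 ^ 2 - r1 ^ 2 := by nlinarith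
  set φ : EuclideanSpace ℝ (Fin n) → ℝ := fun x =>
    Real.smoothTransition ((r2 ^ 2 - ‖x - q‖ ^ 2) / (r2 ^ 2 - r1 ^ 2)) with hφ
  have hin : ContDiff ℝ (⊤ : ℕ∞) fun x : EuclideanSpace ℝ (Fin n) =>
      (r2 ^ 2 - ‖x - q‖ ^ 2) / (r2 ^ 2 - r1 ^ 2) := by
    refine ContDiff.div_const (contDiff_const.sub ?_) _
    exact (contDiff_id.sub contDiff_const).norm_sq ℝ
  have hc : ContDiff ℝ (⊤ : ℕ∞) φ := hst.comp hin
  have h0 : ∀ x ∉ ball q r2, φ x = 0 := by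
    intro x hx
    rw [mem_ball, not_lt, dist_eq_norm] at hx
    apply Real.smoothTransition.zero_of_nonpos
    apply div_nonpos_of_nonpos_of_nonneg _ hd.le
    nlinarith
  have hIcc : ∀ x, φ x ∈ Icc (0 : ℝ) 1 := fun x =>
    ⟨Real.smoothTransition.nonneg _, Real.smoothTransition.le_one _⟩
  refine ⟨φ, hc, ?_, h0, hIcc, ?_⟩
  · intro x hx
    rw [mem_ball, dist_eq_norm] at hx
    apply Real.smoothTransition.one_of_one_le
    rw [le_div_iff₀ hd]
    nlinarith [norm_nonneg (x - q)]
  · intro x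
    have hpos : 0 < r2 - r1 := by linarith
    have triv1 : φ x = 0 → ‖fderiv ℝ φ x‖ ≤ (2 * L0 + 1) / (r2 - r1) := by
      intro h
      have : IsLocalMin φ x := Filter.Eventually.of_forall fun y => by
        rw [h]; exact (hIcc y).1
      rw [this.fderiv_eq_zero, norm_zero]; positivity
    have triv2 : φ x = 1 → ‖fderiv ℝ φ x‖ ≤ (2 * L0 + 1) / (r2 - r1) := by
      intro h
      have : IsLocalMax φ x := Filter.Eventually.of_forall fun y => by
        show φ y ≤ φ x
        rw [h]; exact (hIcc y).2
      rw [this.fderiv_eq_zero, norm_zero]; positivity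
    by_cases hx : x ∈ ball q r2
    swap
    · exact triv1 (h0 x hx)
    rw [mem_ball, dist_eq_norm] at hx
    set t := (r2 ^ 2 - ‖x - q‖ ^ 2) / (r2 ^ 2 - r1 ^ 2) with ht
    by_cases ht1 : 1 ≤ t
    · exact triv2 (Real.smoothTransition.one_of_one_le ht1)
    have ht0 : 0 ≤ t := div_nonneg (by nlinarith [norm_nonneg (x - q)]) hd.le
    have hn : HasFDerivAt (fun x : EuclideanSpace ℝ (Fin n) => ‖x - q‖ ^ 2)
        ((2 : ℝ) • (innerSL ℝ (x - q))) x := by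
      have := (hasStrictFDerivAt_norm_sq (x - q)).hasFDerivAt.comp x ((hasFDerivAt_id x).sub_const q)
      refine HasFDerivAt.congr_fderiv this ?_
      ext y
      simp [inner_sub_left]
    have hf : HasFDerivAt (fun x : EuclideanSpace ℝ (Fin n) =>
        (r2 ^ 2 - ‖x - q‖ ^ 2) / (r2 ^ 2 - r1 ^ 2))
        ((r2 ^ 2 - r1 ^ 2)⁻¹ • (-((2 : ℝ) • (innerSL ℝ (x - q))))) x := by
      have := (hn.const_sub (r2 ^ 2)).const_mul (r2 ^ 2 - r1 ^ 2)⁻¹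
      refine this.congr_of_eventuallyEq (Filter.Eventually.of_forall fun y => ?_)
      simp only
      ring
    have hst1 : HasDerivAt Real.smoothTransition (deriv Real.smoothTransition t) t :=
      ((hst.differentiable (by simp)) t).hasDerivAt
    have hg : HasFDerivAt φ (deriv Real.smoothTransition t •
        ((r2 ^ 2 - r1 ^ 2)⁻¹ • (-((2 : ℝ) • (innerSL ℝ (x - q)))))) x := by
      have h := HasDerivAt.comp_hasFDerivAt (h₂ := Real.smoothTransition) x hst1 hf
      exact h
    rw [hg.fderiv, norm_smul, norm_smul, norm_neg, norm_smul,
      innerSL_apply_norm]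
    have b := hL0 t ⟨ht0, by linarith⟩
    have hr2 : 0 < r2 := by linarith
    calc _ ≤ L0 * ((r2 ^ 2 - r1 ^ 2)⁻¹ * (2 * r2)) := by
          rw [norm_inv, Real.norm_eq_abs (r2 ^ 2 - r1 ^ 2), abs_of_pos hd]
          rw [Real.norm_eq_abs] at b
          norm_num
          gcongr
      _ = 2 * L0 * r2 / ((r2 - r1) * (r2 + r1)) := by
          have : r2 ^ 2 - r1 ^ 2 = (r2 - r1) * (r2 + r1) := by ring
          rw [this]; field_simp
      _ ≤ (2 * L0 + 1) / (r2 - r1) := by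
          rw [div_le_div_iff₀ (by positivity) hpos]
          have : 2 * L0 * r2 ≤ (2 * L0 + 1) * (r2 + r1) := by nlinarith
          nlinarith

lemma rb_pd {n : ℕ} {w : EuclideanSpace ℝ (Fin n) → ℝ} {x : EuclideanSpace ℝ (Fin n)} {l : ℝ}
    (hw : ContDiffAt ℝ 2 w x) :
    ContDiffAt ℝ 1 (fun z => (max (w z - l) 0) ^ 2) x ∧
    ContDiffAt ℝ 1 (fun z => (max (w z - l) 0) ^ 3) x ∧
    fderiv ℝ (fun z => (max (w z - l) 0) ^ 2) x = (2 * max (w x - l) 0) • fderiv ℝ w x ∧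
    fderiv ℝ (fun z => (max (w z - l) 0) ^ 3) x = (3 * (max (w x - l) 0) ^ 2) • fderiv ℝ w x := by
  have h1 : ContDiffAt ℝ 1 (fun z => w z - l) x := (hw.of_le (by norm_num)).sub contDiffAt_const
  have h2 : HasFDerivAt (fun z => w z - l) (fderiv ℝ w x) x :=
    (hw.differentiableAt (by norm_num)).hasFDerivAt.sub_const l
  refine ⟨ContDiffAt.comp x rb_cd_sq.contDiffAt h1, ContDiffAt.comp x rb_cd_cb.contDiffAt h1, ?_, ?_⟩
  · exact (HasDerivAt.comp_hasFDerivAt x (rb_sq (w x - l)) h2).fderiv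
  · exact (HasDerivAt.comp_hasFDerivAt x (rb_cb (w x - l)) h2).fderiv

set_option maxHeartbeats 1600000 in
lemma rb_cacc (n : ℕ) (M : ℝ) : ∃ L : ℝ, 0 < L ∧ ∀ (Ω : Set (EuclideanSpace ℝ (Fin n)))
    (σ : Measure (EuclideanSpace ℝ (Fin n))) (a : ℝ) (Q : EuclideanSpace ℝ (Fin n)) (ρ : ℝ)
    (w : EuclideanSpace ℝ (Fin n) → ℝ), IsOneSidedNTA M Ω → Bornology.IsBounded Ω →
    (frontier Ω).Nonempty → 0 < diam Ω → σ (frontier Ω) ≠ ⊤ → 0 < a → RbSol Ω σ a Q ρ w →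
    ∀ l r1 r2 : ℝ, 0 ≤ l → 0 ≤ r1 → r1 < r2 → r2 < ρ →
    IntegrableOn (fun z => ((max (w z - l) 0) ^ 2) ^ 2) (Ω ∩ ball Q r2) ∧
    IntegrableOn (fun z => ‖fderiv ℝ (fun z => (max (w z - l) 0) ^ 2) z‖ ^ 2) (Ω ∩ ball Q r1) ∧
    ∫ z in Ω ∩ ball Q r1, ‖fderiv ℝ (fun z => (max (w z - l) 0) ^ 2) z‖ ^ 2 ≤
      L / (r2 - r1) ^ 2 * ∫ z in Ω ∩ ball Q r2, ((max (w z - l) 0) ^ 2) ^ 2 := by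
  obtain ⟨L, hL, HL⟩ := rb_cut2 n
  refine ⟨2 * L ^ 2, by positivity, ?_⟩
  intro Ω σ a Q ρ w hN hb hF hD hσ ha hw l r1 r2 hl h0 h12 h2
  obtain ⟨φ, p1, p2, p3, p4, p5⟩ := HL Q r1 r2 h0 h12
  have hO := hN.isOpen
  have hOm := hO.measurableSet
  set s : EuclideanSpace ℝ (Fin n) → ℝ := fun z => max (w z - l) 0 with hs
  have hs0 : ∀ z, 0 ≤ s z := fun z => le_max_right _ _
  have hsc : ContinuousOn s (closure Ω ∩ ball Q ρ) :=
    (hw.contOn.sub continuousOn_const).sup continuousOn_const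
  obtain ⟨W, hW⟩ := IsCompact.exists_bound_of_continuousOn
      (hb.isCompact_closure.inter_right isClosed_closedBall)
      (hsc.mono (inter_subset_inter_right _ (closedBall_subset_ball h2)))
  have hW' : ∀ x ∈ Ω ∩ ball Q r2, s x ≤ |W| := fun x hx =>
    (le_abs_self _).trans ((hW x ⟨subset_closure hx.1, ball_subset_closedBall hx.2⟩).trans
      (le_abs_self W))
  have hsub : ∀ r ≤ r2, Ω ∩ ball Q r ⊆ Ω ∩ ball Q ρ := fun r hr =>
    inter_subset_inter_right _ (ball_subset_ball (by linarith))
  have hmS : ∀ r, MeasurableSet (Ω ∩ ball Q r) := fun r => hOm.inter measurableSet_ball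
  have hfin : ∀ r, volume (Ω ∩ ball Q r) ≠ ⊤ := fun r =>
    ((measure_mono inter_subset_right).trans_lt measure_ball_lt_top).ne
  have hsm : AEStronglyMeasurable s (volume.restrict (Ω ∩ ball Q r2)) :=
    (hsc.mono ((inter_subset_inter_left _ subset_closure).trans
      (inter_subset_inter_right _ (ball_subset_ball h2.le)))).aestronglyMeasurable (hmS _)
  have hgw := hw.grad_L2 r2 h2
  have d2 : ∀ z ∈ Ω ∩ ball Q ρ, ContDiffAt ℝ 2 w z := fun z hz => (hw.harmonic z hz).1
  have i4 : IntegrableOn (fun z => (s z ^ 2) ^ 2) (Ω ∩ ball Q r2) := by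
    refine Integrable.mono' (integrableOn_const (C := (|W| ^ 2) ^ 2) (hfin r2))
      ((hsm.pow 2).pow 2) ?_
    filter_upwards [ae_restrict_mem (hmS r2)] with x hx
    rw [Real.norm_eq_abs, abs_of_nonneg (by positivity)]
    have := hW' x hx
    have := hs0 x
    gcongr
  have ev : ∀ z ∈ Ω ∩ ball Q ρ, ‖fderiv ℝ (fun z => s z ^ 2) z‖ ^ 2 =
      4 * s z ^ 2 * ‖gradient w z‖ ^ 2 := by
    intro z hz
    obtain ⟨_, _, e, _⟩ := rb_pd (l := l) (d2 z hz)
    simp only [hs] at e ⊢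
    rw [e, norm_smul, rb_norm_grad, Real.norm_eq_abs, abs_of_nonneg (by positivity)]
    ring
  have i5 : IntegrableOn (fun z => s z ^ 2 * ‖gradient w z‖ ^ 2) (Ω ∩ ball Q r2) := by
    refine Integrable.bdd_mul (c := |W| ^ 2) hgw (hsm.pow 2) ?_
    filter_upwards [ae_restrict_mem (hmS r2)] with x hx
    rw [Real.norm_eq_abs, abs_of_nonneg (by positivity)]
    have := hW' x hx
    have := hs0 x
    gcongr
  have i6 : IntegrableOn (fun z => ‖fderiv ℝ (fun z => s z ^ 2) z‖ ^ 2) (Ω ∩ ball Q r1) := by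
    have : IntegrableOn (fun z => 4 * (s z ^ 2 * ‖gradient w z‖ ^ 2)) (Ω ∩ ball Q r2) :=
      i5.const_mul 4
    have := this.mono_set (inter_subset_inter_right Ω (ball_subset_ball h12.le))
    refine IntegrableOn.congr_fun this (fun z hz => ?_) (hmS r1)
    rw [ev z (hsub r1 h12.le hz)]; ring
  refine ⟨i4, i6, ?_⟩
  set ψ : EuclideanSpace ℝ (Fin n) → ℝ := fun z => φ z ^ 2 * s z ^ 3 with hψ
  have ψ0 : ∀ z ∉ ball Q r2, ψ z = 0 := fun z hz => by simp [hψ, p3 z hz]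
  have ψz : ∀ z ∉ ball Q ρ, ψ =ᶠ[𝓝 z] fun _ => 0 := by
    intro z hz
    have hz' : z ∉ closedBall Q r2 := fun h => hz (closedBall_subset_ball h2 h)
    filter_upwards [isClosed_closedBall.isOpen_compl.mem_nhds hz'] with y hy
    exact ψ0 y fun h => hy (ball_subset_closedBall h)
  have φd : ∀ z, DifferentiableAt ℝ φ z := fun z => p1.differentiable (by simp) z
  have ψc : ContinuousOn ψ (closure Ω) := by
    intro z hz
    by_cases hzb : z ∈ ball Q ρ
    · have h1 : ContinuousWithinAt s (closure Ω) z := by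
        have := hsc z ⟨hz, hzb⟩
        rwa [continuousWithinAt_inter (isOpen_ball.mem_nhds hzb)] at this
      exact (p1.continuous.continuousWithinAt.pow 2).mul (h1.pow 3)
    · exact ((continuousAt_const (y := (0 : ℝ))).congr (ψz z hzb).symm).continuousWithinAt
  have ψd : ∀ z ∈ Ω, ContDiffAt ℝ 1 ψ z := by
    intro z hz
    by_cases hzb : z ∈ ball Q ρ
    · exact ((p1.of_le (by simp)).contDiffAt.pow 2).mul (rb_pd (l := l) (d2 z ⟨hz, hzb⟩)).2.1
    · exact (contDiffAt_const (c := (0 : ℝ))).congr_of_eventuallyEq (ψz z hzb)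
  have ψg : ∀ z ∈ Ω ∩ ball Q ρ, gradient ψ z = (2 * φ z * s z ^ 3) • gradient φ z +
      (3 * φ z ^ 2 * s z ^ 2) • gradient w z := by
    intro z hz
    obtain ⟨_, e1, _, e2⟩ := rb_pd (l := l) (d2 z hz)
    have : fderiv ℝ ψ z = (2 * φ z * s z ^ 3) • fderiv ℝ φ z +
        (3 * φ z ^ 2 * s z ^ 2) • fderiv ℝ w z := by
      have h1 : HasFDerivAt (fun z => φ z ^ 2) _ z := (φd z).hasFDerivAt.pow 2
      have h3 := h1.mul (e1.differentiableAt (by simp)).hasFDerivAt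
      rw [e2] at h3
      refine HasFDerivAt.fderiv (h3.congr_fderiv ?_)
      ext y
      simp [hs]
      ring
    unfold gradient
    rw [this, map_add]
    simp
  have ψI' : IntegrableOn (fun z => ‖gradient ψ z‖ ^ 2) Ω := by
    have hz : ∀ z ∈ Ω \ (Ω ∩ ball Q r2), ‖gradient ψ z‖ ^ 2 = 0 := by
      intro z hz
      have hzb : z ∉ ball Q r2 := fun h => hz.2 ⟨hz.1, h⟩
      by_cases hzr : z ∈ ball Q ρ
      · rw [ψg z ⟨hz.1, hzr⟩, p3 z hzb]; simp
      · rw [rb_norm_grad, (ψz z hzr).fderiv_eq]; simp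
    have i7 : IntegrableOn (fun z => ‖gradient ψ z‖ ^ 2) (Ω ∩ ball Q r2) := by
      refine Integrable.mono' (g := fun z => 8 * |W| ^ 6 * (L / (r2 - r1)) ^ 2 +
        18 * |W| ^ 4 * ‖gradient w z‖ ^ 2) ?_
        ((rb_grad_meas _).norm.pow_const 2).aestronglyMeasurable ?_
      · exact (integrableOn_const (hfin r2)).add (hgw.const_mul _)
      · filter_upwards [ae_restrict_mem (hmS r2)] with x hx
        rw [Real.norm_eq_abs, abs_of_nonneg (by positivity), ψg x (hsub r2 le_rfl hx)]
        have q1 := hW' x hx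
        have q2 := hs0 x
        have q3 := p5 x
        rw [← rb_norm_grad] at q3
        obtain ⟨q4, q5⟩ := p4 x
        have t1 : ‖(2 * φ x * s x ^ 3) • gradient φ x‖ ≤ 2 * |W| ^ 3 * (L / (r2 - r1)) := by
          rw [norm_smul, Real.norm_eq_abs, abs_of_nonneg (by positivity)]
          gcongr
          nlinarith
        have t2 : ‖(3 * φ x ^ 2 * s x ^ 2) • gradient w x‖ ≤ 3 * |W| ^ 2 * ‖gradient w x‖ := by
          rw [norm_smul, Real.norm_eq_abs, abs_of_nonneg (by positivity)]
          gcongr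
          nlinarith
        have t3 := norm_add_le ((2 * φ x * s x ^ 3) • gradient φ x)
          ((3 * φ x ^ 2 * s x ^ 2) • gradient w x)
        set N1 := ‖(2 * φ x * s x ^ 3) • gradient φ x‖
        set N2 := ‖(3 * φ x ^ 2 * s x ^ 2) • gradient w x‖
        have n1 : N1 ^ 2 ≤ (2 * |W| ^ 3 * (L / (r2 - r1))) ^ 2 := by gcongr
        have n2 : N2 ^ 2 ≤ (3 * |W| ^ 2 * ‖gradient w x‖) ^ 2 := by gcongr
        calc _ ≤ (N1 + N2) ^ 2 := by gcongr
          _ ≤ 2 * N1 ^ 2 + 2 * N2 ^ 2 := by nlinarith only [sq_nonneg (N1 - N2)]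
          _ ≤ _ := by linarith
    exact i7.of_forall_sdiff_eq_zero hOm hz
  have ψI : IntegrableOn (fun z => ‖fderiv ℝ ψ z‖ ^ 2) Ω := by
    simpa only [rb_norm_grad] using ψI'
  have test := rb_test hN hb hF hD hσ ha hw h2 ψc ψd ψI ψ0 (by
    intro P hP
    have : 0 ≤ w P * s P ^ 3 := by
      rcases le_total (w P - l) 0 with h | h
      · simp [hs, max_eq_right h]
      · have : 0 ≤ w P := by linarith
        have := hs0 P
        positivity
    calc 0 ≤ φ P ^ 2 * (w P * s P ^ 3) := by positivity
      _ = _ := by simp only [hψ]; ring)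
  have hred : ∫ X in Ω, ⟪gradient w X, gradient ψ X⟫ =
      ∫ X in Ω ∩ ball Q r2, ⟪gradient w X, gradient ψ X⟫ := by
    refine setIntegral_eq_of_subset_of_forall_sdiff_eq_zero hOm inter_subset_left ?_
    intro z hz
    have hzb : z ∉ ball Q r2 := fun h => hz.2 ⟨hz.1, h⟩
    by_cases hzr : z ∈ ball Q ρ
    · rw [ψg z ⟨hz.1, hzr⟩, p3 z hzb]; simp
    · rw [inner_gradient_right, (ψz z hzr).fderiv_eq]; simp
  rw [hred] at test
  have i8 : IntegrableOn (fun z => φ z ^ 2 * (s z ^ 2 * ‖gradient w z‖ ^ 2)) (Ω ∩ ball Q r2) := by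
    refine Integrable.bdd_mul (c := 1) i5 (p1.continuous.pow 2).aestronglyMeasurable ?_
    refine Filter.Eventually.of_forall fun x => ?_
    rw [Real.norm_eq_abs, abs_of_nonneg (by positivity)]
    obtain ⟨q4, q5⟩ := p4 x
    nlinarith
  have pt : ∫ z in Ω ∩ ball Q r2, (2 * (φ z ^ 2 * (s z ^ 2 * ‖gradient w z‖ ^ 2)) -
      (L / (r2 - r1)) ^ 2 * (s z ^ 2) ^ 2) ≤
      ∫ X in Ω ∩ ball Q r2, ⟪gradient w X, gradient ψ X⟫ := by
    refine setIntegral_mono_on ?_ (rb_inner_int hgw (ψI'.mono_set inter_subset_left)) (hmS r2) ?_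
    · exact (i8.const_mul 2).sub (i4.const_mul _)
    · intro x hx
      rw [ψg x (hsub r2 le_rfl hx), inner_add_right, inner_smul_right, inner_smul_right,
        real_inner_self_eq_norm_sq]
      have c1 := abs_real_inner_le_norm (gradient w x) (gradient φ x)
      have c2 := neg_abs_le ⟪gradient w x, gradient φ x⟫
      have q3 := p5 x
      rw [← rb_norm_grad] at q3
      obtain ⟨q4, q5⟩ := p4 x
      have q2 := hs0 x
      set I := ⟪gradient w x, gradient φ x⟫
      set g := ‖gradient w x‖
      set f := ‖gradient φ x‖
      have hg : 0 ≤ g := norm_nonneg _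
      have hf : 0 ≤ f := norm_nonneg _
      have a1 : -(g * f) ≤ I := by linarith
      have a2 : 2 * φ x * s x ^ 3 * (-(g * f)) ≤ 2 * φ x * s x ^ 3 * I := by gcongr
      have a3 : f ^ 2 * (s x ^ 2) ^ 2 ≤ (L / (r2 - r1)) ^ 2 * (s x ^ 2) ^ 2 := by gcongr
      nlinarith [sq_nonneg (φ x * s x * g - s x ^ 2 * f)]
  rw [integral_sub (i8.const_mul 2) (i4.const_mul _), integral_const_mul, integral_const_mul] at pt
  have lower : ∫ z in Ω ∩ ball Q r1, ‖fderiv ℝ (fun z => s z ^ 2) z‖ ^ 2 ≤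
      4 * ∫ z in Ω ∩ ball Q r2, φ z ^ 2 * (s z ^ 2 * ‖gradient w z‖ ^ 2) := by
    rw [← integral_const_mul]
    calc _ = ∫ z in Ω ∩ ball Q r1, 4 * (φ z ^ 2 * (s z ^ 2 * ‖gradient w z‖ ^ 2)) := by
          refine setIntegral_congr_fun (hmS r1) fun z hz => ?_
          rw [ev z (hsub r1 h12.le hz), p2 z hz.2]; ring
      _ ≤ _ := setIntegral_mono_set (i8.const_mul 4)
          (Filter.Eventually.of_forall fun z => by
            have := hs0 z
            simp only [Pi.zero_apply]
            positivity)
          (Filter.Eventually.of_forall (inter_subset_inter_right Ω (ball_subset_ball h12.le)))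
  refine lower.trans ?_
  have e : 2 * L ^ 2 / (r2 - r1) ^ 2 = 2 * (L / (r2 - r1)) ^ 2 := by
    rw [div_pow]; ring
  rw [e]
  linarith

open MeasureTheory Metric Set
open scoped RealInnerProductSpace ENNReal NNReal Topology

structure RbDom {n : ℕ} (M : ℝ) (Ω : Set (EuclideanSpace ℝ (Fin n)))
    (σ : Measure (EuclideanSpace ℝ (Fin n))) (a : ℝ) : Prop where
  nta : IsOneSidedNTA M Ω
  bdd : Bornology.IsBounded Ω
  fr : (frontier Ω).Nonempty
  dpos : 0 < diam Ω
  fin : σ (frontier Ω) ≠ ⊤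
  apos : 0 < a

lemma RbSol.mono {n : ℕ} {Ω : Set (EuclideanSpace ℝ (Fin n))}
    {σ : Measure (EuclideanSpace ℝ (Fin n))} {a : ℝ} {Q q : EuclideanSpace ℝ (Fin n)} {ρ r : ℝ}
    {w : EuclideanSpace ℝ (Fin n) → ℝ} (h : RbSol Ω σ a Q ρ w) (hr : dist q Q + r ≤ ρ) :
    RbSol Ω σ a q r w := by
  have hs : ball q r ⊆ ball Q ρ := ball_subset_ball' (by linarith)
  refine ⟨h.contOn.mono (inter_subset_inter_right _ hs), fun x hx => h.harmonic x ⟨hx.1, hs hx.2⟩,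
    ?_, fun φ h1 h2 h3 => h.weak φ h1 h2 (h3.trans hs)⟩
  intro ρ' h'
  refine (h.grad_L2 (dist q Q + ρ') (by linarith)).mono_set (inter_subset_inter_right _ ?_)
  exact ball_subset_ball' (by linarith)

lemma rb_decay (n : ℕ) (M : ℝ) : ∃ L : ℝ, 1 ≤ L ∧ ∀ (Ω : Set (EuclideanSpace ℝ (Fin n)))
    (σ : Measure (EuclideanSpace ℝ (Fin n))) (a : ℝ), RbDom M Ω σ a →
    ∀ (q : EuclideanSpace ℝ (Fin n)) (R : ℝ) (w : EuclideanSpace ℝ (Fin n) → ℝ),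
    RbSol Ω σ a q R w → ∀ l η ρ : ℝ, 0 ≤ l → 0 < η → 0 ≤ ρ → L * η < diam Ω →
    ∀ m : ℕ, ρ + m * (L * η) < R →
    (∀ z ∈ Ω ∩ ball q (ρ + m * (L * η)), η ≤ infDist z (frontier Ω) → w z ≤ l) →
    ∫ z in Ω ∩ ball q ρ, ((max (w z - l) 0) ^ 2) ^ 2 ≤
      (1 / 2) ^ m * ∫ z in Ω ∩ ball q (ρ + m * (L * η)), ((max (w z - l) 0) ^ 2) ^ 2 := by
  obtain ⟨K, hK, HP⟩ := rb_poincare n M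
  obtain ⟨L0, hL0, HC⟩ := rb_cacc n M
  set c := 2 * K * L0 + 1 with hc
  have hc1 : 1 ≤ c := by rw [hc]; have : 0 ≤ 2 * K * L0 := by positivity
                         linarith
  refine ⟨K + c, by linarith, ?_⟩
  intro Ω σ a hD q R w hw l η ρ hl hη hρ hLη m
  have hstep : ∀ ρ : ℝ, 0 ≤ ρ → ρ + (K + c) * η < R →
      (∀ z ∈ Ω ∩ ball q (ρ + (K + c) * η), η ≤ infDist z (frontier Ω) → w z ≤ l) →
      ∫ z in Ω ∩ ball q ρ, ((max (w z - l) 0) ^ 2) ^ 2 ≤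
      (1 / 2) * ∫ z in Ω ∩ ball q (ρ + (K + c) * η), ((max (w z - l) 0) ^ 2) ^ 2 := by
    intro ρ hρ h1 h2
    have hKη : 0 < K * η := by positivity
    have hcη : 0 < c * η := by positivity
    obtain ⟨j1, j2, j3⟩ := HC Ω σ a q R w hD.nta hD.bdd hD.fr hD.dpos hD.fin hD.apos hw l
      (ρ + K * η) (ρ + (K + c) * η) hl (by positivity) (by linarith) h1
    have hsub : ball q (ρ + K * η) ⊆ ball q (ρ + (K + c) * η) := ball_subset_ball (by linarith)
    have := HP Ω hD.nta hD.fr q ρ η hη (by linarith) (fun z => (max (w z - l) 0) ^ 2)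
      (fun z hz => (rb_pd (hw.harmonic z ⟨hz.1, ball_subset_ball (by linarith) hz.2⟩).1).1) j2
      (fun z hz hzη => by
        have := h2 z ⟨hz.1, hsub hz.2⟩ hzη
        rw [max_eq_right (by linarith)]; norm_num)
    refine this.trans ?_
    have e : ρ + (K + c) * η - (ρ + K * η) = c * η := by ring
    rw [e] at j3
    set J := ∫ z in Ω ∩ ball q (ρ + (K + c) * η), ((max (w z - l) 0) ^ 2) ^ 2
    have hJ : 0 ≤ J := integral_nonneg fun _ => by positivity
    calc _ ≤ K * η ^ 2 * (L0 / (c * η) ^ 2 * J) := by gcongr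
      _ = K * L0 / c ^ 2 * J := by field_simp
      _ ≤ 1 / 2 * J := by
        refine mul_le_mul_of_nonneg_right ?_ hJ
        rw [div_le_div_iff₀ (by positivity) (by norm_num)]
        nlinarith
  induction m with
  | zero => intro _ _; simp
  | succ m ih =>
    intro h1 h2
    push_cast at h1 h2 ⊢
    have e : ρ + (m + 1) * ((K + c) * η) = (ρ + m * ((K + c) * η)) + (K + c) * η := by ring
    have hp : 0 < (K + c) * η := by positivity
    have hm : (0 : ℝ) ≤ m * ((K + c) * η) := by positivity
    rw [e] at h1 h2 ⊢
    have s1 := hstep (ρ + m * ((K + c) * η)) (by positivity) h1 h2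
    have s2 := ih (by linarith) (fun z hz => h2 z ⟨hz.1, ball_subset_ball (by linarith) hz.2⟩)
    rw [pow_succ, mul_assoc]
    refine s2.trans ?_
    gcongr

open MeasureTheory Metric Set
open scoped RealInnerProductSpace ENNReal NNReal Topology

lemma rb_hc2 (n : ℕ) (M Λ : ℝ) (hΛ : 1 ≤ Λ) : ∃ K : ℝ, 1 ≤ K ∧ ∀ Ω : Set (EuclideanSpace ℝ (Fin n)),
    IsOneSidedNTA M Ω → ∀ x ∈ Ω, ∀ y ∈ Ω, ∀ ε : ℝ, 0 < ε → ε ≤ infDist x (frontier Ω) →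
    ε ≤ infDist y (frontier Ω) → dist x y ≤ Λ * ε → Λ * ε < diam Ω / 10 →
    ∀ (Q : EuclideanSpace ℝ (Fin n)) (ρ : ℝ), dist x Q + K * ε ≤ ρ → dist y Q + K * ε ≤ ρ →
    ∀ g : EuclideanSpace ℝ (Fin n) → ℝ, IsHarmonicOn g (Ω ∩ ball Q ρ) →
    (∀ z ∈ Ω ∩ ball Q ρ, 0 ≤ g z) → g y ≤ K * g x ∧ g x ≤ K * g y := by
  obtain ⟨K, hK, H⟩ := rb_hc n M Λ hΛ
  refine ⟨K, hK, ?_⟩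
  intro Ω hN x hx y hy ε hε h1 h2 h3 h4 Q ρ h5 h6 g hg hp
  have s1 : ball x (K * ε) ⊆ ball Q ρ := ball_subset_ball' (by linarith)
  have s2 : ball y (K * ε) ⊆ ball Q ρ := ball_subset_ball' (by linarith)
  constructor
  · exact H Ω hN x hx y hy ε hε h1 h2 h3 h4 g (fun z hz => hg z ⟨hz.1, s1 hz.2⟩)
      (fun z hz _ => hp z ⟨hz.1, s1 hz.2⟩)
  · exact H Ω hN y hy x hx ε hε h2 h1 (by rwa [dist_comm]) h4 g (fun z hz => hg z ⟨hz.1, s2 hz.2⟩)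
      (fun z hz _ => hp z ⟨hz.1, s2 hz.2⟩)

lemma rb_growth (n : ℕ) (M Λ : ℝ) : ∃ K : ℝ, 1 ≤ K ∧ ∀ Ω : Set (EuclideanSpace ℝ (Fin n)),
    IsOneSidedNTA M Ω → (frontier Ω).Nonempty → ∀ (Q : EuclideanSpace ℝ (Fin n)) (R : ℝ), 0 < R →
    K * R < diam Ω → ∀ u : EuclideanSpace ℝ (Fin n) → ℝ, IsHarmonicOn u (Ω ∩ ball Q (K * R)) →
    (∀ z ∈ Ω ∩ ball Q (K * R), 0 ≤ u z) → ∀ A ∈ Ω ∩ ball Q R, R ≤ Λ * infDist A (frontier Ω) →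
    ∀ j : ℕ, ∀ x ∈ Ω ∩ ball Q R, R ≤ 2 ^ j * infDist x (frontier Ω) →
      u x ≤ K ^ (j + 1) * u A ∧ u A ≤ K ^ (j + 1) * u x := by
  by_cases hM1 : 1 < M
  swap
  · exact ⟨1, le_rfl, fun Ω h => absurd h.M_gt_one hM1⟩
  set Λ0 := max M Λ with hΛ0
  have hΛM : M ≤ Λ0 := le_max_left _ _
  have hΛΛ : Λ ≤ Λ0 := le_max_right _ _
  obtain ⟨K1, hK1, H1⟩ := rb_hc2 n M (6 * M) (by linarith)
  obtain ⟨K2, hK2, H2⟩ := rb_hc2 n M (4 * Λ0) (by linarith)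
  set K := K1 + K2 + 100 with hK
  refine ⟨K, by linarith, ?_⟩
  intro Ω hN hF Q R hR hKR u hu hp A hA hAΛ j x hx hxj
  have hM0 : 0 < M := by linarith
  have hΛ00 : 0 < Λ0 := by linarith
  have hR10 : 100 * R ≤ diam Ω := by nlinarith
  have hsi : ∀ i : ℕ, 0 < R / 2 ^ i ∧ R / 2 ^ i ≤ R := fun i =>
    ⟨by positivity, div_le_self hR.le (one_le_pow₀ (by norm_num))⟩
  have hdx : dist x Q < R := hx.2
  have hdA : dist A Q < R := hA.2
  have hsel : ∀ i : ℕ, ∃ B ∈ Ω, dist B x ≤ 2 * (R / 2 ^ i) ∧ R / 2 ^ i / M ≤ infDist B (frontier Ω) ∧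
      (R / 2 ^ i ≤ infDist x (frontier Ω) → B = x) := fun i =>
    rb_ck hN hF (subset_closure hx.1) (hsi i).1 (by linarith [(hsi i).2])
  choose B b1 b2 b3 b4 using hsel
  have hBQ : ∀ i, dist (B i) Q ≤ 3 * R := fun i => by
    linarith [dist_triangle (B i) x Q, b2 i, (hsi i).2]
  have huA : 0 ≤ u A := hp A ⟨hA.1, by rw [mem_ball]; nlinarith⟩
  have huB : ∀ i, 0 ≤ u (B i) := fun i => hp _ ⟨b1 i, by rw [mem_ball]; nlinarith [hBQ i]⟩
  have hdv : R / Λ0 ≤ R := div_le_self hR.le (by linarith)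
  have main : ∀ i, u (B i) ≤ K ^ (i + 1) * u A ∧ u A ≤ K ^ (i + 1) * u (B i) := by
    intro i
    induction i with
    | zero =>
      have c3 : K2 * (R / Λ0) ≤ K2 * R := by gcongr
      have b20 := b2 0
      have b30 := b3 0
      simp only [pow_zero, div_one] at b20 b30
      have := H2 Ω hN A hA.1 (B 0) (b1 0) (R / Λ0) (by positivity) (by
          rw [div_le_iff₀ hΛ00]
          have : 0 ≤ infDist A (frontier Ω) := infDist_nonneg
          nlinarith)
        ((div_le_div_of_nonneg_left hR.le hM0 hΛM).trans b30)
        (by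
          have e : 4 * Λ0 * (R / Λ0) = 4 * R := by field_simp
          rw [e]
          rw [dist_comm]
          have := dist_triangle (B 0) x A
          have := dist_triangle x Q A
          rw [dist_comm Q A] at this
          linarith)
        (by
          have e : 4 * Λ0 * (R / Λ0) = 4 * R := by field_simp
          rw [e]; linarith) Q (K * R) (by nlinarith) (by nlinarith [hBQ 0]) u hu hp
      constructor
      · refine this.1.trans ?_
        rw [zero_add, pow_one]
        gcongr; linarith
      · refine this.2.trans ?_
        rw [zero_add, pow_one]
        have := huB 0
        gcongr; linarith
    | succ i ih =>
      set s := R / 2 ^ i with hs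
      have hs0 := (hsi i).1
      have hsR := (hsi i).2
      have e2 : R / 2 ^ (i + 1) = s / 2 := by rw [hs, pow_succ]; field_simp
      have b2' := b2 (i + 1)
      have b3' := b3 (i + 1)
      rw [e2] at b2' b3'
      have e1 : s / 2 / M = s / (2 * M) := by field_simp
      rw [e1] at b3'
      have hle : s / (2 * M) ≤ R := (div_le_self hs0.le (by linarith)).trans hsR
      have c3 : K1 * (s / (2 * M)) ≤ K1 * R := by gcongr
      have e : 6 * M * (s / (2 * M)) = 3 * s := by field_simp; ring
      have := H1 Ω hN (B i) (b1 i) (B (i + 1)) (b1 _) (s / (2 * M)) (by positivity)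
        ((div_le_div_of_nonneg_left hs0.le hM0 (by linarith)).trans (b3 i)) b3'
        (by
          rw [e]
          have := dist_triangle (B i) x (B (i + 1))
          rw [dist_comm x] at this
          linarith [b2 i])
        (by rw [e]; linarith) Q (K * R) (by nlinarith [hBQ i]) (by nlinarith [hBQ (i + 1)]) u hu hp
      have h1 := huB i
      have h2 := huB (i + 1)
      have hK0 : 0 ≤ K := by linarith
      have hKK : K1 ≤ K := by linarith
      constructor
      · calc _ ≤ K1 * u (B i) := this.1
          _ ≤ K * (K ^ (i + 1) * u A) := by
            gcongr; exact ih.1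
          _ = _ := by ring
      · calc _ ≤ K ^ (i + 1) * u (B i) := ih.2
          _ ≤ K ^ (i + 1) * (K * u (B (i + 1))) := by
            gcongr
            exact this.2.trans (by gcongr)
          _ = _ := by ring
  have := main j
  rwa [b4 j (by rw [div_le_iff₀ (by positivity)]; linarith)] at this

open MeasureTheory Metric Set
open scoped RealInnerProductSpace ENNReal NNReal Topology

lemma rb_seq {N : ℕ → ℝ} {κ c B : ℝ} (hκ : 1 ≤ κ) (hB0 : 0 ≤ B) (hB : ∀ j, N j ≤ B)
    (h : ∀ j, N j ≤ c * κ ^ j + 1 / (2 * κ) * N (j + 1)) : N 0 ≤ 2 * c := by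
  have h1 : ∀ j, N 0 ≤ 2 * c * (1 - (1 / 2) ^ j) + (1 / (2 * κ)) ^ j * N j := by
    intro j
    induction j with
    | zero => simp
    | succ j ih =>
      have : (1 / (2 * κ)) ^ j * N j ≤ (1 / (2 * κ)) ^ j * (c * κ ^ j + 1 / (2 * κ) * N (j + 1)) := by
        gcongr; exact h j
      have e : (1 / (2 * κ)) ^ j * (c * κ ^ j + 1 / (2 * κ) * N (j + 1)) =
          c * (1 / 2) ^ j + (1 / (2 * κ)) ^ (j + 1) * N (j + 1) := by
        have e1 : (1 / (2 * κ)) ^ j * κ ^ j = (1 / 2) ^ j := by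
          rw [← mul_pow]; congr 1; field_simp
        rw [pow_succ (1 / (2 * κ)), ← e1]; ring
      rw [pow_succ (1 / 2 : ℝ)]
      linarith
  have h2 : ∀ j : ℕ, N 0 ≤ 2 * c * (1 - (1 / 2) ^ j) + (1 / 2) ^ j * B := by
    intro j
    refine (h1 j).trans ?_
    have a1 : (1 / (2 * κ)) ^ j * N j ≤ (1 / (2 * κ)) ^ j * B := by gcongr; exact hB j
    have a2 : (1 / (2 * κ)) ^ j * B ≤ (1 / 2) ^ j * B := by gcongr; linarith
    linarith
  have ht : Filter.Tendsto (fun j : ℕ => 2 * c * (1 - (1 / 2 : ℝ) ^ j) + (1 / 2) ^ j * B) Filter.atTop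
      (𝓝 (2 * c * (1 - 0) + 0 * B)) := by
    have := tendsto_pow_atTop_nhds_zero_of_lt_one (r := (1 / 2 : ℝ)) (by norm_num) (by norm_num)
    exact ((this.const_sub 1).const_mul _).add (this.mul_const B)
  have := ge_of_tendsto' ht h2
  linarith

set_option maxHeartbeats 1600000 in
lemma rb_carleson (n : ℕ) (M Λ : ℝ) : ∃ K : ℝ, 1 ≤ K ∧ ∀ (Ω : Set (EuclideanSpace ℝ (Fin n)))
    (σ : Measure (EuclideanSpace ℝ (Fin n))) (a : ℝ), RbDom M Ω σ a →
    ∀ (Q : EuclideanSpace ℝ (Fin n)) (R : ℝ), 0 < R → K * R < diam Ω →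
    ∀ u : EuclideanSpace ℝ (Fin n) → ℝ, RbSol Ω σ a Q (K * R) u →
    (∀ z ∈ Ω ∩ ball Q (K * R), 0 ≤ u z) → ∀ A ∈ Ω ∩ ball Q R, R ≤ Λ * infDist A (frontier Ω) →
    IntegrableOn (fun z => u z ^ 4) (Ω ∩ ball Q R) ∧
    ∫ z in Ω ∩ ball Q R, u z ^ 4 ≤ K * R ^ n * u A ^ 4 := by
  obtain ⟨K1, hK1, HG⟩ := rb_growth n M (2 * Λ)
  obtain ⟨L, hL, HD⟩ := rb_decay n M
  obtain ⟨L0, hL0, HC⟩ := rb_cacc n M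
  set κ := K1 ^ 4 with hκ
  have hκ1 : 1 ≤ κ := one_le_pow₀ hK1
  obtain ⟨m, hm⟩ := exists_pow_lt_of_lt_one (show (0 : ℝ) < 1 / (16 * κ) by positivity)
    (show (1 / 2 : ℝ) < 1 by norm_num)
  obtain ⟨i0, hi0⟩ := pow_unbounded_of_one_lt (4 * m * L) (show (1 : ℝ) < 2 by norm_num)
  set V := (volume (ball (0 : EuclideanSpace ℝ (Fin n)) 1)).toReal with hV
  have hV0 : 0 ≤ V := ENNReal.toReal_nonneg
  set c1 := 8 * κ ^ (i0 + 1) * V * 2 ^ n with hc1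
  have hc10 : 0 ≤ c1 := by positivity
  set K := 2 * K1 + 2 * L + 2 * c1 + 3 with hK
  refine ⟨K, by linarith, ?_⟩
  intro Ω σ a hD Q R hR hKR u hu hp A hA hAΛ
  have hOm := hD.nta.isOpen.measurableSet
  have h2R : 2 * R < K * R := by
    have : 2 < K := by linarith
    gcongr
  have hsubK : Ω ∩ ball Q (2 * R) ⊆ Ω ∩ ball Q (K * R) :=
    inter_subset_inter_right _ (ball_subset_ball h2R.le)
  have hK1R : K1 * (2 * R) ≤ K * R := by
    have : K1 * 2 ≤ K := by linarith
    rw [← mul_assoc]; gcongr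
  have hs1 : Ω ∩ ball Q (K1 * (2 * R)) ⊆ Ω ∩ ball Q (K * R) :=
    inter_subset_inter_right _ (ball_subset_ball hK1R)
  have hA2 : A ∈ Ω ∩ ball Q (2 * R) := ⟨hA.1, ball_subset_ball (by linarith) hA.2⟩
  have huA : 0 ≤ u A := hp A (hsubK hA2)
  have grow : ∀ i : ℕ, ∀ x ∈ Ω ∩ ball Q (2 * R), 2 * R ≤ 2 ^ i * infDist x (frontier Ω) →
      u x ≤ K1 ^ (i + 1) * u A := fun i x hx h =>
    (HG Ω hD.nta hD.fr Q (2 * R) (by linarith) (by linarith) u (fun z hz => hu.harmonic z (hs1 hz))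
      (fun z hz => hp z (hs1 hz)) A hA2 (by linarith) i x hx h).1
  have hcacc := fun l (hl : 0 ≤ l) => HC Ω σ a Q (K * R) u hD.nta hD.bdd hD.fr hD.dpos hD.fin hD.apos
    hu l 0 (2 * R) hl le_rfl (by linarith) h2R
  have hmS : ∀ r, MeasurableSet (Ω ∩ ball Q r) := fun r => hOm.inter measurableSet_ball
  have i4 : IntegrableOn (fun z => u z ^ 4) (Ω ∩ ball Q (2 * R)) := by
    refine (hcacc 0 le_rfl).1.congr_fun (fun z hz => ?_) (hmS _)
    simp only [sub_zero]
    rw [max_eq_left (hp z (hsubK hz))]; ring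
  have hvol : ∀ r, 0 < r → volume.real (Ω ∩ ball Q r) ≤ V * r ^ n := by
    intro r hr
    rw [Measure.real]
    calc _ ≤ (volume (ball Q r)).toReal :=
          ENNReal.toReal_mono measure_ball_lt_top.ne (measure_mono inter_subset_right)
      _ = V * r ^ n := by
          rw [Measure.addHaar_ball_of_pos _ _ hr, ENNReal.toReal_mul, ENNReal.toReal_ofReal (by positivity),
            finrank_euclideanSpace, Fintype.card_fin, mul_comm]
  set ρ : ℕ → ℝ := fun j => (2 - (1 / 2) ^ j) * R with hρ
  have hρ1 : ∀ j, R ≤ ρ j := fun j => by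
    have : (1 / 2 : ℝ) ^ j ≤ 1 := pow_le_one₀ (by norm_num) (by norm_num)
    simp only [hρ]; nlinarith only [this, hR]
  have hρ2 : ∀ j, ρ j ≤ 2 * R := fun j => by
    have : (0 : ℝ) < (1 / 2 : ℝ) ^ j := by positivity
    simp only [hρ]; nlinarith only [this, hR]
  have hmono : ∀ r1 r2, r1 ≤ r2 → r2 ≤ 2 * R →
      ∫ z in Ω ∩ ball Q r1, u z ^ 4 ≤ ∫ z in Ω ∩ ball Q r2, u z ^ 4 := fun r1 r2 h h' =>
    setIntegral_mono_set (i4.mono_set (inter_subset_inter_right _ (ball_subset_ball h')))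
      (Filter.Eventually.of_forall fun z => by
        show (0 : ℝ) ≤ u z ^ 4
        positivity)
      (Filter.Eventually.of_forall (inter_subset_inter_right _ (ball_subset_ball h)))
  set c := c1 * R ^ n * u A ^ 4 with hc
  have hmain : (fun j => ∫ z in Ω ∩ ball Q (ρ j), u z ^ 4) 0 ≤ 2 * c := by
    refine rb_seq (B := ∫ z in Ω ∩ ball Q (2 * R), u z ^ 4) hκ1
      (integral_nonneg fun z => by positivity) (fun j => hmono _ _ (hρ2 j) le_rfl) fun j => ?_
    set i := j + i0 with hi
    set l := K1 ^ (i + 1) * u A with hl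
    have hl0 : 0 ≤ l := by positivity
    set η := 2 * R / 2 ^ i with hη
    have hη0 : 0 < η := by positivity
    have hη2 : η ≤ 2 * R := div_le_self (by linarith) (one_le_pow₀ (by norm_num))
    have hstep : ρ j + m * (L * η) ≤ ρ (j + 1) := by
      have e : ρ (j + 1) = ρ j + R / 2 * (1 / 2) ^ j := by
        simp only [hρ, pow_succ]; ring
      rw [e]
      have e2 : m * (L * η) = (4 * m * L) / 2 ^ i0 * (R / 2 * (1 / 2) ^ j) := by
        rw [hη, hi, pow_add, one_div, inv_pow]; field_simp; norm_num
      rw [e2]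
      have : (4 * m * L) / 2 ^ i0 ≤ 1 := by rw [div_le_one (by positivity)]; exact hi0.le
      have : (4 * m * L) / 2 ^ i0 * (R / 2 * (1 / 2) ^ j) ≤ 1 * (R / 2 * (1 / 2) ^ j) := by gcongr
      linarith
    have hst2 : ρ j + m * (L * η) ≤ 2 * R := hstep.trans (hρ2 _)
    have is := (hcacc l hl0).1
    have hdec := HD Ω σ a hD Q (K * R) u hu l η (ρ j) hl0 hη0 (hR.le.trans (hρ1 j)) (by
        have : L * η ≤ L * (2 * R) := by gcongr
        have h9 : L * 2 * R ≤ K * R := by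
          have : L * 2 ≤ K := by linarith
          gcongr
        linarith only [this, h9, hKR]) m
      (by linarith) (fun z hz hzη => grow i z ⟨hz.1, ball_subset_ball hst2 hz.2⟩ (by
        rw [hη, div_le_iff₀ (by positivity)] at hzη; linarith))
    have hs4 : ∀ z ∈ Ω ∩ ball Q (2 * R), ((max (u z - l) 0) ^ 2) ^ 2 ≤ u z ^ 4 := by
      intro z hz
      have h0 := hp z (hsubK hz)
      have : max (u z - l) 0 ≤ u z := max_le (by linarith) h0
      have h00 : 0 ≤ max (u z - l) 0 := le_max_right _ _
      calc _ = (max (u z - l) 0) ^ 4 := by ring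
        _ ≤ _ := by gcongr
    have hu4 : ∀ z ∈ Ω ∩ ball Q (2 * R), u z ^ 4 ≤ 8 * l ^ 4 + 8 * ((max (u z - l) 0) ^ 2) ^ 2 := by
      intro z hz
      have h0 := hp z (hsubK hz)
      have h1 : u z ≤ l + max (u z - l) 0 := by linarith [le_max_left (u z - l) 0]
      have h00 : 0 ≤ max (u z - l) 0 := le_max_right _ _
      set s := max (u z - l) 0
      calc u z ^ 4 ≤ (l + s) ^ 4 := by gcongr
        _ = ((l + s) ^ 2) ^ 2 := by ring
        _ ≤ (2 * l ^ 2 + 2 * s ^ 2) ^ 2 := by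
          gcongr; nlinarith only [sq_nonneg (l - s)]
        _ ≤ _ := by nlinarith only [sq_nonneg (l ^ 2 - s ^ 2)]
    have hsubj : Ω ∩ ball Q (ρ j) ⊆ Ω ∩ ball Q (2 * R) :=
      inter_subset_inter_right _ (ball_subset_ball (hρ2 j))
    have hsubj1 : Ω ∩ ball Q (ρ j + m * (L * η)) ⊆ Ω ∩ ball Q (2 * R) :=
      inter_subset_inter_right _ (ball_subset_ball hst2)
    have hcon : IntegrableOn (fun _ : EuclideanSpace ℝ (Fin n) => 8 * l ^ 4) (Ω ∩ ball Q (ρ j)) :=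
      integrableOn_const ((measure_mono inter_subset_right).trans_lt measure_ball_lt_top).ne
    have isj : IntegrableOn (fun z => 8 * ((max (u z - l) 0) ^ 2) ^ 2) (Ω ∩ ball Q (ρ j)) :=
      (is.mono_set hsubj).const_mul 8
    have t1 : ∫ z in Ω ∩ ball Q (ρ j), u z ^ 4 ≤
        8 * l ^ 4 * (V * (2 * R) ^ n) + 8 * ∫ z in Ω ∩ ball Q (ρ j), ((max (u z - l) 0) ^ 2) ^ 2 := by
      calc _ ≤ ∫ z in Ω ∩ ball Q (ρ j), (8 * l ^ 4 + 8 * ((max (u z - l) 0) ^ 2) ^ 2) :=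
            setIntegral_mono_on (i4.mono_set hsubj) (hcon.add isj) (hmS _)
              fun z hz => hu4 z (hsubj hz)
        _ = volume.real (Ω ∩ ball Q (ρ j)) * (8 * l ^ 4) +
            8 * ∫ z in Ω ∩ ball Q (ρ j), ((max (u z - l) 0) ^ 2) ^ 2 := by
            rw [integral_add hcon isj, setIntegral_const, integral_const_mul, smul_eq_mul]
        _ ≤ _ := by
            have h1 : volume.real (Ω ∩ ball Q (ρ j)) ≤ V * (2 * R) ^ n := by
              refine (hvol (ρ j) (hR.trans_le (hρ1 j))).trans ?_
              have := hρ1 j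
              have := hρ2 j
              have : 0 ≤ ρ j := by linarith
              gcongr
            have : volume.real (Ω ∩ ball Q (ρ j)) * (8 * l ^ 4) ≤ (V * (2 * R) ^ n) * (8 * l ^ 4) := by
              gcongr
            linarith
    have t2 : ∫ z in Ω ∩ ball Q (ρ j + m * (L * η)), ((max (u z - l) 0) ^ 2) ^ 2 ≤
        ∫ z in Ω ∩ ball Q (ρ (j + 1)), u z ^ 4 :=
      (setIntegral_mono_on (is.mono_set hsubj1) (i4.mono_set hsubj1) (hmS _)
        fun z hz => hs4 z (hsubj1 hz)).trans (hmono _ _ hstep (hρ2 _))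
    set N1 := ∫ z in Ω ∩ ball Q (ρ (j + 1)), u z ^ 4
    have hN1 : 0 ≤ N1 := integral_nonneg fun z => by positivity
    have t3 : 8 * ((1 / 2) ^ m * ∫ z in Ω ∩ ball Q (ρ j + m * (L * η)), ((max (u z - l) 0) ^ 2) ^ 2) ≤
        1 / (2 * κ) * N1 := by
      calc _ ≤ 8 * (1 / (16 * κ) * N1) := by gcongr
        _ = _ := by field_simp; ring
    have e : 8 * l ^ 4 * (V * (2 * R) ^ n) = c * κ ^ j := by
      have e1 : l ^ 4 = κ ^ j * κ ^ (i0 + 1) * u A ^ 4 := by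
        rw [hl, mul_pow, hκ, ← pow_mul, ← pow_mul, ← pow_mul, ← pow_add, hi]; congr 2; ring
      rw [e1, hc, hc1, mul_pow]; ring
    linarith
  have hρ0 : ρ 0 = R := by simp [hρ]; ring
  simp only [hρ0] at hmain
  refine ⟨i4.mono_set (inter_subset_inter_right _ (ball_subset_ball (by linarith))), hmain.trans ?_⟩
  rw [hc]
  have : 0 ≤ R ^ n * u A ^ 4 := by positivity
  nlinarith only [this, hc10, hK1, hL, hK]

open MeasureTheory Metric Set
open scoped RealInnerProductSpace ENNReal NNReal Topology

lemma rb_harm_comb {n : ℕ} {S : Set (EuclideanSpace ℝ (Fin n))} {u v : EuclideanSpace ℝ (Fin n) → ℝ}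
    (hu : IsHarmonicOn u S) (hv : IsHarmonicOn v S) (b c : ℝ) :
    IsHarmonicOn (fun z => b * u z + c * v z) S := by
  intro x hx
  obtain ⟨u1, u2⟩ := hu x hx
  obtain ⟨v1, v2⟩ := hv x hx
  have u3 : ContDiffAt ℝ 2 (fun z => b * u z) x := contDiffAt_const.mul u1
  have v3 : ContDiffAt ℝ 2 (fun z => c * v z) x := contDiffAt_const.mul v1
  refine ⟨u3.add v3, ?_⟩
  have e : iteratedFDeriv ℝ 2 (fun z => b * u z + c * v z) x =
      b • iteratedFDeriv ℝ 2 u x + c • iteratedFDeriv ℝ 2 v x := by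
    have h1 := iteratedFDeriv_add_apply (i := 2) u3 v3
    have h2 := iteratedFDeriv_const_smul_apply (i := 2) (a := b) u1
    have h3 := iteratedFDeriv_const_smul_apply (i := 2) (a := c) v1
    rw [← h2, ← h3]
    exact h1
  rw [e]
  simp only [ContinuousMultilinearMap.add_apply, ContinuousMultilinearMap.smul_apply, smul_eq_mul]
  rw [Finset.sum_add_distrib, ← Finset.mul_sum, ← Finset.mul_sum, u2, v2]
  simp

lemma RbSol.comb {n : ℕ} {Ω : Set (EuclideanSpace ℝ (Fin n))}
    {σ : Measure (EuclideanSpace ℝ (Fin n))} {a : ℝ} {Q : EuclideanSpace ℝ (Fin n)} {ρ : ℝ}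
    {u v : EuclideanSpace ℝ (Fin n) → ℝ} (hO : IsOpen Ω) (hb : Bornology.IsBounded Ω)
    (hσ : σ (frontier Ω) ≠ ⊤) (hu : RbSol Ω σ a Q ρ u)
    (hv : RbSol Ω σ a Q ρ v) (b c : ℝ) : RbSol Ω σ a Q ρ (fun z => b * u z + c * v z) := by
  have hg : ∀ x ∈ Ω ∩ ball Q ρ, gradient (fun z => b * u z + c * v z) x =
      b • gradient u x + c • gradient v x := by
    intro x hx
    have h1 := ((hu.harmonic x hx).1.differentiableAt (by norm_num)).hasFDerivAt.const_mul b
    have h2 := ((hv.harmonic x hx).1.differentiableAt (by norm_num)).hasFDerivAt.const_mul c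
    unfold gradient
    rw [(h1.fun_add h2).fderiv, map_add]
    simp
  have hm : ∀ r, MeasurableSet (Ω ∩ ball Q r) := fun r => hO.measurableSet.inter measurableSet_ball
  refine ⟨(continuousOn_const.mul hu.contOn).add (continuousOn_const.mul hv.contOn),
    rb_harm_comb hu.harmonic hv.harmonic b c, ?_, ?_⟩
  · intro ρ' hρ'
    have i : IntegrableOn (fun X => 2 * b ^ 2 * ‖gradient u X‖ ^ 2 + 2 * c ^ 2 * ‖gradient v X‖ ^ 2)
        (Ω ∩ ball Q ρ') :=
      Integrable.add ((hu.grad_L2 ρ' hρ').const_mul _) ((hv.grad_L2 ρ' hρ').const_mul _)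
    refine Integrable.mono' i ((rb_grad_meas _).norm.pow_const 2).aestronglyMeasurable ?_
    filter_upwards [ae_restrict_mem (hm ρ')] with x hx
    rw [hg x ⟨hx.1, ball_subset_ball hρ'.le hx.2⟩, Real.norm_eq_abs, abs_of_nonneg (by positivity)]
    have h1 := norm_add_le (b • gradient u x) (c • gradient v x)
    have e1 : ‖b • gradient u x‖ ^ 2 = b ^ 2 * ‖gradient u x‖ ^ 2 := by
      rw [norm_smul, mul_pow, Real.norm_eq_abs, sq_abs]
    have e2 : ‖c • gradient v x‖ ^ 2 = c ^ 2 * ‖gradient v x‖ ^ 2 := by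
      rw [norm_smul, mul_pow, Real.norm_eq_abs, sq_abs]
    nlinarith [sq_nonneg (‖b • gradient u x‖ - ‖c • gradient v x‖),
      norm_nonneg (b • gradient u x + c • gradient v x)]
  · intro φ p1 p2 p3
    obtain ⟨ρ', h', hs⟩ := exists_lt_subset_ball (isClosed_tsupport φ) p3
    have hφI : Integrable (fun X => ‖gradient φ X‖ ^ 2) := by
      have h1 : Continuous fun z => ‖gradient φ z‖ ^ 2 := by
        simp only [rb_norm_grad]
        have := p1.continuous_fderiv (by simp)
        fun_prop
      refine h1.integrable_of_hasCompactSupport (p2.mono' ?_)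
      intro x hx
      by_contra h
      apply hx
      have := notMem_tsupport_iff_eventuallyEq.1 h
      simp only [rb_norm_grad]
      rw [this.fderiv_eq]
      simp
    have hz : ∀ w : EuclideanSpace ℝ (Fin n) → ℝ, ∀ x ∈ Ω \ (Ω ∩ ball Q ρ'),
        ⟪gradient w x, gradient φ x⟫ = 0 := by
      intro w x hx
      have : x ∉ tsupport φ := fun h => hx.2 ⟨hx.1, hs h⟩
      rw [inner_gradient_right, (notMem_tsupport_iff_eventuallyEq.1 this).fderiv_eq]
      simp
    have hred : ∀ w : EuclideanSpace ℝ (Fin n) → ℝ, ∫ X in Ω, ⟪gradient w X, gradient φ X⟫ =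
        ∫ X in Ω ∩ ball Q ρ', ⟪gradient w X, gradient φ X⟫ := fun w =>
      setIntegral_eq_of_subset_of_forall_sdiff_eq_zero hO.measurableSet inter_subset_left (hz w)
    have iu := rb_inner_int (hu.grad_L2 ρ' h') hφI.integrableOn
    have iv := rb_inner_int (hv.grad_L2 ρ' h') hφI.integrableOn
    have e1 : ∫ X in Ω, ⟪gradient (fun z => b * u z + c * v z) X, gradient φ X⟫ =
        b * (∫ X in Ω, ⟪gradient u X, gradient φ X⟫) + c * ∫ X in Ω, ⟪gradient v X, gradient φ X⟫ := by
      rw [hred, hred, hred, ← integral_const_mul, ← integral_const_mul,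
        ← integral_add (iu.const_mul b) (iv.const_mul c)]
      refine setIntegral_congr_fun (hm ρ') fun x hx => ?_
      show ⟪gradient (fun z => b * u z + c * v z) x, gradient φ x⟫ = _
      rw [hg x ⟨hx.1, ball_subset_ball h'.le hx.2⟩, inner_add_left, inner_smul_left, inner_smul_left]
      simp
    have hbI : ∀ w : EuclideanSpace ℝ (Fin n) → ℝ, ContinuousOn w (closure Ω ∩ ball Q ρ) →
        IntegrableOn (fun P => w P * φ P) (frontier Ω) σ := by
      intro w hw
      haveI : IsFiniteMeasure (σ.restrict (frontier Ω)) := ⟨by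
        rw [Measure.restrict_apply_univ]; exact hσ.lt_top⟩
      have hK : IsCompact (frontier Ω ∩ tsupport φ) := p2.inter_left isClosed_frontier
      have h1 : IntegrableOn (fun P => w P * φ P) (frontier Ω ∩ tsupport φ) (σ.restrict (frontier Ω)) := by
        refine ContinuousOn.integrableOn_compact hK ?_
        refine (hw.mono fun x hx => ⟨frontier_subset_closure hx.1, p3 hx.2⟩).mul
          p1.continuous.continuousOn
      have h2 : IntegrableOn (fun P => w P * φ P) (frontier Ω) (σ.restrict (frontier Ω)) := by
        refine h1.of_forall_sdiff_eq_zero isClosed_frontier.measurableSet fun x hx => ?_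
        have : x ∉ tsupport φ := fun h => hx.2 ⟨hx.1, h⟩
        rw [image_eq_zero_of_notMem_tsupport this, mul_zero]
      rwa [IntegrableOn, Measure.restrict_restrict isClosed_frontier.measurableSet, inter_self] at h2
    have e2 : ∫ P in frontier Ω, (b * u P + c * v P) * φ P ∂σ =
        b * (∫ P in frontier Ω, u P * φ P ∂σ) + c * ∫ P in frontier Ω, v P * φ P ∂σ := by
      rw [← integral_const_mul, ← integral_const_mul,
        ← integral_add ((hbI u hu.contOn).const_mul b) ((hbI v hv.contOn).const_mul c)]
      refine integral_congr_ae (Filter.Eventually.of_forall fun x => ?_)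
      simp only
      ring
    rw [e1, e2]
    have w1 := hu.weak φ p1 p2 p3
    have w2 := hv.weak φ p1 p2 p3
    linear_combination b * w1 + c * w2

open MeasureTheory Metric Set
open scoped RealInnerProductSpace ENNReal NNReal Topology

lemma rb_harm_const {n : ℕ} (S : Set (EuclideanSpace ℝ (Fin n))) :
    IsHarmonicOn (fun _ : EuclideanSpace ℝ (Fin n) => (1 : ℝ)) S := by
  intro x _
  refine ⟨contDiffAt_const, ?_⟩
  rw [iteratedFDeriv_const_of_ne (by norm_num)]
  simp

lemma rb_choose (n : ℕ) (a b c d : ℝ) (hc : 0 < c) (hd : 0 < d) : ∃ m : ℕ, 1 ≤ m ∧ a ≤ m ∧ b ≤ m ∧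
    (m : ℝ) ^ n * (1 / 2) ^ m ≤ c ∧ (1 / 2 : ℝ) ^ m ≤ d := by
  have h1 := tendsto_pow_const_mul_const_pow_of_lt_one n (r := (1 / 2 : ℝ)) (by norm_num) (by norm_num)
  have h2 := tendsto_pow_atTop_nhds_zero_of_lt_one (r := (1 / 2 : ℝ)) (by norm_num) (by norm_num)
  have h3 := tendsto_natCast_atTop_atTop (R := ℝ)
  obtain ⟨m, e1, e2, e3, e4, e5⟩ := ((Filter.eventually_ge_atTop 1).and
    ((h3.eventually_ge_atTop a).and ((h3.eventually_ge_atTop b).and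
    ((h1.eventually_le_const hc).and (h2.eventually_le_const hd))))).exists
  exact ⟨m, e1, e2, e3, e4, e5⟩

set_option maxHeartbeats 1600000 in
lemma rb_step (n : ℕ) (M : ℝ) : ∃ η θ : ℝ, 0 < η ∧ η ≤ 1 / 4 ∧ 0 < θ ∧
    ∀ (Ω : Set (EuclideanSpace ℝ (Fin n)))
    (σ : Measure (EuclideanSpace ℝ (Fin n))) (a : ℝ), RbDom M Ω σ a →
    ∀ (q : EuclideanSpace ℝ (Fin n)) (R α : ℝ), 0 < R → 100 * R < diam Ω → 0 < α →
    ∀ w : EuclideanSpace ℝ (Fin n) → ℝ, RbSol Ω σ a q (2 * R) w →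
    (∀ z ∈ Ω ∩ ball q R, η * R ≤ infDist z (frontier Ω) → w z ≤ - α) →
    (∫ z in Ω ∩ ball q R, (max (w z) 0) ^ 4 ≤ α ^ 4 * R ^ n) →
    (∀ z ∈ Ω ∩ ball q (R / 2), η * (R / 2) ≤ infDist z (frontier Ω) → w z ≤ - (θ * α)) ∧
    (∫ z in Ω ∩ ball q (R / 2), (max (w z) 0) ^ 4 ≤ (θ * α) ^ 4 * (R / 2) ^ n) := by
  by_cases hM : 1 < M
  swap
  · exact ⟨1 / 4, 1, by norm_num, by norm_num, by norm_num, fun Ω σ a hD => absurd hD.nta.M_gt_one hM⟩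
  obtain ⟨L, hL, HD⟩ := rb_decay n M
  obtain ⟨L0, hL0, HC⟩ := rb_cacc n M
  obtain ⟨K, hK, HH⟩ := rb_hc n M (4 * M) (by linarith)
  have hκ := rbκ_pos n
  set τ := 1 / (2 * K) with hτ
  have hτ0 : 0 < τ := by positivity
  have hτ1 : τ ≤ 1 := by
    rw [hτ, div_le_one (by positivity)]; linarith
  obtain ⟨m, m1, m2, m3, m4, m5⟩ := rb_choose n K (2 * M)
    ((τ / 2) ^ 4 * rbκ n * (1 / (16 * L * K)) ^ n) (τ ^ 4 * (1 / 2) ^ n) (by positivity) (by positivity)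
  have m0 : (1 : ℝ) ≤ m := by exact_mod_cast m1
  have mp : (0 : ℝ) < m := by linarith
  set η := 1 / (4 * L * m) with hη
  have hη0 : 0 < η := by positivity
  have hLm : (m : ℝ) ≤ L * m := le_mul_of_one_le_left mp.le hL
  have e1 : η * (L * m) = 1 / 4 := by rw [hη]; field_simp
  have hη4 : η ≤ 1 / 4 := by
    rw [← e1]; exact le_mul_of_one_le_right hη0.le (m0.trans hLm)
  have hKη : K * η ≤ 1 / 4 := by
    rw [← e1, mul_comm]; exact mul_le_mul_of_nonneg_left (m2.trans hLm) hη0.le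
  have hMη : 8 * M * η ≤ 1 := by
    have := mul_le_mul_of_nonneg_left (m3.trans hLm) hη0.le
    linarith only [this, e1]
  have hm4 : (1 / 2 : ℝ) ^ m ≤ (τ / 2) ^ 4 * rbκ n * (η / (4 * K)) ^ n := by
    have e2 : η / (4 * K) = (1 / (16 * L * K)) / m := by rw [hη]; field_simp; norm_num
    rw [e2, div_pow (1 / (16 * L * K)), ← mul_div_assoc, le_div_iff₀ (by positivity)]
    linarith
  refine ⟨η, τ, hη0, hη4, hτ0, ?_⟩
  intro Ω σ a hD q R α hR hRd hα w hw H1 H2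
  have hO := hD.nta.isOpen
  have hmS : ∀ r, MeasurableSet (Ω ∩ ball q r) := fun r => hO.measurableSet.inter measurableSet_ball
  have i4 : IntegrableOn (fun z => (max (w z) 0) ^ 4) (Ω ∩ ball q R) := by
    refine (HC Ω σ a q (2 * R) w hD.nta hD.bdd hD.fr hD.dpos hD.fin hD.apos hw 0 0 R le_rfl le_rfl hR
      (by linarith)).1.congr_fun (fun z hz => ?_) (hmS _)
    simp only [sub_zero]
    ring
  have hrad : 3 * R / 4 + m * (L * (η * R)) = R := by
    have : m * (L * (η * R)) = (η * (L * m)) * R := by ring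
    rw [this, e1]; ring
  have hdec : ∫ z in Ω ∩ ball q (3 * R / 4), (max (w z) 0) ^ 4 ≤ (1 / 2) ^ m * (α ^ 4 * R ^ n) := by
    have h := HD Ω σ a hD q (2 * R) w hw 0 (η * R) (3 * R / 4) le_rfl (by positivity) (by positivity)
      (by
        have : η * (L * 1) ≤ η * (L * m) := by gcongr
        nlinarith only [this, e1, hR, hRd]) m (by linarith) (fun z hz hzη => by
        rw [hrad] at hz
        linarith [H1 z hz hzη])
    rw [hrad] at h
    have e : ∀ z, ((max (w z - 0) 0) ^ 2) ^ 2 = (max (w z) 0) ^ 4 := fun z => by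
      rw [sub_zero]; ring
    simp only [e] at h
    refine h.trans ?_
    gcongr
  have hmono : ∀ S : Set (EuclideanSpace ℝ (Fin n)), S ⊆ Ω ∩ ball q (3 * R / 4) →
      ∫ z in S, (max (w z) 0) ^ 4 ≤ (1 / 2) ^ m * (α ^ 4 * R ^ n) := fun S hS => by
    refine le_trans (setIntegral_mono_set
      (i4.mono_set (inter_subset_inter_right _ (ball_subset_ball (by linarith))))
      (Filter.Eventually.of_forall fun z => ?_) (Filter.Eventually.of_forall hS)) hdec
    show (0 : ℝ) ≤ max (w z) 0 ^ 4
    positivity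
  constructor
  · intro x hx hxη
    have hxq := mem_ball.1 hx.2
    rcases le_or_gt (η * R) (infDist x (frontier Ω)) with hc | hc
    · have := H1 x ⟨hx.1, ball_subset_ball (by linarith) hx.2⟩ hc
      nlinarith only [this, hτ1, hα]
    obtain ⟨A, hA, hAx, hAd, -⟩ := rb_ck hD.nta hD.fr (subset_closure hx.1)
      (show 0 < M * (η * R) by positivity) (by nlinarith only [hMη, hR, hRd])
    rw [mul_div_cancel_left₀ _ (by linarith : M ≠ 0)] at hAd
    have hMR : 8 * M * η * R ≤ R := by nlinarith only [hMη, hR]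
    have hKR : K * η * R ≤ R / 4 := by nlinarith only [hKη, hR]
    have hA2 : A ∈ Ω ∩ ball q R := by
      refine ⟨hA, mem_ball.2 ?_⟩
      have := dist_triangle A x q
      linarith only [this, hAx, hxq, hMR, hR]
    have hwA := H1 A hA2 hAd
    set t := η * R / (4 * K) with ht
    have ht0 : 0 < t := by positivity
    have ht1 : t ≤ R / 16 := by
      rw [ht, div_le_iff₀ (by positivity)]; nlinarith only [hη4, hR, hK]
    have ht2 : η * R / 2 / K = 2 * t := by rw [ht]; field_simp; norm_num
    have hsub : Ω ∩ ball x (K * (η * R / 2)) ⊆ Ω ∩ ball q (5 * R / 8) := by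
      intro z hz
      refine ⟨hz.1, mem_ball.2 ?_⟩
      have h1 := mem_ball.1 hz.2
      have := dist_triangle z x q
      linarith
    have key := HH Ω hD.nta x hx.1 A hA (η * R / 2) (by positivity) (by linarith)
      (by have : 0 < η * R := by positivity
          linarith only [hAd, this])
      (by rw [dist_comm]; linarith) (by linarith) (fun z => (τ * α) * 1 + (-1) * w z)
      (rb_harm_comb (rb_harm_const _) (fun z hz => hw.harmonic z
        ⟨hz.1, ball_subset_ball (by linarith) (hsub hz).2⟩) _ _) (fun z hz hzd => by
        rw [ht2] at hzd
        have hzq := mem_ball.1 (hsub hz).2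
        have hb : ball z (2 * t) ⊆ Ω ∩ ball q (3 * R / 4) := by
          refine subset_inter ((ball_subset_ball hzd).trans (rb_ball hz.1)) (ball_subset_ball' ?_)
          linarith
        have hs := rb_sup (w := w) (x := z) (r := t) (R := 2 * t) (α := τ / 2 * α) ht0 (by linarith)
          (fun y hy => hw.harmonic y ⟨(hb hy).1, ball_subset_ball (by linarith) (hb hy).2⟩)
          (by positivity) (by
            refine (hmono _ ((ball_subset_ball (by linarith)).trans hb)).trans ?_
            have e : t ^ n = (η / (4 * K)) ^ n * R ^ n := by
              rw [← mul_pow]; congr 1; rw [ht]; ring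
            calc (1 / 2 : ℝ) ^ m * (α ^ 4 * R ^ n)
                ≤ ((τ / 2) ^ 4 * rbκ n * (η / (4 * K)) ^ n) * (α ^ 4 * R ^ n) := by gcongr
              _ = _ := by rw [e, mul_pow]; ring)
        linarith)
    have hKτ : K * τ = 1 / 2 := by rw [hτ]; field_simp
    have hKK : K * w x ≤ K * -(τ * α) := by
      have : K * -(τ * α) = -(K * τ) * α := by ring
      rw [this, hKτ]
      have e3 : K * (τ * α * 1 + -1 * w x) = (K * τ) * α - K * w x := by ring
      rw [e3, hKτ] at key
      have : 0 < τ * α := by positivity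
      linarith
    exact le_of_mul_le_mul_left hKK (by linarith)
  · refine (hmono _ (inter_subset_inter_right _ (ball_subset_ball (by linarith)))).trans ?_
    calc (1 / 2 : ℝ) ^ m * (α ^ 4 * R ^ n) ≤ (τ ^ 4 * (1 / 2) ^ n) * (α ^ 4 * R ^ n) := by gcongr
      _ = (τ * α) ^ 4 * (R / 2) ^ n := by
        have : (R / 2) ^ n = (1 / 2) ^ n * R ^ n := by
          rw [← mul_pow]; congr 1; ring
        rw [this, mul_pow]; ring

open MeasureTheory Metric Set
open scoped RealInnerProductSpace ENNReal NNReal Topology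

set_option maxHeartbeats 1600000 in
lemma rb_final (n : ℕ) (M : ℝ) : ∃ C Kt : ℝ, 1 ≤ C ∧ 1 < Kt ∧ ∀ (Ω : Set (EuclideanSpace ℝ (Fin n)))
    (σ : Measure (EuclideanSpace ℝ (Fin n))) (a : ℝ), RbDom M Ω σ a →
    ∀ Q ∈ frontier Ω, ∀ r : ℝ, 0 < r → r < diam Ω / Kt →
    ∀ u v : EuclideanSpace ℝ (Fin n) → ℝ, IsRobinLocalSolution Ω σ a Q (Kt * r) u →
    IsRobinLocalSolution Ω σ a Q (Kt * r) v →
    ∀ A ∈ Ω ∩ ball Q r, r / M ≤ infDist A (frontier Ω) → ∀ X ∈ Ω ∩ ball Q r,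
    u X * v A ≤ C * (u A * v X) := by
  obtain ⟨η, θ, hη, hη4, hθ, HS⟩ := rb_step n M
  obtain ⟨K1, hK1, HG⟩ := rb_growth n M (4 * M)
  obtain ⟨K2, hK2, HC⟩ := rb_carleson n M (4 * M)
  obtain ⟨j, hj⟩ := pow_unbounded_of_one_lt (1 / η) (show (1 : ℝ) < 2 by norm_num)
  set P := K1 ^ (j + 1) with hP
  have hP1 : 1 ≤ P := one_le_pow₀ hK1
  set C := P * (P + K2) with hC
  have hC1 : 1 ≤ C := by rw [hC]; nlinarith only [hP1, hK2]
  set Kt := 2 + 4 * (K1 + K2 + 100) with hKt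
  refine ⟨C, Kt, hC1, by linarith, ?_⟩
  intro Ω σ a hD Q hQ r hr hrd u v hu hv A hA hAd X hX
  have hM := hD.nta.M_gt_one
  have hM0 : 0 < M := by linarith
  rw [lt_div_iff₀ (by linarith)] at hrd
  obtain ⟨q, hq, hXq⟩ := rb_near hD.fr X
  have hδ0 : 0 < infDist X (frontier Ω) := rb_ipos hD.nta.isOpen hD.fr hX.1
  have hδQ : infDist X (frontier Ω) ≤ dist X Q := infDist_le_dist_of_mem hQ
  have hXQ := mem_ball.1 hX.2
  have hAQ := mem_ball.1 hA.2
  have hqQ : dist q Q < 2 * r := by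
    have := dist_triangle q X Q
    rw [dist_comm q X] at this
    linarith
  set R := 4 * r with hR
  have hR0 : 0 < R := by positivity
  have hAq : A ∈ Ω ∩ ball q R := by
    refine ⟨hA.1, mem_ball.2 ?_⟩
    have := dist_triangle A Q q
    rw [dist_comm Q q] at this
    linarith
  have hXq' : X ∈ Ω ∩ ball q R := ⟨hX.1, mem_ball.2 (by linarith)⟩
  have hAR : R ≤ 4 * M * infDist A (frontier Ω) := by
    rw [div_le_iff₀ hM0] at hAd
    rw [hR]; linarith
  have mono : ∀ K, K ≤ K1 + K2 + 100 → dist q Q + K * R ≤ Kt * r := by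
    intro K hK
    have : K * R ≤ (K1 + K2 + 100) * R := by gcongr
    rw [hKt, hR] at *
    linarith
  have monoS : ∀ K, K ≤ K1 + K2 + 100 → Ω ∩ ball q (K * R) ⊆ Ω ∩ ball Q (Kt * r) := by
    intro K hK
    refine inter_subset_inter_right _ (ball_subset_ball' ?_)
    linarith [mono K hK]
  have hdi : ∀ K, K ≤ K1 + K2 + 100 → K * R < diam Ω := by
    intro K hK
    have := mono K hK
    have := dist_nonneg (x := q) (y := Q)
    linarith
  have su : RbSol Ω σ a Q (Kt * r) u := ⟨hu.contOn, hu.harmonic, hu.grad_L2, hu.weak⟩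
  have sv : RbSol Ω σ a Q (Kt * r) v := ⟨hv.contOn, hv.harmonic, hv.grad_L2, hv.weak⟩
  have pu : ∀ z ∈ Ω ∩ ball Q (Kt * r), 0 ≤ u z := fun z hz => hu.nonneg z ⟨subset_closure hz.1, hz.2⟩
  have pv : ∀ z ∈ Ω ∩ ball Q (Kt * r), 0 ≤ v z := fun z hz => hv.nonneg z ⟨subset_closure hz.1, hz.2⟩
  have k1 : K1 ≤ K1 + K2 + 100 := by linarith
  have k2 : K2 ≤ K1 + K2 + 100 := by linarith
  have gu := HG Ω hD.nta hD.fr q R hR0 (hdi K1 k1) u (fun z hz => hu.harmonic z (monoS K1 k1 hz))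
    (fun z hz => pu z (monoS K1 k1 hz)) A hAq hAR
  have gv := HG Ω hD.nta hD.fr q R hR0 (hdi K1 k1) v (fun z hz => hv.harmonic z (monoS K1 k1 hz))
    (fun z hz => pv z (monoS K1 k1 hz)) A hAq hAR
  have cu := HC Ω σ a hD q R hR0 (hdi K2 k2) u (su.mono (mono K2 k2))
    (fun z hz => pu z (monoS K2 k2 hz)) A hAq hAR
  have hs1 : Ω ∩ ball q R ⊆ Ω ∩ ball Q (Kt * r) := by
    have := monoS 1 (by linarith)
    rwa [one_mul] at this
  have uA := pu A (hs1 hAq)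
  have vA := pv A (hs1 hAq)
  have vX := pv X (hs1 hXq')
  have uX := pu X (hs1 hXq')
  have hRHS : 0 ≤ C * (u A * v X) := by positivity
  rcases vA.eq_or_lt with hv0 | hv0
  · rw [← hv0, mul_zero]; exact hRHS
  rcases uA.eq_or_lt with hu0 | hu0
  · obtain ⟨i, hi⟩ := pow_unbounded_of_one_lt (R / infDist X (frontier Ω)) (show (1 : ℝ) < 2 by norm_num)
    rw [div_lt_iff₀ hδ0] at hi
    have := (gu i X hXq' hi.le).1
    rw [← hu0, mul_zero] at this
    have : u X = 0 := le_antisymm this uX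
    rw [this, zero_mul]; exact hRHS
  set w : EuclideanSpace ℝ (Fin n) → ℝ := fun z => (u A)⁻¹ * u z + (-(C * (v A)⁻¹)) * v z with hw
  have sw : RbSol Ω σ a Q (Kt * r) w := RbSol.comb hD.nta.isOpen hD.bdd hD.fin su sv _ _
  have iter : ∀ k : ℕ, (∀ z ∈ Ω ∩ ball q (R * (1 / 2) ^ k),
      η * (R * (1 / 2) ^ k) ≤ infDist z (frontier Ω) → w z ≤ - (θ ^ k * K2)) ∧
      (∫ z in Ω ∩ ball q (R * (1 / 2) ^ k), (max (w z) 0) ^ 4 ≤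
        (θ ^ k * K2) ^ 4 * (R * (1 / 2) ^ k) ^ n) := by
    intro k
    induction k with
    | zero =>
      simp only [pow_zero, mul_one, one_mul]
      constructor
      · intro z hz hzη
        have h1 : R ≤ 2 ^ j * infDist z (frontier Ω) := by
          rw [div_lt_iff₀ hη] at hj
          calc R ≤ (2 ^ j * η) * R := le_mul_of_one_le_left hR0.le hj.le
            _ = 2 ^ j * (η * R) := by ring
            _ ≤ _ := by gcongr
        have a1 : (u A)⁻¹ * u z ≤ P := by
          rw [inv_mul_le_iff₀ hu0, mul_comm]; exact (gu j z hz h1).1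
        have a2 : 1 ≤ P * ((v A)⁻¹ * v z) := by
          have := (gv j z hz h1).2
          calc (1 : ℝ) = (v A)⁻¹ * v A := by field_simp
            _ ≤ (v A)⁻¹ * (K1 ^ (j + 1) * v z) := by gcongr
            _ = _ := by ring
        have e : w z = (u A)⁻¹ * u z - (P + K2) * (P * ((v A)⁻¹ * v z)) := by
          simp only [hw, hC]; ring
        have : (P + K2) * 1 ≤ (P + K2) * (P * ((v A)⁻¹ * v z)) := by gcongr
        rw [e]; linarith
      · have hi : IntegrableOn (fun z => ((u A)⁻¹) ^ 4 * u z ^ 4) (Ω ∩ ball q R) := cu.1.const_mul _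
        have hb : ∀ z ∈ Ω ∩ ball q R, (max (w z) 0) ^ 4 ≤ ((u A)⁻¹) ^ 4 * u z ^ 4 := by
          intro z hz
          have z1 := pu z (hs1 hz)
          have z2 := pv z (hs1 hz)
          rw [← mul_pow]
          refine pow_le_pow_left₀ (le_max_right _ _) (max_le ?_ (by positivity)) 4
          have : 0 ≤ C * (v A)⁻¹ * v z := by positivity
          simp only [hw]; linarith
        have hm := (hD.nta.isOpen.measurableSet.inter (measurableSet_ball (x := q) (ε := R)))
        calc ∫ z in Ω ∩ ball q R, (max (w z) 0) ^ 4
            ≤ ∫ z in Ω ∩ ball q R, ((u A)⁻¹) ^ 4 * u z ^ 4 :=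
              integral_mono_of_nonneg (Filter.Eventually.of_forall fun z => by
                show (0 : ℝ) ≤ max (w z) 0 ^ 4
                positivity) hi
                ((ae_restrict_mem hm).mono fun z hz => hb z hz)
          _ = ((u A)⁻¹) ^ 4 * ∫ z in Ω ∩ ball q R, u z ^ 4 := integral_const_mul _ _
          _ ≤ ((u A)⁻¹) ^ 4 * (K2 * R ^ n * u A ^ 4) := by gcongr; exact cu.2
          _ = K2 * R ^ n := by field_simp
          _ ≤ K2 ^ 4 * R ^ n := by
            gcongr
            exact le_self_pow₀ hK2 (by norm_num)
    | succ k ih =>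
      have hp1 : (1 / 2 : ℝ) ^ k ≤ 1 := pow_le_one₀ (by norm_num) (by norm_num)
      have hRk : R * (1 / 2) ^ k ≤ R := mul_le_of_le_one_right hR0.le hp1
      have h100 := hdi 100 (by linarith)
      have h2 := mono 2 (by linarith)
      have := HS Ω σ a hD q (R * (1 / 2) ^ k) (θ ^ k * K2) (by positivity) (by linarith) (by positivity) w
        (sw.mono (by linarith)) ih.1 ih.2
      have e1 : R * (1 / 2) ^ k / 2 = R * (1 / 2) ^ (k + 1) := by rw [pow_succ]; ring
      have e2 : θ * (θ ^ k * K2) = θ ^ (k + 1) * K2 := by rw [pow_succ]; ring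
      rwa [e1, e2] at this
  obtain ⟨k, hk1, hk2⟩ := exists_nat_pow_near_of_lt_one (x := 2 * infDist X (frontier Ω) / R)
    (y := (1 / 2 : ℝ)) (by positivity) (by rw [div_le_one hR0]; linarith) (by norm_num) (by norm_num)
  rw [lt_div_iff₀ hR0, pow_succ] at hk1
  rw [div_le_iff₀ hR0] at hk2
  have hpos : 0 < R * (1 / 2) ^ k := by positivity
  have fin := (iter k).1 X ⟨hX.1, mem_ball.2 (by linarith)⟩
    (by nlinarith only [hk1, hpos, hη4])
  have hneg : 0 ≤ θ ^ k * K2 := by positivity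
  have hle : (u A)⁻¹ * u X + (-(C * (v A)⁻¹)) * v X ≤ 0 := by
    have : w X ≤ 0 := by linarith
    exact this
  have e : u X * v A - C * (u A * v X) = (u A * v A) * ((u A)⁻¹ * u X + (-(C * (v A)⁻¹)) * v X) := by
    field_simp; ring
  have : (u A * v A) * ((u A)⁻¹ * u X + (-(C * (v A)⁻¹)) * v X) ≤ 0 :=
    mul_nonpos_of_nonneg_of_nonpos (by positivity) hle
  linarith

/-- Boundary comparison principle for nonnegative solutions of the homogeneous
Robin problem: any two such solutions in `B(Q, K̃r)` are comparable on `Ω ∩ B(Q,r)` after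
normalization at a corkscrew point, with constants independent of `a`. -/
theorem stmt_15 (n : ℕ) (hn : 3 ≤ n) (M Cσ d cd : ℝ) :
    ∃ C Kt : ℝ, 0 < C ∧ 1 < Kt ∧
      ∀ (Ω : Set (EuclideanSpace ℝ (Fin n))) (σ : MeasureTheory.Measure (EuclideanSpace ℝ (Fin n))),
        IsMixedPair M Cσ d cd Ω σ →
        ∀ a : ℝ, 0 < a →
          ∀ Q ∈ frontier Ω, ∀ r : ℝ, 0 < r → r < Metric.diam Ω / Kt →
            ∀ u v : EuclideanSpace ℝ (Fin n) → ℝ,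
              IsRobinLocalSolution Ω σ a Q (Kt * r) u →
              IsRobinLocalSolution Ω σ a Q (Kt * r) v →
              ∀ A ∈ Ω ∩ Metric.ball Q r, r / M ≤ Metric.infDist A (frontier Ω) →
                ∀ X ∈ Ω ∩ Metric.ball Q r,
                  C⁻¹ * (u X * v A) ≤ u A * v X ∧ u A * v X ≤ C * (u X * v A) := by
  obtain ⟨C, Kt, hC, hKt, H⟩ := rb_final n M
  refine ⟨C, Kt, by linarith, hKt, ?_⟩
  intro Ω σ hP a ha Q hQ r hr hrd u v hu hv A hA hAd X hX
  have hdp : 0 < diam Ω := by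
    have := (lt_div_iff₀ (by linarith : (0 : ℝ) < Kt)).1 hrd
    have : 0 < r * Kt := by positivity
    linarith
  have hD : RbDom M Ω σ a := ⟨hP.nta, hP.bounded, ⟨Q, hQ⟩, hdp, hP.finite, ha⟩
  have h1 := H Ω σ a hD Q hQ r hr hrd u v hu hv A hA hAd X hX
  have h2 := H Ω σ a hD Q hQ r hr hrd v u hv hu A hA hAd X hX
  refine ⟨?_, ?_⟩
  · rw [inv_mul_le_iff₀ (by linarith)]; exact h1
  · have e1 : u A * v X = v X * u A := mul_comm _ _
    have e2 : u X * v A = v A * u X := mul_comm _ _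
    rw [e1, e2]; exact h2
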